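/- arXiv:2008.01234 — 3 statements merged into one kernel-verified Lean document; each statement's English description precedes it below -/
import Mathlib

section
/- Let Z be the k-subalgebra of D~ generated by x21^p, x2^{2p}, u21^p, u2^{2p}, g^p, g'^p, ζ^p - ζ. Then Z is isomorphic as a k-algebra to k[T, T^{-1}][X1, X2, X3, X4, X5] (Laurent polynomials in T over a polynomial ring in five variables), via an isomorphism sending T ↦ g^p, X1 ↦ x21^p, X2 ↦ x2^{2p}, X3 ↦ -(ζ^p - ζ), X4 ↦ u21^p, X5 ↦ u2^{2p}. In particular Z is an integral domain. -/
/-!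
The Hopf algebra `D~` (double of the super Jordan plane, bosonization stripped),
presented by generators x1, x2, u1, u2, g, g' (= g⁻¹), ζ and the relations
listed in the paper.  We realize it as `RingQuot` of the relation `Rel` on the
free algebra on 7 generators.
-/

namespace SuperJordanDouble

variable (k : Type) [Field k]

noncomputable def fx1 : FreeAlgebra k (Fin 7) := FreeAlgebra.ι k 0
noncomputable def fx2 : FreeAlgebra k (Fin 7) := FreeAlgebra.ι k 1
noncomputable def fu1 : FreeAlgebra k (Fin 7) := FreeAlgebra.ι k 2
noncomputable def fu2 : FreeAlgebra k (Fin 7) := FreeAlgebra.ι k 3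
noncomputable def fg  : FreeAlgebra k (Fin 7) := FreeAlgebra.ι k 4
noncomputable def fgi : FreeAlgebra k (Fin 7) := FreeAlgebra.ι k 5
noncomputable def fz  : FreeAlgebra k (Fin 7) := FreeAlgebra.ι k 6
noncomputable def fx21 : FreeAlgebra k (Fin 7) := fx1 k * fx2 k + fx2 k * fx1 k
noncomputable def fu21 : FreeAlgebra k (Fin 7) := fu1 k * fu2 k + fu2 k * fu1 k

/-- The defining relations of `D~`. -/
inductive Rel : FreeAlgebra k (Fin 7) → FreeAlgebra k (Fin 7) → Prop
  | x1sq  : Rel (fx1 k * fx1 k) 0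
  | x2x21 : Rel (fx2 k * fx21 k) (fx21 k * fx2 k + fx1 k * fx21 k)
  | u1sq  : Rel (fu1 k * fu1 k) 0
  | u2u21 : Rel (fu2 k * fu21 k) (fu21 k * fu2 k + fu1 k * fu21 k)
  | ggi   : Rel (fg k * fgi k) 1
  | gig   : Rel (fgi k * fg k) 1
  | zg    : Rel (fz k * fg k) (fg k * fz k)
  | gx1   : Rel (fg k * fx1 k) (fx1 k * fg k)
  | gx2   : Rel (fg k * fx2 k) (fx2 k * fg k - fx1 k * fg k)
  | u1g   : Rel (fu1 k * fg k) (fg k * fu1 k)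
  | u2g   : Rel (fu2 k * fg k) (fg k * fu2 k - fg k * fu1 k)
  | zx1   : Rel (fz k * fx1 k) (fx1 k * fz k + fx1 k)
  | zx2   : Rel (fz k * fx2 k) (fx2 k * fz k + fx2 k)
  | u1z   : Rel (fu1 k * fz k) (fz k * fu1 k + fu1 k)
  | u2z   : Rel (fu2 k * fz k) (fz k * fu2 k + fu2 k)
  | u1x1  : Rel (fu1 k * fx1 k) (-(fx1 k * fu1 k))
  | u1x2  : Rel (fu1 k * fx2 k) (-(fx2 k * fu1 k) + 1 - fg k)
  | u2x1  : Rel (fu2 k * fx1 k) (-(fx1 k * fu2 k) + 1 - fg k + fx1 k * fu1 k)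
  | u2x2  : Rel (fu2 k * fx2 k) (-(fx2 k * fu2 k) + fg k * fz k + fx2 k * fu1 k)

/-- The algebra `D~`. -/
abbrev tD := RingQuot (Rel k)

noncomputable def x1 : tD k := RingQuot.mkAlgHom k (Rel k) (fx1 k)
noncomputable def x2 : tD k := RingQuot.mkAlgHom k (Rel k) (fx2 k)
noncomputable def u1 : tD k := RingQuot.mkAlgHom k (Rel k) (fu1 k)
noncomputable def u2 : tD k := RingQuot.mkAlgHom k (Rel k) (fu2 k)
noncomputable def g  : tD k := RingQuot.mkAlgHom k (Rel k) (fg k)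
noncomputable def gi : tD k := RingQuot.mkAlgHom k (Rel k) (fgi k)
noncomputable def z  : tD k := RingQuot.mkAlgHom k (Rel k) (fz k)
noncomputable def x21 : tD k := x1 k * x2 k + x2 k * x1 k
noncomputable def u21 : tD k := u1 k * u2 k + u2 k * u1 k

/-- `g^n` for `n : ℤ`, where negative powers are interpreted using `g' = g⁻¹`. -/
noncomputable def gpow (n : ℤ) : tD k :=
  if 0 ≤ n then g k ^ n.toNat else gi k ^ (-n).toNat

end SuperJordanDouble

namespace SuperJordanDouble

variable (k : Type) [Field k]

/-- The central subalgebra `Z` of `D~`. -/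
noncomputable def Zc (p : ℕ) : Subalgebra k (tD k) :=
  Algebra.adjoin k
    ({x21 k ^ p, x2 k ^ (2 * p), u21 k ^ p, u2 k ^ (2 * p),
      g k ^ p, gi k ^ p, z k ^ p - z k} : Set (tD k))

end SuperJordanDouble

namespace SuperJordanDouble

section Representation

variable {F : Type*} [Field F]

/-- The space carrying a family of representations of `tD k`: four copies (indexed by the monomials
`1, x1, u1, x1 u1`) of the functions on `ℤ⁴`, whose coordinates are the exponents of `x21`, `u21`, `g`
and the degree. -/
abbrev FockSpace (F : Type*) : Type _ := Fin 4 → ℤ → ℤ → ℤ → ℤ → F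

/-- The action of `x1`. -/
def opX1 : Module.End F (FockSpace F) where
  toFun f := ![0, f 0, 0, f 2]
  map_add' f h := by ext e; fin_cases e <;> simp
  map_smul' r f := by ext e; fin_cases e <;> simp

/-- The action of `u1`. -/
def opU1 : Module.End F (FockSpace F) where
  toFun f := ![0, 0, f 0, -f 1]
  map_add' f h := by ext e; fin_cases e <;> simp <;> ring
  map_smul' r f := by ext e; fin_cases e <;> simp

/-- The action of `x21`. -/
def opX21 : Module.End F (FockSpace F) where
  toFun f e i j l n := f e (i - 1) j l n
  map_add' _ _ := rfl
  map_smul' _ _ := rfl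

/-- The action of `u21`. -/
def opU21 : Module.End F (FockSpace F) where
  toFun f e i j l n := f e i (j - 1) l n
  map_add' _ _ := rfl
  map_smul' _ _ := rfl

/-- The action of `g`. -/
def opG : Module.End F (FockSpace F) where
  toFun f e i j l n := f e i j (l - 1) n
  map_add' _ _ := rfl
  map_smul' _ _ := rfl

/-- The action of `gi`. -/
def opGi : Module.End F (FockSpace F) where
  toFun f e i j l n := f e i j (l + 1) n
  map_add' _ _ := rfl
  map_smul' _ _ := rfl

/-- The action of `z`, with weight `a` at the origin. -/
def opZ (a : F) : Module.End F (FockSpace F) where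
  toFun f e i j l n := (![0, 1, -1, 0] e + 2 * i - 2 * j + n + a) * f e i j l n
  map_add' f h := by ext; simp; ring
  map_smul' r f := by ext; simp; ring

/-- The action of `x2`. -/
def opX2 : Module.End F (FockSpace F) where
  toFun f := ![
    fun i j l n => f 1 (i - 1) j l n + f 2 i j l n - f 2 i j (l - 1) n + f 0 i j (l - 1) (n - 1),
    fun i j l n => (i + l + 1) * f 0 i j l n - f 3 i j l n + f 3 i j (l - 1) n
      - f 1 i j (l - 1) (n - 1),
    fun i j l n => -((j + 1) * (f 0 i (j + 1) l n + f 0 i (j + 1) (l - 1) n))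
      + f 3 (i - 1) j l n - f 2 i j (l - 1) (n - 1),
    fun i j l n => (j + 1) * (f 1 i (j + 1) l n + f 1 i (j + 1) (l - 1) n)
      + (i + l + 1) * f 2 i j l n + f 3 i j (l - 1) (n - 1)]
  map_add' f h := by ext e; fin_cases e <;> simp <;> ring
  map_smul' r f := by ext e; fin_cases e <;> simp <;> ring

/-- The action of `u2`, with structure function `c`. -/
def opU2 (c : ℤ → F) : Module.End F (FockSpace F) where
  toFun f := ![
    fun i j l n => f 1 i j l n - f 1 i j (l - 1) n + f 2 i (j - 1) l n
      + c (n + 1) * f 0 i j l (n + 1),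
    fun i j l n => (i + 1) * (f 0 (i + 1) j l n + f 0 (i + 1) j (l - 1) n) - f 3 i (j - 1) l n
      - c (n + 1) * f 1 i j l (n + 1),
    fun i j l n => (j - l - 2 * i) * f 0 i j l n + f 3 i j l n - f 3 i j (l - 1) n
      - c (n + 1) * f 2 i j l (n + 1),
    fun i j l n => f 1 i j l n - (j - l - 2 * i) * f 1 i j l n
      + (i + 1) * (f 2 (i + 1) j l n + f 2 (i + 1) j (l - 1) n) + c (n + 1) * f 3 i j l (n + 1)]
  map_add' f h := by ext e; fin_cases e <;> simp <;> ring
  map_smul' r f := by ext e; fin_cases e <;> simp <;> ring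

theorem fockSpace_end_ext {S T : Module.End F (FockSpace F)}
    (h : ∀ f i j l n, S f 0 i j l n = T f 0 i j l n ∧ S f 1 i j l n = T f 1 i j l n ∧
      S f 2 i j l n = T f 2 i j l n ∧ S f 3 i j l n = T f 3 i j l n) : S = T := by
  refine LinearMap.ext fun f => funext fun e => funext fun i => funext fun j => funext fun l =>
    funext fun n => ?_
  obtain ⟨h0, h1, h2, h3⟩ := h f i j l n
  fin_cases e <;> assumption

@[simp] theorem opX1_apply_0 (f : FockSpace F) (i j l n : ℤ) :
    opX1 f 0 i j l n = 0 := rfl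

@[simp] theorem opX1_apply_1 (f : FockSpace F) (i j l n : ℤ) :
    opX1 f 1 i j l n = f 0 i j l n := rfl

@[simp] theorem opX1_apply_2 (f : FockSpace F) (i j l n : ℤ) :
    opX1 f 2 i j l n = 0 := rfl

@[simp] theorem opX1_apply_3 (f : FockSpace F) (i j l n : ℤ) :
    opX1 f 3 i j l n = f 2 i j l n := rfl

@[simp] theorem opU1_apply_0 (f : FockSpace F) (i j l n : ℤ) :
    opU1 f 0 i j l n = 0 := rfl

@[simp] theorem opU1_apply_1 (f : FockSpace F) (i j l n : ℤ) :
    opU1 f 1 i j l n = 0 := rfl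

@[simp] theorem opU1_apply_2 (f : FockSpace F) (i j l n : ℤ) :
    opU1 f 2 i j l n = f 0 i j l n := rfl

@[simp] theorem opU1_apply_3 (f : FockSpace F) (i j l n : ℤ) :
    opU1 f 3 i j l n = -f 1 i j l n := rfl

@[simp] theorem opX21_apply (f : FockSpace F) (e : Fin 4) (i j l n : ℤ) :
    opX21 f e i j l n = f e (i - 1) j l n := rfl

@[simp] theorem opU21_apply (f : FockSpace F) (e : Fin 4) (i j l n : ℤ) :
    opU21 f e i j l n = f e i (j - 1) l n := rfl

@[simp] theorem opG_apply (f : FockSpace F) (e : Fin 4) (i j l n : ℤ) :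
    opG f e i j l n = f e i j (l - 1) n := rfl

@[simp] theorem opGi_apply (f : FockSpace F) (e : Fin 4) (i j l n : ℤ) :
    opGi f e i j l n = f e i j (l + 1) n := rfl

@[simp] theorem opZ_apply_0 (a : F) (f : FockSpace F) (i j l n : ℤ) :
    opZ a f 0 i j l n = (0 + 2 * i - 2 * j + n + a) * f 0 i j l n := rfl

@[simp] theorem opZ_apply_1 (a : F) (f : FockSpace F) (i j l n : ℤ) :
    opZ a f 1 i j l n = (1 + 2 * i - 2 * j + n + a) * f 1 i j l n := rfl

@[simp] theorem opZ_apply_2 (a : F) (f : FockSpace F) (i j l n : ℤ) :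
    opZ a f 2 i j l n = (-1 + 2 * i - 2 * j + n + a) * f 2 i j l n := rfl

@[simp] theorem opZ_apply_3 (a : F) (f : FockSpace F) (i j l n : ℤ) :
    opZ a f 3 i j l n = (0 + 2 * i - 2 * j + n + a) * f 3 i j l n := rfl

@[simp] theorem opX2_apply_0 (f : FockSpace F) (i j l n : ℤ) :
    opX2 f 0 i j l n =
      f 1 (i - 1) j l n + f 2 i j l n - f 2 i j (l - 1) n + f 0 i j (l - 1) (n - 1) := rfl

@[simp] theorem opX2_apply_1 (f : FockSpace F) (i j l n : ℤ) :
    opX2 f 1 i j l n =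
      (i + l + 1) * f 0 i j l n - f 3 i j l n + f 3 i j (l - 1) n - f 1 i j (l - 1) (n - 1) := rfl

@[simp] theorem opX2_apply_2 (f : FockSpace F) (i j l n : ℤ) :
    opX2 f 2 i j l n =
      -((j + 1) * (f 0 i (j + 1) l n + f 0 i (j + 1) (l - 1) n)) + f 3 (i - 1) j l n - f 2 i j (l - 1) (n - 1) := rfl

@[simp] theorem opX2_apply_3 (f : FockSpace F) (i j l n : ℤ) :
    opX2 f 3 i j l n =
      (j + 1) * (f 1 i (j + 1) l n + f 1 i (j + 1) (l - 1) n) + (i + l + 1) * f 2 i j l n + f 3 i j (l - 1) (n - 1) := rfl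

@[simp] theorem opU2_apply_0 (c : ℤ → F) (f : FockSpace F) (i j l n : ℤ) :
    opU2 c f 0 i j l n =
      f 1 i j l n - f 1 i j (l - 1) n + f 2 i (j - 1) l n + c (n + 1) * f 0 i j l (n + 1) := rfl

@[simp] theorem opU2_apply_1 (c : ℤ → F) (f : FockSpace F) (i j l n : ℤ) :
    opU2 c f 1 i j l n =
      (i + 1) * (f 0 (i + 1) j l n + f 0 (i + 1) j (l - 1) n) - f 3 i (j - 1) l n - c (n + 1) * f 1 i j l (n + 1) := rfl

@[simp] theorem opU2_apply_2 (c : ℤ → F) (f : FockSpace F) (i j l n : ℤ) :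
    opU2 c f 2 i j l n =
      (j - l - 2 * i) * f 0 i j l n + f 3 i j l n - f 3 i j (l - 1) n - c (n + 1) * f 2 i j l (n + 1) := rfl

@[simp] theorem opU2_apply_3 (c : ℤ → F) (f : FockSpace F) (i j l n : ℤ) :
    opU2 c f 3 i j l n =
      f 1 i j l n - (j - l - 2 * i) * f 1 i j l n + (i + 1) * (f 2 (i + 1) j l n + f 2 (i + 1) j (l - 1) n) + c (n + 1) * f 3 i j l (n + 1) := rfl

theorem opX1_mul_opX2_add :
    opX1 * opX2 + opX2 * opX1 = (opX21 : Module.End F (FockSpace F)) := by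
  refine fockSpace_end_ext fun f i j l n => ⟨?_, ?_, ?_, ?_⟩ <;> simp

theorem opU1_mul_opU2_add (c : ℤ → F) :
    opU1 * opU2 c + opU2 c * opU1 = opU21 := by
  refine fockSpace_end_ext fun f i j l n => ⟨?_, ?_, ?_, ?_⟩ <;> simp <;> ring

theorem opU2_mul_opX2 (a : F) (c : ℤ → F) (hc : ∀ n : ℤ, c (n + 1) = a + n - c n) :
    opU2 c * opX2 = -(opX2 * opU2 c) + opG * opZ a + opX2 * opU1 := by
  refine fockSpace_end_ext fun f i j l n => ⟨?_, ?_, ?_, ?_⟩ <;> simp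
  · linear_combination f 0 i j (l - 1) n * hc n
  · linear_combination f 1 i j (l - 1) n * hc n
  · linear_combination f 2 i j (l - 1) n * hc n
  · linear_combination f 3 i j (l - 1) n * hc n

theorem opX1_mul_self :
    opX1 * opX1 = (0 : Module.End F (FockSpace F)) := by
  refine fockSpace_end_ext fun f i j l n => ⟨?_, ?_, ?_, ?_⟩ <;> simp

theorem opU1_mul_self :
    opU1 * opU1 = (0 : Module.End F (FockSpace F)) := by
  refine fockSpace_end_ext fun f i j l n => ⟨?_, ?_, ?_, ?_⟩ <;> simp

theorem opX2_mul_opX21 :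
    opX2 * opX21 = opX21 * opX2 + opX1 * (opX21 : Module.End F (FockSpace F)) := by
  refine fockSpace_end_ext fun f i j l n => ⟨?_, ?_, ?_, ?_⟩ <;> simp <;> ring

theorem opU2_mul_opU21 (c : ℤ → F) :
    opU2 c * opU21 = opU21 * opU2 c + opU1 * opU21 := by
  refine fockSpace_end_ext fun f i j l n => ⟨?_, ?_, ?_, ?_⟩ <;> simp <;> ring

theorem opG_mul_opGi :
    opG * opGi = (1 : Module.End F (FockSpace F)) := by
  refine fockSpace_end_ext fun f i j l n => ⟨?_, ?_, ?_, ?_⟩ <;> simp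

theorem opGi_mul_opG :
    opGi * opG = (1 : Module.End F (FockSpace F)) := by
  refine fockSpace_end_ext fun f i j l n => ⟨?_, ?_, ?_, ?_⟩ <;> simp

theorem opZ_mul_opG (a : F) :
    opZ a * opG = opG * opZ a := by
  refine fockSpace_end_ext fun f i j l n => ⟨?_, ?_, ?_, ?_⟩ <;> simp

theorem opG_mul_opX1 :
    opG * opX1 = opX1 * (opG : Module.End F (FockSpace F)) := by
  refine fockSpace_end_ext fun f i j l n => ⟨?_, ?_, ?_, ?_⟩ <;> simp

theorem opG_mul_opX2 :
    opG * opX2 = opX2 * (opG : Module.End F (FockSpace F)) - opX1 * opG := by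
  refine fockSpace_end_ext fun f i j l n => ⟨?_, ?_, ?_, ?_⟩ <;> simp <;> ring

theorem opU1_mul_opG :
    opU1 * opG = opG * (opU1 : Module.End F (FockSpace F)) := by
  refine fockSpace_end_ext fun f i j l n => ⟨?_, ?_, ?_, ?_⟩ <;> simp

theorem opU2_mul_opG (c : ℤ → F) :
    opU2 c * opG = opG * opU2 c - opG * opU1 := by
  refine fockSpace_end_ext fun f i j l n => ⟨?_, ?_, ?_, ?_⟩ <;> simp <;> ring

theorem opZ_mul_opX1 (a : F) :
    opZ a * opX1 = opX1 * opZ a + opX1 := by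
  refine fockSpace_end_ext fun f i j l n => ⟨?_, ?_, ?_, ?_⟩ <;> simp <;> ring

theorem opZ_mul_opX2 (a : F) :
    opZ a * opX2 = opX2 * opZ a + opX2 := by
  refine fockSpace_end_ext fun f i j l n => ⟨?_, ?_, ?_, ?_⟩ <;> simp <;> ring

theorem opU1_mul_opZ (a : F) :
    opU1 * opZ a = opZ a * opU1 + opU1 := by
  refine fockSpace_end_ext fun f i j l n => ⟨?_, ?_, ?_, ?_⟩ <;> simp <;> ring

theorem opU2_mul_opZ (a : F) (c : ℤ → F) :
    opU2 c * opZ a = opZ a * opU2 c + opU2 c := by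
  refine fockSpace_end_ext fun f i j l n => ⟨?_, ?_, ?_, ?_⟩ <;> simp <;> ring

theorem opU1_mul_opX1 :
    opU1 * opX1 = -(opX1 * (opU1 : Module.End F (FockSpace F))) := by
  refine fockSpace_end_ext fun f i j l n => ⟨?_, ?_, ?_, ?_⟩ <;> simp

theorem opU1_mul_opX2 :
    opU1 * opX2 = -(opX2 * opU1) + 1 - (opG : Module.End F (FockSpace F)) := by
  refine fockSpace_end_ext fun f i j l n => ⟨?_, ?_, ?_, ?_⟩ <;> simp <;> ring

theorem opU2_mul_opX1 (c : ℤ → F) :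
    opU2 c * opX1 = -(opX1 * opU2 c) + 1 - opG + opX1 * opU1 := by
  refine fockSpace_end_ext fun f i j l n => ⟨?_, ?_, ?_, ?_⟩ <;> simp <;> ring

end Representation

section PthPowers

variable {A : Type*} [Ring A] (p : ℕ) [hp : Fact p.Prime]

/-- If `w` is a divided-power string for the commutator with `e`, then in characteristic `p` the
element `e ^ p` commutes with the head of the string. -/
theorem commute_pow_char_of_string (k : Type*) [Field k] [CharP k p] [Algebra k A] (e : A)
    (w : ℕ → A) (h : ∀ n : ℕ, e * w n = w n * e + ((n : k) + 1) • w (n + 1)) : Commute (e ^ p) (w 0) := by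
  cases subsingleton_or_nontrivial A
  · exact Subsingleton.elim _ _
  have : CharP (Module.End k A) p :=
    charP_of_injective_algebraMap (algebraMap k (Module.End k A)).injective p
  have : CharP A p := charP_of_injective_algebraMap (algebraMap k A).injective p
  have hD : ∀ n : ℕ, ((LinearMap.mulLeft k e - LinearMap.mulRight k e) ^ n) (w 0) =
      (n.factorial : k) • w n := by
    intro n
    induction n with
    | zero => simp
    | succ n ih =>
      rw [pow_succ', Module.End.mul_apply, ih, map_smul, LinearMap.sub_apply,
        LinearMap.mulLeft_apply, LinearMap.mulRight_apply, h, add_sub_cancel_left, smul_smul,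
        Nat.factorial_succ, Nat.cast_mul, Nat.cast_succ, mul_comm]
  have := hD p
  rw [sub_pow_char_of_commute _ (LinearMap.commute_mulLeft_right (R := k) e e),
    LinearMap.pow_mulLeft, LinearMap.pow_mulRight,
    (CharP.cast_eq_zero_iff k p _).2 (hp.out.dvd_factorial.2 le_rfl)] at this
  simpa [sub_eq_zero, Commute, SemiconjBy] using this

theorem commute_pow_char_of_commute (k : Type*) [Field k] [CharP k p] [Algebra k A] {e y r : A}
    (h : e * y = y * e + r) (hr : Commute e r) : Commute (e ^ p) y := by
  refine commute_pow_char_of_string p k e (fun n => n.casesOn y fun m => m.casesOn r fun _ => 0)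
    fun n => ?_
  match n with
  | 0 => simpa using h
  | 1 => simpa using hr.eq
  | n + 2 => simp

theorem commute_pow_char_sub_self [CharP A p] {e y : A} (h : e * y = y * (e + 1)) :
    Commute (e ^ p - e) y := by
  have h' : SemiconjBy y (e + 1) e := h.symm
  have := (h'.pow_right p).eq
  rw [add_pow_char_of_commute _ (Commute.one_right e), one_pow] at this
  rw [Commute, SemiconjBy, sub_mul, mul_sub, ← this, h]
  noncomm_ring

theorem commute_pow_char_sub_self' [CharP A p] {e y : A} (h : y * e = (e + 1) * y) :
    Commute (e ^ p - e) y := by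
  have h' : SemiconjBy y e (e + 1) := h
  have := (h'.pow_right p).eq
  rw [add_pow_char_of_commute _ (Commute.one_right e), one_pow] at this
  rw [Commute, SemiconjBy, sub_mul, mul_sub, this, h]
  noncomm_ring

theorem commute_of_inverse {a b y : A} (hab : a * b = 1) (hba : b * a = 1) (h : Commute y a) :
    Commute y b := by
  let u : Aˣ := ⟨a, b, hab, hba⟩
  exact Commute.units_inv_right (u := u) h

end PthPowers

section Relations

variable (k : Type) [Field k]

theorem x1_mul_x1 : x1 k * x1 k = 0 := by
  simpa [x1] using RingQuot.mkAlgHom_rel k (Rel.x1sq (k := k))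

theorem x2_mul_x21 : x2 k * x21 k = x21 k * x2 k + x1 k * x21 k := by
  simpa [x1, x2, x21, fx21] using RingQuot.mkAlgHom_rel k (Rel.x2x21 (k := k))

theorem u1_mul_u1 : u1 k * u1 k = 0 := by
  simpa [u1] using RingQuot.mkAlgHom_rel k (Rel.u1sq (k := k))

theorem u2_mul_u21 : u2 k * u21 k = u21 k * u2 k + u1 k * u21 k := by
  simpa [u1, u2, u21, fu21] using RingQuot.mkAlgHom_rel k (Rel.u2u21 (k := k))

theorem g_mul_gi : g k * gi k = 1 := by
  simpa [g, gi] using RingQuot.mkAlgHom_rel k (Rel.ggi (k := k))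

theorem gi_mul_g : gi k * g k = 1 := by
  simpa [g, gi] using RingQuot.mkAlgHom_rel k (Rel.gig (k := k))

theorem z_mul_g : z k * g k = g k * z k := by
  simpa [g, z] using RingQuot.mkAlgHom_rel k (Rel.zg (k := k))

theorem g_mul_x1 : g k * x1 k = x1 k * g k := by
  simpa [g, x1] using RingQuot.mkAlgHom_rel k (Rel.gx1 (k := k))

theorem g_mul_x2 : g k * x2 k = x2 k * g k - x1 k * g k := by
  simpa [g, x1, x2] using RingQuot.mkAlgHom_rel k (Rel.gx2 (k := k))

theorem u1_mul_g : u1 k * g k = g k * u1 k := by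
  simpa [g, u1] using RingQuot.mkAlgHom_rel k (Rel.u1g (k := k))

theorem u2_mul_g : u2 k * g k = g k * u2 k - g k * u1 k := by
  simpa [g, u1, u2] using RingQuot.mkAlgHom_rel k (Rel.u2g (k := k))

theorem z_mul_x1 : z k * x1 k = x1 k * z k + x1 k := by
  simpa [z, x1] using RingQuot.mkAlgHom_rel k (Rel.zx1 (k := k))

theorem z_mul_x2 : z k * x2 k = x2 k * z k + x2 k := by
  simpa [z, x2] using RingQuot.mkAlgHom_rel k (Rel.zx2 (k := k))

theorem u1_mul_z : u1 k * z k = z k * u1 k + u1 k := by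
  simpa [z, u1] using RingQuot.mkAlgHom_rel k (Rel.u1z (k := k))

theorem u2_mul_z : u2 k * z k = z k * u2 k + u2 k := by
  simpa [z, u2] using RingQuot.mkAlgHom_rel k (Rel.u2z (k := k))

theorem u1_mul_x1 : u1 k * x1 k = -(x1 k * u1 k) := by
  simpa [x1, u1] using RingQuot.mkAlgHom_rel k (Rel.u1x1 (k := k))

theorem u1_mul_x2 : u1 k * x2 k = -(x2 k * u1 k) + 1 - g k := by
  simpa [x2, u1, g] using RingQuot.mkAlgHom_rel k (Rel.u1x2 (k := k))

theorem u2_mul_x1 : u2 k * x1 k = -(x1 k * u2 k) + 1 - g k + x1 k * u1 k := by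
  simpa [x1, u1, u2, g] using RingQuot.mkAlgHom_rel k (Rel.u2x1 (k := k))

theorem u2_mul_x2 : u2 k * x2 k = -(x2 k * u2 k) + g k * z k + x2 k * u1 k := by
  simpa [x2, u1, u2, g, z] using RingQuot.mkAlgHom_rel k (Rel.u2x2 (k := k))

theorem x21_mul_x1 : x21 k * x1 k = x1 k * x21 k := by
  unfold x21
  linear_combination (norm := skip) x2 k * x1_mul_x1 k - x1_mul_x1 k * x2 k
  grind

theorem g_mul_x21 : g k * x21 k = x21 k * g k := by
  unfold x21
  linear_combination (norm := skip) g_mul_x1 k * x2 k + x1 k * g_mul_x2 k +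
    g_mul_x2 k * x1 k + (x2 k - x1 k) * g_mul_x1 k - 2 * x1_mul_x1 k * g k
  grind

theorem u1_mul_x21 : u1 k * x21 k = x21 k * u1 k := by
  unfold x21
  linear_combination (norm := skip) u1_mul_x1 k * x2 k - x1 k * u1_mul_x2 k +
    u1_mul_x2 k * x1 k - x2 k * u1_mul_x1 k - g_mul_x1 k
  grind

theorem u2_mul_x21 :
    u2 k * x21 k = x21 k * u2 k - 2 * (x21 k * u1 k) + x1 k + x1 k * g k := by
  unfold x21
  linear_combination (norm := skip) u2_mul_x1 k * x2 k - x1 k * u2_mul_x2 k +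
    u2_mul_x2 k * x1 k - x2 k * u2_mul_x1 k + x1 k * u1_mul_x2 k + x2 k * u1_mul_x1 k
    + g k * z_mul_x1 k + g_mul_x1 k * (z k + 1) - g_mul_x2 k
  grind

theorem u21_mul_u1 : u21 k * u1 k = u1 k * u21 k := by
  unfold u21
  linear_combination (norm := skip) u2 k * u1_mul_u1 k - u1_mul_u1 k * u2 k
  grind

theorem u21_mul_g : u21 k * g k = g k * u21 k := by
  unfold u21
  linear_combination (norm := skip) u1 k * u2_mul_g k + u1_mul_g k * (u2 k - u1 k) +
    u2 k * u1_mul_g k + u2_mul_g k * u1 k - 2 * g k * u1_mul_u1 k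
  grind

theorem x2_sq_mul_x21 : x2 k ^ 2 * x21 k = x21 k * x2 k ^ 2 + x21 k ^ 2 := by
  have h := x2_mul_x21 k
  unfold x21 at h ⊢
  linear_combination (norm := skip) x2 k * h + h * x2 k - x1 k * h -
    x1_mul_x1 k * (x1 k * x2 k + x2 k * x1 k)
  grind

theorem x2_sq_mul_x1 : x2 k ^ 2 * x1 k = x1 k * x2 k ^ 2 + x1 k * x21 k := by
  have h := x2_mul_x21 k
  unfold x21 at h ⊢
  linear_combination (norm := skip) h
  grind

theorem x2_sq_mul_g : x2 k ^ 2 * g k = g k * x2 k ^ 2 + x21 k * g k := by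
  unfold x21
  linear_combination (norm := skip) - x2 k * g_mul_x2 k - g_mul_x2 k * x2 k + x1 k * g_mul_x2 k
    - x1_mul_x1 k * g k
  grind

theorem x2_sq_mul_u1 : x2 k ^ 2 * u1 k = u1 k * x2 k ^ 2 - x1 k * g k := by
  linear_combination (norm := skip) x2 k * u1_mul_x2 k - u1_mul_x2 k * x2 k + g_mul_x2 k
  grind

theorem x2_sq_mul_u2 : x2 k ^ 2 * u2 k =
    u2 k * x2 k ^ 2 + 2 * (x2 k ^ 2 * u1 k) + x1 k * g k * (z k + 1) - x2 k := by
  linear_combination (norm := skip) x2 k * u2_mul_x2 k - u2_mul_x2 k * x2 k - x2 k * u1_mul_x2 k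
    - g k * z_mul_x2 k - g_mul_x2 k * (z k + 1)
  grind

theorem z_mul_x2_sq : z k * x2 k ^ 2 = x2 k ^ 2 * z k + 2 * x2 k ^ 2 := by
  linear_combination (norm := skip) z_mul_x2 k * x2 k + x2 k * z_mul_x2 k
  grind

theorem x2_sq_mul_x21_pow (n : ℕ) :
    x2 k ^ 2 * x21 k ^ n = x21 k ^ n * x2 k ^ 2 + (n : k) • x21 k ^ (n + 1) := by
  induction n with
  | zero => simp
  | succ n ih =>
    rw [pow_succ (x21 k), ← mul_assoc, ih, add_mul, mul_assoc, x2_sq_mul_x21, mul_add,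
      smul_mul_assoc, ← mul_assoc, ← pow_succ, ← pow_add, ← pow_succ]
    push_cast
    module

theorem x2_sq_mul_x21_pow_mul_g (n : ℕ) : x2 k ^ 2 * (x21 k ^ n * g k) =
    x21 k ^ n * g k * x2 k ^ 2 + ((n : k) + 1) • (x21 k ^ (n + 1) * g k) := by
  rw [← mul_assoc, x2_sq_mul_x21_pow, add_mul, mul_assoc, x2_sq_mul_g, pow_succ (x21 k)]
  simp only [mul_add, smul_mul_assoc, mul_assoc]
  module

theorem x2_sq_mul_x1_mul_x21_pow_mul_g (n : ℕ) : x2 k ^ 2 * (x1 k * (x21 k ^ n * g k)) =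
    x1 k * (x21 k ^ n * g k) * x2 k ^ 2 + ((n : k) + 2) • (x1 k * (x21 k ^ (n + 1) * g k)) := by
  rw [← mul_assoc, x2_sq_mul_x1, add_mul, mul_assoc, x2_sq_mul_x21_pow_mul_g, pow_succ' (x21 k)]
  simp only [mul_add, mul_smul_comm, mul_assoc]
  module

theorem x21_pow_commute_u1 (n : ℕ) : Commute (x21 k ^ n) (u1 k) :=
  Commute.pow_left (u1_mul_x21 k).symm n

theorem x21_pow_commute_g (n : ℕ) : Commute (x21 k ^ n) (g k) :=
  Commute.pow_left (g_mul_x21 k).symm n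

theorem u21_pow_commute_g (n : ℕ) : Commute (u21 k ^ n) (g k) :=
  Commute.pow_left (u21_mul_g k) n

theorem commute_gi_pow {n : ℕ} {y : tD k} (h : Commute y (g k ^ n)) : Commute y (gi k ^ n) := by
  have hg : Commute (g k) (gi k) := (g_mul_gi k).trans (gi_mul_g k).symm
  refine commute_of_inverse ?_ ?_ h
  · rw [← hg.mul_pow, g_mul_gi, one_pow]
  · rw [← hg.symm.mul_pow, gi_mul_g, one_pow]

section Char

variable (p : ℕ) [hp : Fact p.Prime] [CharP k p]

theorem x2_sq_pow_char_commute_g : Commute ((x2 k ^ 2) ^ p) (g k) := by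
  have := commute_pow_char_of_string p k (x2 k ^ 2) (fun n => x21 k ^ n * g k)
    (x2_sq_mul_x21_pow_mul_g k)
  simpa using this

theorem x2_sq_pow_char_commute_u1 : Commute ((x2 k ^ 2) ^ p) (u1 k) := by
  obtain ⟨w, hw, hw'⟩ : ∃ w : ℕ → tD k, w 0 = u1 k ∧
      ∀ n, w (n + 1) = (-1 : k) • (x1 k * (x21 k ^ n * g k)) :=
    ⟨fun n => n.casesOn (u1 k) fun m => (-1 : k) • (x1 k * (x21 k ^ m * g k)), rfl, fun _ => rfl⟩
  rw [← hw]
  suffices h : ∀ n : ℕ, x2 k ^ 2 * w n = w n * x2 k ^ 2 + ((n : k) + 1) • w (n + 1) from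
    commute_pow_char_of_string p k (x2 k ^ 2) w h
  intro n
  cases n with
  | zero =>
    simp only [hw, hw', x2_sq_mul_u1, pow_zero, one_mul, Nat.cast_zero, zero_add, one_smul]
    module
  | succ n =>
    simp only [hw', mul_smul_comm, smul_mul_assoc, x2_sq_mul_x1_mul_x21_pow_mul_g]
    push_cast
    module

theorem x2_sq_pow_char_commute_u2 : Commute ((x2 k ^ 2) ^ p) (u2 k) := by
  obtain ⟨w, hw, hw', hw''⟩ : ∃ w : ℕ → tD k, w 0 = u2 k ∧
      w 1 = 2 * (x2 k ^ 2 * u1 k) + x1 k * g k * (z k + 1) - x2 k ∧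
      ∀ n, w (n + 2) = (-2 : k) • (x2 k ^ 2 * (x1 k * (x21 k ^ n * g k))) +
        x1 k * (x21 k ^ (n + 1) * g k) * z k +
        (2 * n + 3 : k) • (x1 k * (x21 k ^ (n + 1) * g k)) :=
    ⟨fun n => n.casesOn (u2 k) fun m => m.casesOn
      (2 * (x2 k ^ 2 * u1 k) + x1 k * g k * (z k + 1) - x2 k) fun n =>
      (-2 : k) • (x2 k ^ 2 * (x1 k * (x21 k ^ n * g k))) +
        x1 k * (x21 k ^ (n + 1) * g k) * z k +
        (2 * n + 3 : k) • (x1 k * (x21 k ^ (n + 1) * g k)), rfl, rfl, fun _ => rfl⟩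
  rw [← hw]
  suffices h : ∀ n : ℕ, x2 k ^ 2 * w n = w n * x2 k ^ 2 + ((n : k) + 1) • w (n + 1) from
    commute_pow_char_of_string p k (x2 k ^ 2) w h
  intro n
  match n with
  | 0 =>
    simp only [hw, hw', x2_sq_mul_u2, Nat.cast_zero, zero_add, one_smul]
    abel
  | 1 =>
    have h0 := x2_sq_mul_x1_mul_x21_pow_mul_g k 0
    have h1 := z_mul_x2_sq k
    have h2 := x2_sq_mul_u1 k
    have hw'' := hw'' 0
    simp only [pow_zero, one_mul, Nat.cast_zero, zero_add, pow_one] at h0 hw'' ⊢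
    rw [hw', one_add_one_eq_two, hw'']
    linear_combination (norm := skip) 2 * x2 k ^ 2 * h2 + h0 * (z k + 1) - x1 k * g k * h1 + 2 * h0
    simp only [mul_add, add_mul, mul_sub, sub_mul, smul_mul_assoc, mul_smul_comm, mul_assoc,
      two_mul, mul_one, Nat.cast_one, pow_two]
    module
  | n + 2 =>
    have h0 := x2_sq_mul_x1_mul_x21_pow_mul_g k n
    have h1 := x2_sq_mul_x1_mul_x21_pow_mul_g k (n + 1)
    have h := z_mul_x2_sq k
    rw [hw'', hw'' (n + 1)]
    linear_combination (norm := skip) (-2 : k) • (x2 k ^ 2 * h0) + h1 * z k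
      - x1 k * (x21 k ^ (n + 1) * g k) * h + (2 * (n : k) + 3) • h1 + 2 * h1
    simp only [mul_add, add_mul, smul_mul_assoc, mul_smul_comm, mul_assoc, two_mul]
    push_cast
    module

theorem x21_pow_char_commute_x2 : Commute (x21 k ^ p) (x2 k) := by
  refine commute_pow_char_of_commute p k (r := -(x1 k * x21 k)) ?_ ?_
  · rw [x2_mul_x21]; abel
  · refine (Commute.mul_right (b := x1 k) ?_ (Commute.refl _)).neg_right
    exact x21_mul_x1 k

theorem x21_pow_char_commute_u2 : Commute (x21 k ^ p) (u2 k) := by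
  refine commute_pow_char_of_commute p k (r := 2 * (x21 k * u1 k) - x1 k - x1 k * g k) ?_ ?_
  · rw [u2_mul_x21]; abel
  · have h1 : Commute (x21 k) (x1 k) := x21_mul_x1 k
    have h2 : Commute (x21 k) (u1 k) := (u1_mul_x21 k).symm
    have h3 : Commute (x21 k) (g k) := (g_mul_x21 k).symm
    exact ((((Commute.ofNat_right _ 2).mul_right ((Commute.refl _).mul_right h2))).sub_right
      h1).sub_right (h1.mul_right h3)

theorem u21_pow_char_commute_u2 : Commute (u21 k ^ p) (u2 k) := by
  refine commute_pow_char_of_commute p k (r := -(u1 k * u21 k)) ?_ ?_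
  · rw [u2_mul_u21]; abel
  · refine (Commute.mul_right (b := u1 k) ?_ (Commute.refl _)).neg_right
    exact u21_mul_u1 k

theorem g_pow_char_commute_u2 : Commute (g k ^ p) (u2 k) := by
  refine commute_pow_char_of_commute p k (r := g k * u1 k) ?_ ?_
  · rw [u2_mul_g]; abel
  · exact (Commute.refl _).mul_right (u1_mul_g k).symm

theorem z_pow_char_sub_commute {y : tD k} (hy : y ∈ ({x1 k, x2 k, u1 k, u2 k, g k} : Set (tD k))) :
    Commute (z k ^ p - z k) y := by
  cases subsingleton_or_nontrivial (tD k)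
  · exact Subsingleton.elim _ _
  have : CharP (tD k) p := charP_of_injective_algebraMap (algebraMap k (tD k)).injective p
  have hx {y : tD k} (h : z k * y = y * z k + y) : Commute (z k ^ p - z k) y :=
    commute_pow_char_sub_self p (by rw [h, mul_add, mul_one])
  have hu {y : tD k} (h : y * z k = z k * y + y) : Commute (z k ^ p - z k) y :=
    commute_pow_char_sub_self' p (by rw [h, add_mul, one_mul])
  obtain rfl | rfl | rfl | rfl | rfl := hy
  · exact hx (z_mul_x1 k)
  · exact hx (z_mul_x2 k)
  · exact hu (u1_mul_z k)
  · exact hu (u2_mul_z k)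
  · exact (Commute.pow_left (z_mul_g k) p).sub_left (z_mul_g k)

/-- The generators of `Zc k p`. -/
def centralGens : Set (tD k) :=
  {x21 k ^ p, x2 k ^ (2 * p), u21 k ^ p, u2 k ^ (2 * p), g k ^ p, gi k ^ p, z k ^ p - z k}

theorem commute_of_mem_centralGens {a b : tD k} (ha : a ∈ centralGens k p)
    (hb : b ∈ centralGens k p) : Commute a b := by
  have hz {y : tD k} (hy) := z_pow_char_sub_commute k p (y := y) hy
  have zx1 := hz (y := x1 k) (by simp)
  have zx2 := hz (y := x2 k) (by simp)
  have zu1 := hz (y := u1 k) (by simp)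
  have zu2 := hz (y := u2 k) (by simp)
  have zg := hz (y := g k) (by simp)
  have zX := (zx1.mul_right zx2).add_right (zx2.mul_right zx1)
  have zU := (zu1.mul_right zu2).add_right (zu2.mul_right zu1)
  have eg := x2_sq_pow_char_commute_g k p
  have eu1 := x2_sq_pow_char_commute_u1 k p
  have eu2 := x2_sq_pow_char_commute_u2 k p
  have eU := (eu1.mul_right eu2).add_right (eu2.mul_right eu1)
  have Xg := x21_pow_commute_g k p
  have Xu1 := x21_pow_commute_u1 k p
  have Xu2 := x21_pow_char_commute_u2 k p
  have XU := (Xu1.mul_right Xu2).add_right (Xu2.mul_right Xu1)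
  have Xx2 := x21_pow_char_commute_x2 k p
  have Ug := u21_pow_commute_g k p
  have Uu2 := u21_pow_char_commute_u2 k p
  have gu2 := g_pow_char_commute_u2 k p
  have zg_p := zg.pow_right p
  have Xg_p := Xg.pow_right p
  have eg_p := eg.pow_right p
  have Ug_p := Ug.pow_right p
  have := zX.pow_right p
  have := zU.pow_right p
  have := (zx2.pow_right 2).pow_right p
  have := zu2.pow_right (2 * p)
  have := commute_gi_pow k zg_p
  have := (Xx2.pow_right 2).pow_right p
  have := XU.pow_right p
  have := Xu2.pow_right (2 * p)
  have := commute_gi_pow k Xg_p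
  have := eU.pow_right p
  have := eu2.pow_right (2 * p)
  have := commute_gi_pow k eg_p
  have := Uu2.pow_right (2 * p)
  have := commute_gi_pow k Ug_p
  have gu2_p := gu2.pow_right (2 * p)
  have := commute_gi_pow k gu2_p.symm
  have := commute_gi_pow k (Commute.refl (g k ^ p))
  rw [centralGens, pow_mul (x2 k)] at ha hb
  rcases ha with rfl | rfl | rfl | rfl | rfl | rfl | rfl <;>
  rcases hb with rfl | rfl | rfl | rfl | rfl | rfl | rfl <;>
  first
  | exact Commute.refl _
  | assumption
  | apply Commute.symm; assumption

theorem isMulCommutative_Zc : IsMulCommutative (Zc k p) :=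
  Algebra.isMulCommutative_adjoin k fun _ ha _ hb => commute_of_mem_centralGens k p ha hb

end Char
end Relations

section Eigenvector

/-- Coefficients of the powers of `e` on a vector `v` with `e v = (A + K) v`, where
`[e, A] = A ^ 2` and `[e, K] = 2 A K`. -/
def stringCoeff : ℕ → ℕ → ℕ
  | 0, 0 => 1
  | i + 1, 0 => (i + 1) * stringCoeff i 0
  | 0, j + 1 => stringCoeff 0 j
  | i + 1, j + 1 => (i + 2 * (j + 1) + 1) * stringCoeff i (j + 1) + stringCoeff (i + 1) j

open Nat in
theorem stringCoeff_mul_factorial (i j : ℕ) :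
    stringCoeff i j * (j ! ^ 2 * i !) = (i + j)! ^ 2 := by
  induction i, j using stringCoeff.induct with
  | case1 => simp [stringCoeff]
  | case2 i ih =>
    simp only [stringCoeff, factorial_succ, add_zero] at ih ⊢
    linear_combination (i + 1) ^ 2 * ih
  | case3 j ih =>
    simp only [stringCoeff, factorial_succ, zero_add] at ih ⊢
    linear_combination (j + 1) ^ 2 * ih
  | case4 i j ih1 ih2 =>
    have h : i + 1 + (j + 1) = i + 1 + j + 1 := by ring
    have h' : i + (j + 1) = i + 1 + j := by ring
    rw [h'] at ih1
    rw [h]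
    simp only [stringCoeff, factorial_succ] at ih1 ih2 ⊢
    linear_combination (i + 2 * (j + 1) + 1) * (i + 1) * ih1 + (j + 1) ^ 2 * ih2

theorem stringCoeff_zero_left (j : ℕ) : stringCoeff 0 j = 1 := by
  induction j with
  | zero => rw [stringCoeff]
  | succ j ih => rw [stringCoeff, ih]

theorem prime_dvd_stringCoeff {p : ℕ} (hp : p.Prime) {i j : ℕ} (h : i + j = p) (hi : i ≠ 0) :
    p ∣ stringCoeff i j := by
  have H := stringCoeff_mul_factorial i j
  have hj : ¬ p ∣ j.factorial := fun hd => by have := hp.dvd_factorial.1 hd; omega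
  rw [h] at H
  by_cases hip : i = p
  · obtain rfl : j = 0 := by omega
    rw [hip, Nat.factorial_zero, one_pow, one_mul, sq] at H
    rw [hip, Nat.eq_of_mul_eq_mul_right p.factorial_pos H]
    exact hp.dvd_factorial.2 le_rfl
  · have hd : p ∣ stringCoeff i j * (j.factorial ^ 2 * i.factorial) := by
      rw [H]
      exact dvd_pow (hp.dvd_factorial.2 le_rfl) two_ne_zero
    refine (hp.dvd_mul.1 hd).resolve_right fun hd => ?_
    obtain hd | hd := hp.dvd_mul.1 hd
    · exact hj (hp.dvd_of_dvd_pow hd)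
    · have := hp.dvd_factorial.1 hd
      omega

theorem pow_apply_eq_sum_stringCoeff {R M : Type*} [CommRing R] [AddCommGroup M] [Module R M]
    {e A K : Module.End R M} {v : M} (hA : e * A = A * e + A ^ 2) (hK : e * K = K * e + 2 * (A * K))
    (hAK : Commute A K) (hv : e v = A v + K v) (n : ℕ) :
    (e ^ n) v =
      ∑ x ∈ Finset.HasAntidiagonal.antidiagonal n, stringCoeff x.1 x.2 • (A ^ x.1 * K ^ x.2) v := by
  have hAn (i : ℕ) : e * A ^ i = A ^ i * e + i • A ^ (i + 1) := by
    induction i with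
    | zero => simp
    | succ i ih =>
      rw [pow_succ, ← mul_assoc, ih, add_mul, mul_assoc, hA, mul_add, smul_mul_assoc, ← pow_succ,
        ← pow_succ, ← pow_add, ← mul_assoc, ← pow_succ, add_smul, one_smul]
      abel
  have hKn (j : ℕ) : e * K ^ j = K ^ j * e + (2 * j) • (A * K ^ j) := by
    induction j with
    | zero => simp
    | succ j ih =>
      have hc : K ^ j * (A * K) = A * K ^ (j + 1) := by
        rw [← mul_assoc, (hAK.pow_right j).symm.eq, mul_assoc, pow_succ]
      rw [pow_succ, ← mul_assoc, ih, add_mul, mul_assoc, hK, mul_add, smul_mul_assoc, two_mul,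
        mul_add, hc, mul_assoc A, ← pow_succ, ← mul_assoc]
      simp only [pow_succ]
      module
  have step (i j : ℕ) : e ((A ^ i * K ^ j) v) =
      (i + 2 * j + 1) • (A ^ (i + 1) * K ^ j) v + (A ^ i * K ^ (j + 1)) v := by
    have h : e * (A ^ i * K ^ j) = A ^ i * K ^ j * e + (i + 2 * j) • (A ^ (i + 1) * K ^ j) := by
      rw [← mul_assoc, hAn, add_mul, mul_assoc, hKn, mul_add, mul_smul_comm, ← mul_assoc,
        smul_mul_assoc, ← mul_assoc, ← pow_succ]
      module
    have hc : A ^ i * K ^ j * A = A ^ (i + 1) * K ^ j := by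
      rw [mul_assoc, ← (hAK.pow_right j).eq, ← mul_assoc, pow_succ]
    rw [← Module.End.mul_apply, h, LinearMap.add_apply, Module.End.mul_apply, hv, map_add,
      ← Module.End.mul_apply, ← Module.End.mul_apply, hc, mul_assoc, ← pow_succ,
      LinearMap.smul_apply]
    module
  induction n with
  | zero => simp [stringCoeff]
  | succ n ih =>
    let P : ℕ → ℕ → ℕ := fun i j => i.casesOn 0 fun i => (i + 2 * j + 1) * stringCoeff i j
    let Q : ℕ → ℕ → ℕ := fun i j => j.casesOn 0 fun j => stringCoeff i j
    have hPQ : ∀ x ∈ Finset.HasAntidiagonal.antidiagonal (n + 1),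
        stringCoeff x.1 x.2 = P x.1 x.2 + Q x.1 x.2 := by
      rintro ⟨i, j⟩ hx
      rcases i with _ | i <;> rcases j with _ | j <;> simp_all [stringCoeff, P, Q]
    rw [pow_succ', Module.End.mul_apply, ih, map_sum]
    have hP : ∑ x ∈ Finset.HasAntidiagonal.antidiagonal (n + 1),
        P x.1 x.2 • (A ^ x.1 * K ^ x.2) v = ∑ x ∈ Finset.HasAntidiagonal.antidiagonal n,
        ((x.1 + 2 * x.2 + 1) * stringCoeff x.1 x.2) • (A ^ (x.1 + 1) * K ^ x.2) v := by
      rw [Finset.Nat.sum_antidiagonal_succ]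
      simp [P]
    have hQ : ∑ x ∈ Finset.HasAntidiagonal.antidiagonal (n + 1),
        Q x.1 x.2 • (A ^ x.1 * K ^ x.2) v = ∑ x ∈ Finset.HasAntidiagonal.antidiagonal n,
        stringCoeff x.1 x.2 • (A ^ x.1 * K ^ (x.2 + 1)) v := by
      rw [Finset.Nat.sum_antidiagonal_succ']
      simp [Q]
    have hsum : ∑ x ∈ Finset.HasAntidiagonal.antidiagonal (n + 1),
        stringCoeff x.1 x.2 • (A ^ x.1 * K ^ x.2) v =
        ∑ x ∈ Finset.HasAntidiagonal.antidiagonal (n + 1), P x.1 x.2 • (A ^ x.1 * K ^ x.2) v +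
        ∑ x ∈ Finset.HasAntidiagonal.antidiagonal (n + 1), Q x.1 x.2 • (A ^ x.1 * K ^ x.2) v := by
      rw [← Finset.sum_add_distrib]
      exact Finset.sum_congr rfl fun x hx => by rw [hPQ x hx, add_smul]
    rw [hsum, hP, hQ, ← Finset.sum_add_distrib]
    refine Finset.sum_congr rfl fun x _ => ?_
    rw [map_nsmul, step]
    module

theorem pow_char_apply_eq {R M : Type*} [CommRing R] [AddCommGroup M] [Module R M] {p : ℕ}
    [hp : Fact p.Prime] [CharP R p] {e A K : Module.End R M} {v : M} (hA : e * A = A * e + A ^ 2)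
    (hK : e * K = K * e + 2 * (A * K)) (hAK : Commute A K) (hv : e v = A v + K v) :
    (e ^ p) v = (K ^ p) v := by
  rw [pow_apply_eq_sum_stringCoeff hA hK hAK hv, Finset.sum_eq_single (0, p)]
  · simp [stringCoeff_zero_left]
  · rintro ⟨i, j⟩ hx hne
    have hx := Finset.HasAntidiagonal.mem_antidiagonal.1 hx
    obtain ⟨m, hm⟩ := prime_dvd_stringCoeff hp.out hx fun hi => hne (by ext <;> simp_all)
    rw [hm, ← Nat.cast_smul_eq_nsmul R]
    simp
  · simp

variable {F : Type*} [Field F]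

/-- The part of `opX2 ^ 2` shifting the last coordinate. -/
def opK : Module.End F (FockSpace F) where
  toFun f := ![
    fun i j l n => f 0 i j (l - 2) (n - 2),
    fun i j l n => f 1 i j (l - 2) (n - 2) + f 0 i j (l - 1) (n - 1),
    fun i j l n => f 2 i j (l - 2) (n - 2),
    fun i j l n => f 3 i j (l - 2) (n - 2) - f 2 i j (l - 1) (n - 1)]
  map_add' f h := by ext e; fin_cases e <;> simp <;> ring
  map_smul' r f := by ext e; fin_cases e <;> simp <;> ring

@[simp] theorem opK_apply_0 (f : FockSpace F) (i j l n : ℤ) :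
    opK f 0 i j l n = f 0 i j (l - 2) (n - 2) := rfl

@[simp] theorem opK_apply_1 (f : FockSpace F) (i j l n : ℤ) :
    opK f 1 i j l n = f 1 i j (l - 2) (n - 2) + f 0 i j (l - 1) (n - 1) := rfl

@[simp] theorem opK_apply_2 (f : FockSpace F) (i j l n : ℤ) :
    opK f 2 i j l n = f 2 i j (l - 2) (n - 2) := rfl

@[simp] theorem opK_apply_3 (f : FockSpace F) (i j l n : ℤ) :
    opK f 3 i j l n = f 3 i j (l - 2) (n - 2) - f 2 i j (l - 1) (n - 1) := rfl

theorem opX2_sq_mul_opX21 :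
    (opX2 ^ 2 : Module.End F (FockSpace F)) * opX21 = opX21 * opX2 ^ 2 + opX21 ^ 2 := by
  refine fockSpace_end_ext fun f i j l n => ⟨?_, ?_, ?_, ?_⟩ <;> simp [sq] <;> ring

theorem opX2_sq_mul_opK : (opX2 ^ 2 : Module.End F (FockSpace F)) * opK =
    opK * opX2 ^ 2 + 2 * (opX21 * opK) := by
  refine fockSpace_end_ext fun f i j l n => ⟨?_, ?_, ?_, ?_⟩ <;> simp [sq, two_mul] <;> ring_nf

theorem opX21_commute_opK : Commute opX21 (opK : Module.End F (FockSpace F)) := by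
  refine fockSpace_end_ext fun f i j l n => ⟨?_, ?_, ?_, ?_⟩ <;> simp

end Eigenvector

section Vacuum

theorem fockSpace_ext {F : Type*} {f h : FockSpace F} (H : ∀ i j l n, f 0 i j l n = h 0 i j l n ∧
    f 1 i j l n = h 1 i j l n ∧ f 2 i j l n = h 2 i j l n ∧ f 3 i j l n = h 3 i j l n) : f = h := by
  refine funext fun e => funext fun i => funext fun j => funext fun l => funext fun n => ?_
  obtain ⟨h0, h1, h2, h3⟩ := H i j l n
  fin_cases e <;> assumption

variable {F : Type*} [Field F]

/-- A function supported on the multiples of `m` with `quasiPeriodic m s 0 = 1`, which is multiplied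
by `s` under the shift by `m`. -/
def quasiPeriodic (m : ℤ) (s : F) (i : ℤ) : F := if m ∣ i then s ^ (-(i / m)) else 0

theorem quasiPeriodic_sub {m : ℤ} (hm : m ≠ 0) {s : F} (hs : s ≠ 0) (i : ℤ) :
    quasiPeriodic m s (i - m) = s * quasiPeriodic m s i := by
  by_cases h : m ∣ i
  · obtain ⟨q, rfl⟩ := h
    have : m * q - m = m * (q - 1) := by ring
    simp only [quasiPeriodic, this, dvd_mul_right, if_true, Int.mul_ediv_cancel_left _ hm]
    rw [neg_sub, sub_eq_add_neg, zpow_add₀ hs, zpow_one]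
  · simp [quasiPeriodic, h]

theorem quasiPeriodic_add {m : ℤ} (hm : m ≠ 0) {s : F} (hs : s ≠ 0) (i : ℤ) :
    quasiPeriodic m s (i + m) = s⁻¹ * quasiPeriodic m s i := by
  have h := quasiPeriodic_sub hm hs (i + m)
  rw [add_sub_cancel_right] at h
  rw [h, inv_mul_cancel_left₀ hs]

theorem quasiPeriodic_zero (m : ℤ) (s : F) : quasiPeriodic m s 0 = 1 := by simp [quasiPeriodic]

theorem intCast_mul_quasiPeriodic (p : ℕ) [CharP F p] {m : ℤ} (hm : (p : ℤ) ∣ m) (s : F) (i : ℤ) :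
    (i : F) * quasiPeriodic m s i = 0 := by
  by_cases h : m ∣ i
  · rw [(CharP.intCast_eq_zero_iff F p i).2 (hm.trans h), zero_mul]
  · simp [quasiPeriodic, h]

/-- The only nonzero component of the common eigenvector. -/
def vacuumCoord (p : ℕ) (T r s w : F) (i j l n : ℤ) : F :=
  quasiPeriodic p r i * quasiPeriodic p s j * quasiPeriodic p T l * quasiPeriodic (2 * p) w n

/-- A common eigenvector of the generators of the central subalgebra. -/
def vacuum (p : ℕ) (T r s w : F) : FockSpace F := ![vacuumCoord p T r s w, 0, 0, 0]

section Basic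

variable (p : ℕ) (T r s w : F)

@[simp] theorem vacuum_apply_0 : vacuum p T r s w 0 = vacuumCoord p T r s w := rfl
@[simp] theorem vacuum_apply_1 : vacuum p T r s w 1 = 0 := rfl
@[simp] theorem vacuum_apply_2 : vacuum p T r s w 2 = 0 := rfl
@[simp] theorem vacuum_apply_3 : vacuum p T r s w 3 = 0 := rfl

theorem vacuum_ne_zero : vacuum p T r s w ≠ 0 := fun h => by
  have := congrFun (congrFun (congrFun (congrFun (congrFun h 0) 0) 0) 0) 0
  simp [vacuumCoord, quasiPeriodic_zero] at this

theorem opX21_pow_apply (q : ℕ) (f : FockSpace F) (e : Fin 4) (i j l n : ℤ) :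
    (opX21 ^ q) f e i j l n = f e (i - q) j l n := by
  induction q generalizing i with
  | zero => simp
  | succ q ih =>
    rw [pow_succ', Module.End.mul_apply, opX21_apply, ih, sub_sub, add_comm (1 : ℤ), Nat.cast_succ]

theorem opU21_pow_apply (q : ℕ) (f : FockSpace F) (e : Fin 4) (i j l n : ℤ) :
    (opU21 ^ q) f e i j l n = f e i (j - q) l n := by
  induction q generalizing j with
  | zero => simp
  | succ q ih =>
    rw [pow_succ', Module.End.mul_apply, opU21_apply, ih, sub_sub, add_comm (1 : ℤ), Nat.cast_succ]

theorem opG_pow_apply (q : ℕ) (f : FockSpace F) (e : Fin 4) (i j l n : ℤ) :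
    (opG ^ q) f e i j l n = f e i j (l - q) n := by
  induction q generalizing l with
  | zero => simp
  | succ q ih =>
    rw [pow_succ', Module.End.mul_apply, opG_apply, ih, sub_sub, add_comm (1 : ℤ), Nat.cast_succ]

theorem opK_pow_vacuum (q : ℕ) (i j l n : ℤ) :
    (opK ^ q) (vacuum p T r s w) 0 i j l n = vacuumCoord p T r s w i j (l - 2 * q) (n - 2 * q) ∧
    (opK ^ q) (vacuum p T r s w) 1 i j l n =
      q * vacuumCoord p T r s w i j (l - 2 * q + 1) (n - 2 * q + 1) ∧
    (opK ^ q) (vacuum p T r s w) 2 i j l n = 0 ∧ (opK ^ q) (vacuum p T r s w) 3 i j l n = 0 := by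
  induction q generalizing l n with
  | zero => simp
  | succ q ih =>
    have h1 := ih (l - 2) (n - 2)
    have h2 := ih (l - 1) (n - 1)
    simp only [pow_succ', Module.End.mul_apply, opK_apply_0, opK_apply_1, opK_apply_2, opK_apply_3,
      h1, h2, sub_zero, and_self, and_true, Nat.cast_succ]
    ring_nf
    trivial

end Basic

theorem intCast_mul_vacuumCoord (p : ℕ) [CharP F p] (T r s w : F) (i j l n : ℤ) :
    i * vacuumCoord p T r s w i j l n = 0 ∧ j * vacuumCoord p T r s w i j l n = 0 ∧
      l * vacuumCoord p T r s w i j l n = 0 ∧ n * vacuumCoord p T r s w i j l n = 0 := by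
  have hi := intCast_mul_quasiPeriodic p (dvd_refl _) r i
  have hj := intCast_mul_quasiPeriodic p (dvd_refl _) s j
  have hl := intCast_mul_quasiPeriodic p (dvd_refl _) T l
  have hn := intCast_mul_quasiPeriodic p (dvd_mul_left _ 2) w n
  rw [vacuumCoord]
  refine ⟨?_, ?_, ?_, ?_⟩
  · linear_combination (quasiPeriodic p s j * quasiPeriodic p T l * quasiPeriodic (2 * p) w n) * hi
  · linear_combination (quasiPeriodic p r i * quasiPeriodic p T l * quasiPeriodic (2 * p) w n) * hj
  · linear_combination (quasiPeriodic p r i * quasiPeriodic p s j * quasiPeriodic (2 * p) w n) * hl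
  · linear_combination (quasiPeriodic p r i * quasiPeriodic p s j * quasiPeriodic p T l) * hn

/-- The solution `c` of the recursion `c (n + 1) = a + n - c n` with `c 0 = b`. -/
def alternating (a b : F) (n : ℤ) : F :=
  if Even n then b + (n / 2 : ℤ) else -b + (a + ((n - 1) / 2 : ℤ))

theorem alternating_add_one (a b : F) (n : ℤ) :
    alternating a b (n + 1) = a + n - alternating a b n := by
  obtain ⟨m, rfl⟩ | ⟨m, rfl⟩ := Int.even_or_odd n
  · have h1 : (m + m + 1 - 1) / 2 = m := by omega
    have h2 : (m + m) / 2 = m := by omega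
    have h3 : ¬ Even (m + m + 1) := Int.not_even_iff_odd.2 ⟨m, by ring⟩
    have h4 : Even (m + m) := ⟨m, rfl⟩
    simp only [alternating, h1, h2, h3, h4, if_true, if_false]
    push_cast
    ring
  · have h1 : (2 * m + 1 + 1) / 2 = m + 1 := by omega
    have h2 : (2 * m + 1 - 1) / 2 = m := by omega
    have h3 : ¬ Even (2 * m + 1) := by simp [parity_simps]
    have h4 : Even (2 * m + 1 + 1) := by simp [parity_simps]
    simp only [alternating, h1, h2, h3, h4, if_true, if_false]
    push_cast
    ring

theorem alternating_add_mul (p : ℕ) [CharP F p] (a b : F) (n q : ℤ) :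
    alternating a b (2 * p * q + n) = alternating a b n := by
  have h1 : (2 * p * q + n) / 2 = p * q + n / 2 := by
    rw [mul_assoc, Int.mul_add_ediv_left _ _ two_ne_zero]
  have h2 : (2 * p * q + n - 1) / 2 = p * q + (n - 1) / 2 := by
    rw [mul_assoc, add_sub_assoc, Int.mul_add_ediv_left _ _ two_ne_zero]
  have h3 : Even (2 * p * q + n) ↔ Even n := by simp [parity_simps]
  simp only [alternating, h1, h2, h3]
  simp

theorem exists_prod_alternating_eq [IsAlgClosed F] {q : ℕ} (hq : q ≠ 0) (a c : F) :
    ∃ b, ∏ t ∈ Finset.range q, alternating a b (t + 1) = c := by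
  open Polynomial in
  let L : ℕ → F[X] := fun t => if Even (t + 1 : ℤ) then C 1 * X + C (((t + 1 : ℤ) / 2 : ℤ) : F)
    else C (-1) * X + C (a + (((t + 1 : ℤ) - 1) / 2 : ℤ))
  have hL (t : ℕ) : (L t).degree = 1 := by
    dsimp only [L]
    split_ifs
    · exact Polynomial.degree_linear one_ne_zero
    · exact Polynomial.degree_linear (neg_ne_zero.2 one_ne_zero)
  have hdeg : (∏ t ∈ Finset.range q, L t).degree = q := by simp [Polynomial.degree_prod, hL]
  obtain ⟨b, hb⟩ := IsAlgClosed.exists_root (∏ t ∈ Finset.range q, L t - Polynomial.C c) (by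
    rw [Polynomial.degree_sub_C (by rw [hdeg]; exact_mod_cast Nat.pos_of_ne_zero hq), hdeg]
    exact_mod_cast hq)
  refine ⟨b, ?_⟩
  rw [Polynomial.IsRoot, Polynomial.eval_sub, Polynomial.eval_C, sub_eq_zero,
    Polynomial.eval_prod] at hb
  rw [← hb]
  refine Finset.prod_congr rfl fun t _ => ?_
  dsimp only [L, alternating]
  split_ifs <;> simp

variable (p : ℕ) {T r s w : F}

theorem opX21_pow_vacuum [hp : Fact p.Prime] (hr : r ≠ 0) :
    (opX21 ^ p) (vacuum p T r s w) = r • vacuum p T r s w := by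
  have hp0 : (p : ℤ) ≠ 0 := mod_cast hp.out.ne_zero
  refine fockSpace_ext fun i j l n => ⟨?_, ?_, ?_, ?_⟩ <;>
    simp [opX21_pow_apply, vacuumCoord, quasiPeriodic_sub hp0 hr, mul_assoc]

theorem opU21_pow_vacuum [hp : Fact p.Prime] (hs : s ≠ 0) :
    (opU21 ^ p) (vacuum p T r s w) = s • vacuum p T r s w := by
  have hp0 : (p : ℤ) ≠ 0 := mod_cast hp.out.ne_zero
  refine fockSpace_ext fun i j l n => ⟨?_, ?_, ?_, ?_⟩ <;>
    simp [opU21_pow_apply, vacuumCoord, quasiPeriodic_sub hp0 hs]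
  ring

theorem opG_pow_vacuum [hp : Fact p.Prime] (hT : T ≠ 0) :
    (opG ^ p) (vacuum p T r s w) = T • vacuum p T r s w := by
  have hp0 : (p : ℤ) ≠ 0 := mod_cast hp.out.ne_zero
  refine fockSpace_ext fun i j l n => ⟨?_, ?_, ?_, ?_⟩ <;>
    simp [opG_pow_apply, vacuumCoord, quasiPeriodic_sub hp0 hT]
  ring

variable [CharP F p]

theorem opZ_vacuum (a : F) : opZ a (vacuum p T r s w) = a • vacuum p T r s w := by
  refine fockSpace_ext fun i j l n => ⟨?_, ?_, ?_, ?_⟩ <;>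
    simp [-mul_eq_mul_right_iff, add_mul, sub_mul, mul_assoc]
  obtain ⟨hi, hj, hl, hn⟩ := intCast_mul_vacuumCoord p T r s w i j l n
  linear_combination 2 * hi - 2 * hj + hn

theorem opZ_pow_sub_vacuum (a : F) :
    (opZ a ^ p - opZ a) (vacuum p T r s w) = (a ^ p - a) • vacuum p T r s w := by
  have h (q : ℕ) : (opZ a ^ q) (vacuum p T r s w) = a ^ q • vacuum p T r s w := by
    induction q with
    | zero => simp
    | succ q ih => rw [pow_succ, Module.End.mul_apply, opZ_vacuum, map_smul, ih, smul_smul, pow_succ']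
  rw [LinearMap.sub_apply, h, opZ_vacuum, sub_smul]

theorem opX2_sq_vacuum : (opX2 ^ 2) (vacuum p T r s w) =
    opX21 (vacuum p T r s w) + opK (vacuum p T r s w) := by
  have hi (i j l n) := (intCast_mul_vacuumCoord p T r s w i j l n).1
  have hj (i j l n) := (intCast_mul_vacuumCoord p T r s w i j l n).2.1
  have hl (i j l n) := (intCast_mul_vacuumCoord p T r s w i j l n).2.2.1
  refine fockSpace_ext fun i j l n => ⟨?_, ?_, ?_, ?_⟩ <;> simp [sq]
  · have h1 := hi (i - 1) j l n
    have h3 := hj i (j + 1) l n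
    have h5 := hj i (j + 1) (l - 1 - 1) n
    push_cast at h1 h3 h5
    rw [show l - 2 = l - 1 - 1 by ring, show n - 2 = n - 1 - 1 by ring]
    linear_combination h1 + hl (i - 1) j l n - h3 + h5
  · ring
  · have h4 := hj i (j + 1) (l - 1) n
    push_cast at h4
    linear_combination -h4

theorem opU2_pow_vacuum_apply (c : ℤ → F) (q : ℕ) (i j l n : ℤ) :
    (opU2 c ^ q) (vacuum p T r s w) 0 i j l n =
      (∏ t ∈ Finset.range q, c (n + t + 1)) * vacuumCoord p T r s w i j l (n + q) ∧
    (opU2 c ^ q) (vacuum p T r s w) 1 i j l n = 0 ∧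
    (opU2 c ^ q) (vacuum p T r s w) 2 i j l n = 0 ∧
    (opU2 c ^ q) (vacuum p T r s w) 3 i j l n = 0 := by
  induction q generalizing i j l n with
  | zero => simp
  | succ q ih =>
    simp only [pow_succ', Module.End.mul_apply, opU2_apply_0, opU2_apply_1, opU2_apply_2,
      opU2_apply_3, ih, Finset.prod_range_succ', Nat.cast_succ]
    have h1 := (intCast_mul_vacuumCoord p T r s w (i + 1) j l (n + q)).1
    have h2 := (intCast_mul_vacuumCoord p T r s w (i + 1) j (l - 1) (n + q)).1
    obtain ⟨h3, h4, h5, -⟩ := intCast_mul_vacuumCoord p T r s w i j l (n + q)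
    push_cast at h1 h2
    refine ⟨?_, ?_, ?_, by simp⟩
    · rw [show n + 1 + (q : ℤ) = n + (q + 1) by ring, Nat.cast_zero, add_zero]
      simp only [add_right_comm n 1, add_assoc]
      ring_nf
    · linear_combination (∏ t ∈ Finset.range q, c (n + t + 1)) * (h1 + h2)
    · linear_combination (∏ t ∈ Finset.range q, c (n + t + 1)) * (h4 - h5 - 2 * h3)

variable [hp : Fact p.Prime]

theorem opX2_pow_vacuum (hT : T ≠ 0) (hw : w ≠ 0) :
    (opX2 ^ (2 * p)) (vacuum p T r s w) = (T ^ 2 * w) • vacuum p T r s w := by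
  have hp0 : (p : ℤ) ≠ 0 := mod_cast hp.out.ne_zero
  rw [pow_mul, pow_char_apply_eq (R := F) opX2_sq_mul_opX21 opX2_sq_mul_opK opX21_commute_opK
    (opX2_sq_vacuum p)]
  have hl (l : ℤ) : l - 2 * p = l - p - p := by ring
  refine fockSpace_ext fun i j l n => ⟨?_, ?_, ?_, ?_⟩ <;>
    simp [opK_pow_vacuum, vacuumCoord, quasiPeriodic_sub (mul_ne_zero two_ne_zero hp0) hw]
  rw [hl, quasiPeriodic_sub hp0 hT, quasiPeriodic_sub hp0 hT]
  ring

theorem opU2_pow_vacuum (hw : w ≠ 0) (a b : F) :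
    (opU2 (alternating a b) ^ (2 * p)) (vacuum p T r s w) =
      ((∏ t ∈ Finset.range (2 * p), alternating a b (t + 1)) * w⁻¹) • vacuum p T r s w := by
  have hp0 : (p : ℤ) ≠ 0 := mod_cast hp.out.ne_zero
  refine fockSpace_ext fun i j l n => ⟨?_, ?_, ?_, ?_⟩ <;>
    simp [opU2_pow_vacuum_apply, vacuumCoord, quasiPeriodic_add (mul_ne_zero two_ne_zero hp0) hw]
  by_cases h : 2 * (p : ℤ) ∣ n
  · obtain ⟨q, rfl⟩ := h
    simp only [add_assoc, alternating_add_mul]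
    ring
  · simp [quasiPeriodic, h]

end Vacuum

section Laurent

variable {k : Type*} [Field k] {σ : Type*}

/-- Evaluation of a polynomial over the Laurent polynomials at a unit and a tuple of elements. -/
noncomputable def laurentMvAeval {A : Type*} [CommRing A] [Algebra k A] (t : Aˣ) (x : σ → A) :
    MvPolynomial σ (LaurentPolynomial k) →ₐ[k] A :=
  MvPolynomial.aevalTower
    (AddMonoidAlgebra.lift k A ℤ ((Units.coeHom A).comp (zpowersHom Aˣ t))) x

section Ring

variable {A : Type*} [CommRing A] [Algebra k A] (t : Aˣ) (x : σ → A)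

theorem laurentMvAeval_C_T (n : ℤ) :
    laurentMvAeval t x (MvPolynomial.C (LaurentPolynomial.T (R := k) n)) = ((t ^ n : Aˣ) : A) := by
  rw [laurentMvAeval, MvPolynomial.aevalTower_C, LaurentPolynomial.T]
  erw [AddMonoidAlgebra.lift_single]
  simp

theorem laurentMvAeval_C_T_one :
    laurentMvAeval t x (MvPolynomial.C (LaurentPolynomial.T (R := k) 1)) = t := by
  rw [laurentMvAeval_C_T, zpow_one]

theorem laurentMvAeval_X (i : σ) :
    laurentMvAeval (k := k) t x (MvPolynomial.X i) = x i := by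
  rw [laurentMvAeval, MvPolynomial.aevalTower_X]

end Ring

theorem eq_zero_of_forall_laurentMvAeval_eq_zero {F : Type*} [Field F] [Infinite F] [Algebra k F]
    {P : MvPolynomial σ (LaurentPolynomial k)}
    (h : ∀ (t : Fˣ) (x : σ → F), (∀ i, x i ≠ 0) → laurentMvAeval t x P = 0) : P = 0 := by
  let ev (t : Fˣ) : LaurentPolynomial k →ₐ[k] F :=
    AddMonoidAlgebra.lift k F ℤ ((Units.coeHom F).comp (zpowersHom Fˣ t))
  have hev (t : Fˣ) : MvPolynomial.map (ev t : LaurentPolynomial k →+* F) P = 0 := by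
    refine MvPolynomial.funext_set (fun _ => ({0}ᶜ : Set F))
      (fun _ => (Set.finite_singleton 0).infinite_compl) fun x hx => ?_
    rw [MvPolynomial.eval_map, map_zero]
    exact h t x fun i => hx i trivial
  have hT (t : Fˣ) (n : ℕ) : ev t (LaurentPolynomial.T n) = (t : F) ^ n := by
    have := laurentMvAeval_C_T (k := k) t (fun i : σ => (0 : F)) n
    rw [laurentMvAeval, MvPolynomial.aevalTower_C] at this
    simpa using this
  ext1 m
  obtain ⟨n, f, hf⟩ := LaurentPolynomial.exists_T_pow (P.coeff m)
  have hroot (t : Fˣ) : Polynomial.aeval (t : F) f = 0 := by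
    have h1 : (ev t).comp Polynomial.toLaurentAlg = Polynomial.aeval (t : F) := by
      ext
      simpa using hT t 1
    have h2 := congrArg (MvPolynomial.coeff m) (hev t)
    rw [MvPolynomial.coeff_map, MvPolynomial.coeff_zero] at h2
    rw [← h1, AlgHom.comp_apply, Polynomial.toLaurentAlg_apply, hf, map_mul]
    erw [h2]
    rw [zero_mul]
  have hf0 : f = 0 := by
    refine (Polynomial.map_eq_zero (algebraMap k F)).1 ?_
    refine Polynomial.eq_zero_of_infinite_isRoot _
      ((Set.finite_singleton (0 : F)).infinite_compl.mono fun t ht => ?_)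
    have := hroot (Units.mk0 t (Set.mem_compl_singleton_iff.1 ht))
    rwa [Units.val_mk0, Polynomial.aeval_def, ← Polynomial.eval_map] at this
  rw [hf0, map_zero] at hf
  rw [MvPolynomial.coeff_zero]
  exact ((LaurentPolynomial.isUnit_T (n : ℤ)).mul_left_eq_zero).1 hf.symm

theorem apply_eq_smul_of_generators {F V : Type*} [Field F] [Algebra k F] [AddCommGroup V]
    [Module F V] [Module k V] [IsScalarTower k F V] [SMulCommClass F k V]
    {ψ : MvPolynomial σ (LaurentPolynomial k) →ₐ[k] Module.End F V}
    {χ : MvPolynomial σ (LaurentPolynomial k) →ₐ[k] F} {v : V}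
    (hT : ψ (MvPolynomial.C (LaurentPolynomial.T 1)) v =
      χ (MvPolynomial.C (LaurentPolynomial.T 1)) • v)
    (hX : ∀ i, ψ (MvPolynomial.X i) v = χ (MvPolynomial.X i) • v)
    (P : MvPolynomial σ (LaurentPolynomial k)) : ψ P v = χ P • v := by
  have hmul {Q R} (hQ : ψ Q v = χ Q • v) (hR : ψ R v = χ R • v) :
      ψ (Q * R) v = χ (Q * R) • v := by
    rw [map_mul, map_mul, Module.End.mul_apply, hR, map_smul, hQ, smul_smul, mul_comm]
  have hpow {Q} (hQ : ψ Q v = χ Q • v) (n : ℕ) : ψ (Q ^ n) v = χ (Q ^ n) • v := by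
    induction n with
    | zero => simp
    | succ n ih => rw [pow_succ]; exact hmul ih hQ
  have hinv : ψ (MvPolynomial.C (LaurentPolynomial.T (-1))) v =
      χ (MvPolynomial.C (LaurentPolynomial.T (-1))) • v := by
    have h1 : MvPolynomial.C (LaurentPolynomial.T (-1)) *
        MvPolynomial.C (σ := σ) (LaurentPolynomial.T (R := k) 1) = 1 := by
      rw [← map_mul, ← LaurentPolynomial.T_add, neg_add_cancel, LaurentPolynomial.T_zero, map_one]
    have h2 := congrArg (fun Q => ψ Q v) h1
    have h3 := congrArg χ h1
    simp only [map_mul, map_one, Module.End.mul_apply, Module.End.one_apply, hT, map_smul] at h2 h3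
    rw [← h2, smul_smul, h3, one_smul, h2]
  induction P using MvPolynomial.induction_on with
  | C q =>
    induction q using LaurentPolynomial.induction_on' with
    | add q r hq hr => rw [map_add, map_add, map_add, LinearMap.add_apply, hq, hr, add_smul]
    | C_mul_T n a =>
      rw [map_mul]
      refine hmul ?_ ?_
      · have : MvPolynomial.C (LaurentPolynomial.C a) =
          algebraMap k (MvPolynomial σ (LaurentPolynomial k)) a := rfl
        rw [this, AlgHom.commutes, AlgHom.commutes, Module.algebraMap_end_apply, algebraMap_smul]
      · obtain ⟨n, rfl | rfl⟩ := n.eq_nat_or_neg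
        · rw [← mul_one (n : ℤ), ← LaurentPolynomial.T_pow, map_pow]
          exact hpow hT n
        · rw [← mul_neg_one (n : ℤ), ← LaurentPolynomial.T_pow, map_pow]
          exact hpow hinv n
  | add Q R hQ hR => rw [map_add, map_add, LinearMap.add_apply, hQ, hR, add_smul]
  | mul_X Q i hQ => exact hmul hQ (hX i)

end Laurent

section Main

variable {k : Type} [Field k]

/-- The action of `tD k` on the Fock space. -/
noncomputable def fockRep {F : Type*} [Field F] [Algebra k F] (a : F) (c : ℤ → F)
    (hc : ∀ n : ℤ, c (n + 1) = a + n - c n) : tD k →ₐ[k] Module.End F (FockSpace F) :=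
  RingQuot.liftAlgHom k
    ⟨FreeAlgebra.lift k ![opX1, opX2, opU1, opU2 c, opG, opGi, opZ a], fun _ _ h => by
      cases h <;>
        simp only [fx21, fu21, fx1, fx2, fu1, fu2, fg, fgi, fz, map_mul, map_add, map_sub, map_neg,
          map_zero, map_one, FreeAlgebra.lift_ι_apply, Matrix.cons_val, opX1_mul_opX2_add,
          opU1_mul_opU2_add]
      · exact opX1_mul_self
      · exact opX2_mul_opX21
      · exact opU1_mul_self
      · exact opU2_mul_opU21 c
      · exact opG_mul_opGi
      · exact opGi_mul_opG
      · exact opZ_mul_opG a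
      · exact opG_mul_opX1
      · exact opG_mul_opX2
      · exact opU1_mul_opG
      · exact opU2_mul_opG c
      · exact opZ_mul_opX1 a
      · exact opZ_mul_opX2 a
      · exact opU1_mul_opZ a
      · exact opU2_mul_opZ a c
      · exact opU1_mul_opX1
      · exact opU1_mul_opX2
      · exact opU2_mul_opX1 c
      · exact opU2_mul_opX2 a c hc⟩

theorem fockRep_ι {F : Type*} [Field F] [Algebra k F] (a : F) (c : ℤ → F)
    (hc : ∀ n : ℤ, c (n + 1) = a + n - c n) (i : Fin 7) :
    fockRep a c hc (RingQuot.mkAlgHom k (Rel k) (FreeAlgebra.ι k i)) =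
      ![opX1, opX2, opU1, opU2 c, opG, opGi, opZ a] i := by
  rw [fockRep, RingQuot.liftAlgHom_mkAlgHom_apply, FreeAlgebra.lift_ι_apply]

theorem exists_common_eigenvector (p : ℕ) [hp : Fact p.Prime] {F : Type*} [Field F] [CharP F p]
    [IsAlgClosed F] [Algebra k F] {t : F} (ht : t ≠ 0) {x : Fin 5 → F} (hx : ∀ i, x i ≠ 0) :
    ∃ (ρ : tD k →ₐ[k] Module.End F (FockSpace F)) (v : FockSpace F), v ≠ 0 ∧
      ρ (g k ^ p) v = t • v ∧ ρ (x21 k ^ p) v = x 0 • v ∧ ρ (x2 k ^ (2 * p)) v = x 1 • v ∧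
      ρ (-(z k ^ p - z k)) v = x 2 • v ∧ ρ (u21 k ^ p) v = x 3 • v ∧
      ρ (u2 k ^ (2 * p)) v = x 4 • v := by
  have hw : x 1 / t ^ 2 ≠ 0 := div_ne_zero (hx 1) (pow_ne_zero 2 ht)
  obtain ⟨a, ha⟩ : ∃ a : F, a ^ p - a = -x 2 := by
    have hdeg : ((Polynomial.X : Polynomial F) ^ p - (Polynomial.X - Polynomial.C (x 2))).degree
        = (p : WithBot ℕ) := by
      rw [Polynomial.degree_sub_eq_left_of_degree_lt, Polynomial.degree_X_pow]
      rw [Polynomial.degree_X_sub_C, Polynomial.degree_X_pow]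
      exact_mod_cast hp.out.one_lt
    obtain ⟨a, ha⟩ := IsAlgClosed.exists_root _ (by
      rw [hdeg]; exact_mod_cast hp.out.ne_zero)
    refine ⟨a, ?_⟩
    simp only [Polynomial.IsRoot, Polynomial.eval_sub, Polynomial.eval_pow, Polynomial.eval_X,
      Polynomial.eval_C] at ha
    linear_combination ha
  obtain ⟨b, hb⟩ := exists_prod_alternating_eq (mul_ne_zero two_ne_zero hp.out.ne_zero) a
    (x 4 * (x 1 / t ^ 2))
  let ρ : tD k →ₐ[k] Module.End F (FockSpace F) :=
    fockRep a (alternating a b) (alternating_add_one a b)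
  have h1 : ρ (x1 k) = opX1 := fockRep_ι _ _ _ 0
  have h2 : ρ (x2 k) = opX2 := fockRep_ι _ _ _ 1
  have h3 : ρ (u1 k) = opU1 := fockRep_ι _ _ _ 2
  have h4 : ρ (u2 k) = opU2 (alternating a b) := fockRep_ι _ _ _ 3
  have h5 : ρ (g k) = opG := fockRep_ι _ _ _ 4
  have h6 : ρ (z k) = opZ a := fockRep_ι _ _ _ 6
  have h21 : ρ (x21 k) = opX21 := by
    rw [x21, map_add, map_mul, map_mul, h1, h2, opX1_mul_opX2_add]
  have hu21 : ρ (u21 k) = opU21 := by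
    rw [u21, map_add, map_mul, map_mul, h3, h4, opU1_mul_opU2_add]
  refine ⟨ρ, vacuum p t (x 0) (x 3) (x 1 / t ^ 2), vacuum_ne_zero p t (x 0) (x 3) (x 1 / t ^ 2), ?_, ?_, ?_, ?_, ?_, ?_⟩
  · rw [map_pow, h5, opG_pow_vacuum p ht]
  · rw [map_pow, h21, opX21_pow_vacuum p (hx 0)]
  · rw [map_pow, h2, opX2_pow_vacuum p ht hw, mul_div_cancel₀ _ (pow_ne_zero 2 ht)]
  · rw [map_neg, map_sub, map_pow, h6, LinearMap.neg_apply, opZ_pow_sub_vacuum p, ha, neg_smul,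
      neg_neg]
  · rw [map_pow, hu21, opU21_pow_vacuum p (hx 3)]
  · rw [map_pow, h4, opU2_pow_vacuum p hw, hb, mul_inv_cancel_right₀ hw]

theorem injective_of_apply_generators (p : ℕ) [hp : Fact p.Prime] [CharP k p]
    {φ : MvPolynomial (Fin 5) (LaurentPolynomial k) →ₐ[k] tD k}
    (hT : φ (MvPolynomial.C (LaurentPolynomial.T 1)) = g k ^ p)
    (hX : ∀ i, φ (MvPolynomial.X i) =
      ![x21 k ^ p, x2 k ^ (2 * p), -(z k ^ p - z k), u21 k ^ p, u2 k ^ (2 * p)] i) :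
    Function.Injective φ := by
  refine (injective_iff_map_eq_zero φ).2 fun P hP => ?_
  have : CharP (AlgebraicClosure k) p :=
    charP_of_injective_algebraMap (algebraMap k (AlgebraicClosure k)).injective p
  refine eq_zero_of_forall_laurentMvAeval_eq_zero (F := AlgebraicClosure k) fun s y hy => ?_
  obtain ⟨ρ, v, hv, e0, e1, e2, e3, e4, e5⟩ := exists_common_eigenvector (k := k) p s.ne_zero hy
  have h := apply_eq_smul_of_generators (ψ := ρ.comp φ) (χ := laurentMvAeval s y) (v := v) ?_ ?_ P
  · rw [AlgHom.comp_apply, hP, map_zero, LinearMap.zero_apply] at h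
    by_contra hc
    exact hv (by rw [← inv_smul_smul₀ hc v, ← h, smul_zero])
  · rw [AlgHom.comp_apply, hT, laurentMvAeval_C_T_one]
    exact e0
  · intro i
    rw [AlgHom.comp_apply, hX, laurentMvAeval_X]
    fin_cases i
    exacts [e1, e2, e3, e4, e5]

theorem exists_surjective_algHom_Zc (p : ℕ) [hp : Fact p.Prime] [CharP k p] :
    ∃ φ : MvPolynomial (Fin 5) (LaurentPolynomial k) →ₐ[k] Zc k p, Function.Surjective φ ∧
      (φ (MvPolynomial.C (LaurentPolynomial.T 1)) : tD k) = g k ^ p ∧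
      ∀ i, (φ (MvPolynomial.X i) : tD k) =
        ![x21 k ^ p, x2 k ^ (2 * p), -(z k ^ p - z k), u21 k ^ p, u2 k ^ (2 * p)] i := by
  have := isMulCommutative_Zc k p
  have hmem {a : tD k} (ha : a ∈ centralGens k p) : a ∈ Zc k p := Algebra.subset_adjoin ha
  let G : Zc k p := ⟨g k ^ p, hmem (by simp [centralGens])⟩
  let G' : Zc k p := ⟨gi k ^ p, hmem (by simp [centralGens])⟩
  let W : Zc k p := ⟨z k ^ p - z k, hmem (by simp [centralGens])⟩
  have hgi : Commute (g k) (gi k) := (g_mul_gi k).trans (gi_mul_g k).symm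
  have hG : G * G' = 1 := Subtype.ext <| by
    change g k ^ p * gi k ^ p = 1
    rw [← hgi.mul_pow, g_mul_gi, one_pow]
  have hG' : G' * G = 1 := Subtype.ext <| by
    change gi k ^ p * g k ^ p = 1
    rw [← hgi.symm.mul_pow, gi_mul_g, one_pow]
  let x : Fin 5 → Zc k p := ![⟨x21 k ^ p, hmem (by simp [centralGens])⟩,
    ⟨x2 k ^ (2 * p), hmem (by simp [centralGens])⟩, -W,
    ⟨u21 k ^ p, hmem (by simp [centralGens])⟩, ⟨u2 k ^ (2 * p), hmem (by simp [centralGens])⟩]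
  open scoped IsMulCommutative in
  obtain ⟨φ, hT, hT', hX⟩ : ∃ φ : MvPolynomial (Fin 5) (LaurentPolynomial k) →ₐ[k] Zc k p,
      φ (MvPolynomial.C (LaurentPolynomial.T 1)) = G ∧
      φ (MvPolynomial.C (LaurentPolynomial.T (-1))) = G' ∧ ∀ i, φ (MvPolynomial.X i) = x i :=
    ⟨laurentMvAeval ⟨G, G', hG, hG'⟩ x, laurentMvAeval_C_T_one _ x,
      (laurentMvAeval_C_T _ x (-1)).trans (by rw [zpow_neg_one]; rfl), laurentMvAeval_X _ x⟩
  refine ⟨φ, fun y => ?_, congrArg Subtype.val hT, fun i => ?_⟩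
  · have hle : Zc k p ≤ φ.range.map (Zc k p).val := by
      refine Algebra.adjoin_le ?_
      rintro _ (rfl | rfl | rfl | rfl | rfl | rfl | rfl)
      · exact ⟨x 0, ⟨_, hX 0⟩, rfl⟩
      · exact ⟨x 1, ⟨_, hX 1⟩, rfl⟩
      · exact ⟨x 3, ⟨_, hX 3⟩, rfl⟩
      · exact ⟨x 4, ⟨_, hX 4⟩, rfl⟩
      · exact ⟨G, ⟨_, hT⟩, rfl⟩
      · exact ⟨G', ⟨_, hT'⟩, rfl⟩
      · refine ⟨W, ⟨-MvPolynomial.X 2, ?_⟩, rfl⟩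
        exact (map_neg φ _).trans ((congrArg _ (hX 2)).trans (neg_neg W))
    obtain ⟨_, ⟨P, rfl⟩, hP⟩ := hle y.2
    exact ⟨P, Subtype.ext hP⟩
  · rw [hX]
    fin_cases i <;> rfl

end Main

end SuperJordanDouble

open SuperJordanDouble

/-- The central subalgebra `Z` of `D~` is isomorphic as a
`k`-algebra to `k[T^{±1}][X1,…,X5]`, via `T ↦ g^p`, `X1 ↦ x21^p`, `X2 ↦ x2^{2p}`,
`X3 ↦ -(ζ^p - ζ)`, `X4 ↦ u21^p`, `X5 ↦ u2^{2p}`; in particular `Z` is a domain. -/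
theorem superJordanDouble_center_iso (p : ℕ) (hp : p.Prime) (hp2 : 2 < p)
    (k : Type) [Field k] [CharP k p] :
    (∃ φ : MvPolynomial (Fin 5) (LaurentPolynomial k) ≃ₐ[k] Zc k p,
      (φ (MvPolynomial.C (LaurentPolynomial.T 1)) : tD k) = g k ^ p ∧
      (φ (MvPolynomial.X 0) : tD k) = x21 k ^ p ∧
      (φ (MvPolynomial.X 1) : tD k) = x2 k ^ (2 * p) ∧
      (φ (MvPolynomial.X 2) : tD k) = -(z k ^ p - z k) ∧
      (φ (MvPolynomial.X 3) : tD k) = u21 k ^ p ∧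
      (φ (MvPolynomial.X 4) : tD k) = u2 k ^ (2 * p)) ∧
    IsDomain (Zc k p) := by
  have : Fact p.Prime := ⟨hp⟩
  obtain ⟨φ, hsurj, hT, hX⟩ := exists_surjective_algHom_Zc (k := k) p
  have hinj : Function.Injective φ := .of_comp (f := (Zc k p).val)
    (injective_of_apply_generators (φ := (Zc k p).val.comp φ) p hT hX)
  let e : MvPolynomial (Fin 5) (LaurentPolynomial k) ≃ₐ[k] Zc k p :=
    AlgEquiv.ofBijective φ ⟨hinj, hsurj⟩
  exact ⟨⟨e, hT, hX 0, hX 1, hX 2, hX 3, hX 4⟩, e.symm.toMulEquiv.isDomain _⟩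
end

section
/- The algebra D~ is a noetherian ring (both left and right noetherian). -/
namespace SuperJordanDouble

open MulOpposite

section Extension

variable {K A : Type*} [Field K] [Ring A] [Algebra K A]

/-- `a` normalizes the subalgebra `T` up to lower order terms:
`a * t ∈ T * a + T` and `t * a ∈ a * T + T`. -/
def AlmostNormalizes (T : Subalgebra K A) (a t : A) : Prop :=
  (∃ p ∈ T, ∃ q ∈ T, a * t = p * a + q) ∧ ∃ p ∈ T, ∃ q ∈ T, t * a = a * p + q

theorem almostNormalizes_of_mem_adjoin {S : Set A} {a : A}
    (h : ∀ s ∈ S, AlmostNormalizes (Algebra.adjoin K S) a s) {t : A}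
    (ht : t ∈ Algebra.adjoin K S) : AlmostNormalizes (Algebra.adjoin K S) a t := by
  induction ht using Algebra.adjoin_induction with
  | mem x hx => exact h x hx
  | algebraMap r =>
    exact ⟨⟨_, algebraMap_mem _ r, 0, zero_mem _, by rw [add_zero, Algebra.commutes]⟩,
      ⟨_, algebraMap_mem _ r, 0, zero_mem _, by rw [add_zero, Algebra.commutes]⟩⟩
  | add x y hx hy ihx ihy =>
    obtain ⟨⟨p, hp, q, hq, e⟩, p', hp', q', hq', e'⟩ := ihx
    obtain ⟨⟨r, hr, s, hs, f⟩, r', hr', s', hs', f'⟩ := ihy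
    exact ⟨⟨_, add_mem hp hr, _, add_mem hq hs, by rw [mul_add, e, f]; noncomm_ring⟩,
      ⟨_, add_mem hp' hr', _, add_mem hq' hs', by rw [add_mul, e', f']; noncomm_ring⟩⟩
  | mul x y hx hy ihx ihy =>
    obtain ⟨⟨p, hp, q, hq, e⟩, p', hp', q', hq', e'⟩ := ihx
    obtain ⟨⟨r, hr, s, hs, f⟩, r', hr', s', hs', f'⟩ := ihy
    refine ⟨⟨_, mul_mem hp hr, _, add_mem (mul_mem hp hs) (mul_mem hq hy), ?_⟩,
      ⟨_, mul_mem hp' hr', _, add_mem (mul_mem hq' hr') (mul_mem hx hs'), ?_⟩⟩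
    · rw [← mul_assoc, e, add_mul, mul_assoc, f]; noncomm_ring
    · rw [mul_assoc, f', mul_add, ← mul_assoc, e']; noncomm_ring

/-- The left `T`-submodule generated by the powers `a ^ i` with `i < n`. -/
def powSpan (T : Subalgebra K A) (a : A) (n : ℕ) : Submodule T A :=
  Submodule.span T ((fun i => a ^ i) '' Set.Iio n)

variable {T : Subalgebra K A} {a : A}

theorem powSpan_mono : Monotone (powSpan T a) := fun _ _ h =>
  Submodule.span_mono (Set.image_mono (Set.Iio_subset_Iio h))

theorem mul_pow_mem_powSpan {t : A} (ht : t ∈ T) {i n : ℕ} (h : i < n) :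
    t * a ^ i ∈ powSpan T a n :=
  (powSpan T a n).smul_mem ⟨t, ht⟩ (Submodule.subset_span ⟨i, h, rfl⟩)

theorem mul_mem_powSpan {t x : A} {n : ℕ} (ht : t ∈ T) (hx : x ∈ powSpan T a n) :
    t * x ∈ powSpan T a n :=
  (powSpan T a n).smul_mem ⟨t, ht⟩ hx

theorem powSpan_induction {n : ℕ} {p : A → Prop} (zero : p 0)
    (add : ∀ x y, p x → p y → p (x + y)) (mul : ∀ t ∈ T, ∀ i < n, p (t * a ^ i)) {x : A}
    (hx : x ∈ powSpan T a n) : p x := by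
  refine Submodule.closure_induction (p := fun x _ => p x) zero (fun x y _ _ => add x y) ?_ hx
  rintro t _ ⟨i, hi, rfl⟩
  exact mul t t.2 i hi

theorem mem_powSpan_mul {x : A} {n : ℕ} (hx : x ∈ powSpan T a n) :
    x * a ∈ powSpan T a (n + 1) := by
  refine powSpan_induction (p := fun x => x * a ∈ powSpan T a (n + 1)) ?_ ?_ ?_ hx
  · simp
  · intro x y hx hy
    rw [add_mul]
    exact add_mem hx hy
  · intro t ht i hi
    rw [mul_assoc, ← pow_succ]
    exact mul_pow_mem_powSpan ht (by omega)

theorem fg_powSpan (n : ℕ) : (powSpan T a n).FG :=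
  Submodule.fg_span ((Set.finite_Iio n).image _)

theorem mul_mem_powSpan_succ (h : ∀ t ∈ T, AlmostNormalizes T a t) {x : A} {n : ℕ}
    (hx : x ∈ powSpan T a n) : a * x ∈ powSpan T a (n + 1) := by
  refine powSpan_induction (p := fun x => a * x ∈ powSpan T a (n + 1)) ?_ ?_ ?_ hx
  · simp
  · intro x y hx hy
    rw [mul_add]
    exact add_mem hx hy
  · intro t ht i hi
    obtain ⟨⟨p, hp, q, hq, e⟩, -⟩ := h t ht
    rw [← mul_assoc, e, add_mul, mul_assoc, ← pow_succ']
    exact add_mem (mul_pow_mem_powSpan hp (by omega)) (mul_pow_mem_powSpan hq (by omega))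

theorem pow_mul_mem_powSpan (h : ∀ t ∈ T, AlmostNormalizes T a t) (m : ℕ) {x : A} {n : ℕ}
    (hx : x ∈ powSpan T a n) : a ^ m * x ∈ powSpan T a (n + m) := by
  induction m with
  | zero => simpa using hx
  | succ m ih =>
    rw [pow_succ', mul_assoc, ← add_assoc]
    exact mul_mem_powSpan_succ h ih

theorem exists_pow_mul_sub_mem (h : ∀ t ∈ T, AlmostNormalizes T a t) (n : ℕ) {t : A}
    (ht : t ∈ T) : ∃ p ∈ T, a ^ n * t - p * a ^ n ∈ powSpan T a n := by
  induction n with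
  | zero => exact ⟨t, ht, by simp⟩
  | succ n ih =>
    obtain ⟨p, hp, hx⟩ := ih
    obtain ⟨⟨r, hr, s, hs, e⟩, -⟩ := h p hp
    refine ⟨r, hr, ?_⟩
    have : a ^ (n + 1) * t - r * a ^ (n + 1) = a * (a ^ n * t - p * a ^ n) + s * a ^ n := by
      have : a * (p * a ^ n) = r * a ^ (n + 1) + s * a ^ n := by
        rw [← mul_assoc, e, add_mul, mul_assoc, ← pow_succ']
      rw [mul_sub, this, pow_succ' a n]
      noncomm_ring
    rw [this]
    exact add_mem (mul_mem_powSpan_succ h hx) (mul_pow_mem_powSpan hs (by omega))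

theorem exists_mul_pow_sub_mem (h : ∀ t ∈ T, AlmostNormalizes T a t) (n : ℕ) {t : A}
    (ht : t ∈ T) : ∃ p ∈ T, t * a ^ n - a ^ n * p ∈ powSpan T a n := by
  induction n with
  | zero => exact ⟨t, ht, by simp⟩
  | succ n ih =>
    obtain ⟨p, hp, hx⟩ := ih
    obtain ⟨-, r, hr, s, hs, e⟩ := h p hp
    refine ⟨r, hr, ?_⟩
    have : t * a ^ (n + 1) - a ^ (n + 1) * r = (t * a ^ n - a ^ n * p) * a + a ^ n * s := by
      rw [sub_mul, mul_assoc _ p, e, pow_succ a n]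
      noncomm_ring
    rw [this]
    obtain ⟨q, hq, hy⟩ := exists_pow_mul_sub_mem h n hs
    refine add_mem (mem_powSpan_mul hx) ?_
    rw [← sub_add_cancel (a ^ n * s) (q * a ^ n)]
    exact add_mem (powSpan_mono n.le_succ hy) (mul_pow_mem_powSpan hq (by omega))

theorem mem_powSpan_mul_mem (h : ∀ t ∈ T, AlmostNormalizes T a t) {x t : A} {n : ℕ}
    (hx : x ∈ powSpan T a n) (ht : t ∈ T) : x * t ∈ powSpan T a n := by
  refine powSpan_induction (p := fun x => x * t ∈ powSpan T a n) ?_ ?_ ?_ hx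
  · simp
  · intro x y hx hy
    rw [add_mul]
    exact add_mem hx hy
  · intro s hs i hi
    obtain ⟨q, hq, hy⟩ := exists_pow_mul_sub_mem h i ht
    rw [mul_assoc, ← sub_add_cancel (a ^ i * t) (q * a ^ i)]
    exact mul_mem_powSpan hs
      (add_mem (powSpan_mono hi.le hy) (mul_pow_mem_powSpan hq hi))

theorem exists_pow_mul_add_of_mem_powSpan_succ (h : ∀ t ∈ T, AlmostNormalizes T a t)
    {x : A} {n : ℕ} (hx : x ∈ powSpan T a (n + 1)) :
    ∃ r ∈ T, ∃ f ∈ powSpan T a n, x = a ^ n * r + f := by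
  refine powSpan_induction (p := fun x => ∃ r ∈ T, ∃ f ∈ powSpan T a n, x = a ^ n * r + f)
    ?_ ?_ ?_ hx
  · exact ⟨0, zero_mem _, 0, zero_mem _, by simp⟩
  · rintro _ _ ⟨r, hr, f, hf, rfl⟩ ⟨s, hs, g, hg, rfl⟩
    exact ⟨_, add_mem hr hs, _, add_mem hf hg, by noncomm_ring⟩
  · intro t ht i hi
    rcases Nat.lt_succ_iff_lt_or_eq.mp hi with hi | rfl
    · exact ⟨0, zero_mem _, _, mul_pow_mem_powSpan ht hi, by simp⟩
    · obtain ⟨p, hp, hy⟩ := exists_mul_pow_sub_mem h i ht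
      exact ⟨p, hp, _, hy, by noncomm_ring⟩

/-- The left ideal of leading coefficients in degree `n` of elements of `J`. -/
def leadingIdeal (h : ∀ t ∈ T, AlmostNormalizes T a t) (J : Submodule T A) (n : ℕ) : Ideal T where
  carrier := {r | ∃ f ∈ powSpan T a n, a ^ n * r + f ∈ J}
  zero_mem' := ⟨0, zero_mem _, by simp⟩
  add_mem' := by
    rintro r s ⟨f, hf, hr⟩ ⟨g, hg, hs⟩
    refine ⟨_, add_mem hf hg, ?_⟩
    convert add_mem hr hs using 1
    push_cast
    noncomm_ring
  smul_mem' := by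
    rintro s r ⟨f, hf, hr⟩
    obtain ⟨p, hp, hy⟩ := exists_pow_mul_sub_mem h n s.2
    refine ⟨p * f - (a ^ n * s - p * a ^ n) * r,
      sub_mem (mul_mem_powSpan hp hf) (mem_powSpan_mul_mem h hy r.2), ?_⟩
    convert J.smul_mem ⟨p, hp⟩ hr using 1
    rw [smul_eq_mul, Subalgebra.smul_def, smul_eq_mul]
    push_cast
    noncomm_ring

theorem leadingIdeal_mono (h : ∀ t ∈ T, AlmostNormalizes T a t) {J : Submodule T A}
    (hJ : ∀ x ∈ J, a * x ∈ J) : Monotone (leadingIdeal h J) := by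
  refine monotone_nat_of_le_succ fun n r => ?_
  rintro ⟨f, hf, hr⟩
  refine ⟨_, mul_mem_powSpan_succ h hf, ?_⟩
  rw [pow_succ', mul_assoc, ← mul_add]
  exact hJ _ hr

theorem pow_mul_mem {J : Submodule T A} (hJ : ∀ x ∈ J, a * x ∈ J) (m : ℕ) {x : A} (hx : x ∈ J) :
    a ^ m * x ∈ J := by
  induction m with
  | zero => simpa using hx
  | succ m ih =>
    rw [pow_succ', mul_assoc]
    exact hJ _ ih

theorem exists_finite_generation [IsNoetherianRing T] (h : ∀ t ∈ T, AlmostNormalizes T a t)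
    {J : Submodule T A} (hJ : ∀ x ∈ J, a * x ∈ J) (hJF : ∀ x ∈ J, ∃ n, x ∈ powSpan T a n) :
    ∃ s : Set A, s.Finite ∧ s ⊆ J ∧
      ∀ L : Submodule T A, (∀ x ∈ L, a * x ∈ L) → s ⊆ L → J ≤ L := by
  obtain ⟨N, hN⟩ := monotone_stabilizes_iff_noetherian.mpr ‹IsNoetherianRing T›
    ⟨leadingIdeal h J, leadingIdeal_mono h hJ⟩
  have := isNoetherian_of_fg_of_noetherian _ (fg_powSpan (T := T) (a := a) (N + 1))
  obtain ⟨s, hs, e⟩ := Submodule.fg_def.mp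
    (isNoetherian_submodule.mp this (J ⊓ powSpan T a (N + 1)) inf_le_right)
  refine ⟨s, hs, fun x hx => (e ▸ Submodule.subset_span hx : x ∈ J ⊓ _).1, fun L hL hsL => ?_⟩
  have base : J ⊓ powSpan T a (N + 1) ≤ L := e ▸ Submodule.span_le.mpr hsL
  suffices ∀ m, J ⊓ powSpan T a (N + 1 + m) ≤ L by
    intro x hx
    obtain ⟨n, hn⟩ := hJF x hx
    exact this n ⟨hx, powSpan_mono (by omega) hn⟩
  intro m
  induction m with
  | zero => exact base
  | succ m ih =>
    intro x hx
    obtain ⟨hxJ, hx⟩ := Submodule.mem_inf.mp hx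
    obtain ⟨r, hr, f, hf, rfl⟩ :=
      exists_pow_mul_add_of_mem_powSpan_succ (n := N + 1 + m) h hx
    have hmem : (⟨r, hr⟩ : T) ∈ leadingIdeal h J N := by
      have e := hN (N + 1 + m) (by omega)
      simp only [OrderHom.coe_mk] at e
      rw [e]
      exact ⟨f, hf, hxJ⟩
    obtain ⟨g, hg, hy⟩ := hmem
    have hyL : a ^ N * r + g ∈ L := by
      refine base ⟨hy, add_mem ?_ (powSpan_mono N.le_succ hg)⟩
      obtain ⟨p, hp, hz⟩ := exists_pow_mul_sub_mem h N hr
      rw [← sub_add_cancel (a ^ N * r) (p * a ^ N)]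
      exact add_mem (powSpan_mono N.le_succ hz) (mul_pow_mem_powSpan hp (by omega))
    have hlow : f - a ^ (m + 1) * g ∈ L := by
      refine ih ⟨SetLike.mem_coe.mpr ?_,
        sub_mem hf (powSpan_mono (by omega) (pow_mul_mem_powSpan h (m + 1) hg))⟩
      convert sub_mem hxJ (pow_mul_mem hJ (m + 1) hy) using 1
      rw [mul_add, ← mul_assoc, ← pow_add, show m + 1 + N = N + 1 + m by omega]
      noncomm_ring
    convert add_mem hlow (pow_mul_mem hL (m + 1) hyL) using 1
    rw [mul_add, ← mul_assoc, ← pow_add, show m + 1 + N = N + 1 + m by omega]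
    noncomm_ring

/-- A left ideal of a larger subalgebra, viewed as a `T`-submodule of the ambient algebra. -/
def idealToSubmodule {T' : Subalgebra K A} (hT : T ≤ T') (I : Ideal T') : Submodule T A where
  carrier := {x | ∃ hx : x ∈ T', (⟨x, hx⟩ : T') ∈ I}
  zero_mem' := ⟨zero_mem _, I.zero_mem⟩
  add_mem' := by
    rintro x y ⟨hx, hxI⟩ ⟨hy, hyI⟩
    exact ⟨add_mem hx hy, I.add_mem hxI hyI⟩
  smul_mem' := by
    rintro t x ⟨hx, hxI⟩
    exact ⟨mul_mem (hT t.2) hx, I.mul_mem_left ⟨t, hT t.2⟩ hxI⟩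

theorem exists_mem_powSpan (h : ∀ t ∈ T, AlmostNormalizes T a t) {S : Set A}
    (hT : T = Algebra.adjoin K S) {x : A} (hx : x ∈ Algebra.adjoin K (insert a S)) :
    ∃ n, x ∈ powSpan T a n := by
  suffices ∀ y n, y ∈ powSpan T a n → ∃ m, x * y ∈ powSpan T a m by
    obtain ⟨m, hm⟩ := this 1 1 (by simpa using mul_pow_mem_powSpan (a := a) (one_mem T) one_pos)
    exact ⟨m, by simpa using hm⟩
  induction hx using Algebra.adjoin_induction with
  | mem x hx =>
    intro y n hy
    rcases hx with rfl | hx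
    · exact ⟨_, mul_mem_powSpan_succ h hy⟩
    · exact ⟨n, mul_mem_powSpan (hT ▸ Algebra.subset_adjoin hx) hy⟩
  | algebraMap r => exact fun y n hy => ⟨n, mul_mem_powSpan (algebraMap_mem T r) hy⟩
  | add u v _ _ hu hv =>
    intro y n hy
    obtain ⟨m, hm⟩ := hu y n hy
    obtain ⟨l, hl⟩ := hv y n hy
    exact ⟨max m l, add_mul u v y ▸
      add_mem (powSpan_mono (le_max_left m l) hm) (powSpan_mono (le_max_right m l) hl)⟩
  | mul u v _ _ hu hv =>
    intro y n hy
    obtain ⟨m, hm⟩ := hv y n hy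
    exact mul_assoc u v y ▸ hu _ m hm

/-- Adjoining to a left noetherian subalgebra an element that almost normalizes it gives a
left noetherian subalgebra. -/
theorem isNoetherianRing_adjoin_insert {S : Set A}
    (h : ∀ s ∈ S, AlmostNormalizes (Algebra.adjoin K S) a s)
    (hS : IsNoetherianRing (Algebra.adjoin K S)) :
    IsNoetherianRing (Algebra.adjoin K (insert a S)) := by
  have h' := fun t ht => almostNormalizes_of_mem_adjoin h (t := t) ht
  have hT : Algebra.adjoin K S ≤ Algebra.adjoin K (insert a S) :=
    Algebra.adjoin_mono (Set.subset_insert a S)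
  have ha : a ∈ Algebra.adjoin K (insert a S) := Algebra.subset_adjoin (Set.mem_insert a S)
  have stable (I : Ideal (Algebra.adjoin K (insert a S))) :
      ∀ x ∈ idealToSubmodule hT I, a * x ∈ idealToSubmodule hT I := by
    rintro x ⟨hx, hxI⟩
    exact ⟨mul_mem ha hx, I.mul_mem_left ⟨a, ha⟩ hxI⟩
  refine (isNoetherianRing_iff_ideal_fg _).mpr fun I => ?_
  obtain ⟨s, hs, hsI, hgen⟩ := exists_finite_generation h' (stable I)
    fun x hx => exists_mem_powSpan h' rfl hx.1
  refine Submodule.fg_def.mpr ⟨Subtype.val ⁻¹' s, hs.preimage Subtype.val_injective.injOn,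
    le_antisymm (Submodule.span_le.mpr fun x hx => (hsI hx).2) fun x hx => ?_⟩
  exact (hgen _ (stable _) (fun y hy => ⟨(hsI hy).1, Submodule.subset_span hy⟩) ⟨x.2, hx⟩).2

/-- The subalgebra generated by `S` is both left and right noetherian. -/
def IsNoetherianAdjoin (K : Type*) {A : Type*} [Field K] [Ring A] [Algebra K A]
    (S : Set A) : Prop :=
  IsNoetherianRing (Algebra.adjoin K S) ∧ IsNoetherianRing (Algebra.adjoin K (unop ⁻¹' S))

theorem isNoetherianRing_adjoin_empty : IsNoetherianRing (Algebra.adjoin K (∅ : Set A)) := by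
  refine isNoetherianRing_of_surjective K _ (algebraMap K (Algebra.adjoin K (∅ : Set A))) ?_
  rintro ⟨x, hx⟩
  obtain ⟨r, rfl⟩ := Algebra.mem_bot.mp (Algebra.adjoin_empty K A ▸ hx)
  exact ⟨r, rfl⟩

theorem isNoetherianAdjoin_empty : IsNoetherianAdjoin K (∅ : Set A) :=
  ⟨isNoetherianRing_adjoin_empty, isNoetherianRing_adjoin_empty⟩

theorem IsNoetherianAdjoin.adjoin_insert {S : Set A} (hS : IsNoetherianAdjoin K S)
    (h : ∀ s ∈ S, AlmostNormalizes (Algebra.adjoin K S) a s) :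
    IsNoetherianAdjoin K (insert a S) := by
  refine ⟨isNoetherianRing_adjoin_insert h hS.1, ?_⟩
  have e : (unop ⁻¹' (insert a S) : Set Aᵐᵒᵖ) = insert (op a) (unop ⁻¹' S) := by
    ext x
    simp [← unop_inj]
  rw [e]
  refine isNoetherianRing_adjoin_insert (fun s hs => ?_) hS.2
  rw [← Subalgebra.op_adjoin]
  obtain ⟨⟨p, hp, q, hq, e⟩, r, hr, t, ht, f⟩ := h _ hs
  exact ⟨⟨op r, hr, op t, ht, unop_injective f⟩, ⟨op p, hp, op q, hq, unop_injective e⟩⟩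

theorem IsNoetherianAdjoin.of_eq_top {S : Set A} (hS : IsNoetherianAdjoin K S)
    (h : Algebra.adjoin K S = ⊤) : IsNoetherianRing A ∧ IsNoetherianRing Aᵐᵒᵖ := by
  obtain ⟨h₁, h₂⟩ := hS
  rw [← Subalgebra.op_adjoin, h, Subalgebra.op_top] at h₂
  rw [h] at h₁
  exact ⟨isNoetherianRing_of_ringEquiv _ (Subalgebra.topEquiv (R := K) (A := A)).toRingEquiv,
    isNoetherianRing_of_ringEquiv _ (Subalgebra.topEquiv (R := K) (A := Aᵐᵒᵖ)).toRingEquiv⟩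

theorem AlmostNormalizes.of_commute_add {t q : A} (ht : t ∈ T) (hq : q ∈ T)
    (e : a * t = t * a + q) : AlmostNormalizes T a t :=
  ⟨⟨t, ht, q, hq, e⟩, ⟨t, ht, -q, neg_mem hq, by rw [e]; abel⟩⟩

theorem AlmostNormalizes.of_commute {t : A} (ht : t ∈ T) (e : a * t = t * a) :
    AlmostNormalizes T a t :=
  .of_commute_add ht (zero_mem T) (by rw [e, add_zero])

theorem AlmostNormalizes.of_anticommute_add {t q : A} (ht : t ∈ T) (hq : q ∈ T)
    (e : a * t = -(t * a) + q) : AlmostNormalizes T a t :=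
  ⟨⟨-t, neg_mem ht, q, hq, by rw [e]; noncomm_ring⟩,
    ⟨-t, neg_mem ht, q, hq, by rw [mul_neg, e]; abel⟩⟩

theorem AlmostNormalizes.of_weight {t : A} (ht : t ∈ T) (n : ℤ) (e : a * t = t * a + n • a) :
    AlmostNormalizes T a t := by
  have hn : (n : A) ∈ T := intCast_mem T n
  exact ⟨⟨t + n, add_mem ht hn, 0, zero_mem T, by rw [e, zsmul_eq_mul]; noncomm_ring⟩,
    ⟨t - n, sub_mem ht hn, 0, zero_mem T, by
      rw [mul_sub, e, zsmul_eq_mul, (Int.cast_commute n a).eq]; noncomm_ring⟩⟩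

end Extension

section Relations

/-- Elements of a ring satisfying the defining relations of `D~`, together with the names
`x21` and `u21` for the two anticommutators. -/
structure SatisfiesRel {A : Type*} [Ring A] (x1 x2 x21 u1 u2 u21 g gi z : A) : Prop where
  x21_eq : x21 = x1 * x2 + x2 * x1
  u21_eq : u21 = u1 * u2 + u2 * u1
  x1_mul_x1 : x1 * x1 = 0
  x2_mul_x21 : x2 * x21 = x21 * x2 + x1 * x21
  u1_mul_u1 : u1 * u1 = 0
  u2_mul_u21 : u2 * u21 = u21 * u2 + u1 * u21
  g_mul_gi : g * gi = 1
  gi_mul_g : gi * g = 1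
  z_mul_g : z * g = g * z
  g_mul_x1 : g * x1 = x1 * g
  g_mul_x2 : g * x2 = x2 * g - x1 * g
  u1_mul_g : u1 * g = g * u1
  u2_mul_g : u2 * g = g * u2 - g * u1
  z_mul_x1 : z * x1 = x1 * z + x1
  z_mul_x2 : z * x2 = x2 * z + x2
  u1_mul_z : u1 * z = z * u1 + u1
  u2_mul_z : u2 * z = z * u2 + u2
  u1_mul_x1 : u1 * x1 = -(x1 * u1)
  u1_mul_x2 : u1 * x2 = -(x2 * u1) + 1 - g
  u2_mul_x1 : u2 * x1 = -(x1 * u2) + 1 - g + x1 * u1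
  u2_mul_x2 : u2 * x2 = -(x2 * u2) + g * z + x2 * u1

namespace SatisfiesRel

variable {A : Type*} [Ring A] {x1 x2 x21 u1 u2 u21 g gi z : A}

theorem gi_mul_of_mul_g (h : SatisfiesRel x1 x2 x21 u1 u2 u21 g gi z) {y w : A}
    (e : y * g = g * w) : gi * y = w * gi := by
  have : gi * (y * g) * gi = gi * (g * w) * gi := by rw [e]
  rwa [mul_assoc, mul_assoc y, h.g_mul_gi, mul_one, ← mul_assoc, h.gi_mul_g, one_mul] at this

theorem gi_mul_z (h : SatisfiesRel x1 x2 x21 u1 u2 u21 g gi z) :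
    gi * z = z * gi :=
  h.gi_mul_of_mul_g h.z_mul_g

theorem gi_mul_x1 (h : SatisfiesRel x1 x2 x21 u1 u2 u21 g gi z) :
    gi * x1 = x1 * gi :=
  h.gi_mul_of_mul_g h.g_mul_x1.symm

theorem x21_mul_g (h : SatisfiesRel x1 x2 x21 u1 u2 u21 g gi z) :
    x21 * g = g * x21 := by
  linear_combination (norm := (simp only [h.x21_eq]; noncomm_ring))
    -h.g_mul_x1 * x2 - x1 * h.g_mul_x2 - h.g_mul_x2 * x1 - x2 * h.g_mul_x1 +
      2 * h.x1_mul_x1 * g + x1 * h.g_mul_x1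

theorem gi_mul_x21 (h : SatisfiesRel x1 x2 x21 u1 u2 u21 g gi z) :
    gi * x21 = x21 * gi :=
  h.gi_mul_of_mul_g h.x21_mul_g

theorem z_mul_x21 (h : SatisfiesRel x1 x2 x21 u1 u2 u21 g gi z) :
    z * x21 = x21 * z + 2 * x21 := by
  linear_combination (norm := (simp only [h.x21_eq]; noncomm_ring))
    h.z_mul_x1 * x2 + x1 * h.z_mul_x2 + h.z_mul_x2 * x1 + x2 * h.z_mul_x1

theorem x21_mul_x1 (h : SatisfiesRel x1 x2 x21 u1 u2 u21 g gi z) :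
    x21 * x1 = x1 * x21 := by
  linear_combination (norm := (simp only [h.x21_eq]; noncomm_ring))
    x2 * h.x1_mul_x1 - h.x1_mul_x1 * x2

theorem x2_mul_g (h : SatisfiesRel x1 x2 x21 u1 u2 u21 g gi z) :
    x2 * g = g * x2 + g * x1 := by
  linear_combination (norm := noncomm_ring)
    -h.g_mul_x2 - h.g_mul_x1

theorem gi_mul_x2 (h : SatisfiesRel x1 x2 x21 u1 u2 u21 g gi z) :
    gi * x2 = x2 * gi + x1 * gi := by
  rw [h.gi_mul_of_mul_g (h.x2_mul_g.trans (mul_add _ _ _).symm), add_mul]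

theorem gi_mul_u1 (h : SatisfiesRel x1 x2 x21 u1 u2 u21 g gi z) :
    gi * u1 = u1 * gi :=
  h.gi_mul_of_mul_g h.u1_mul_g

theorem u1_mul_x21 (h : SatisfiesRel x1 x2 x21 u1 u2 u21 g gi z) :
    u1 * x21 = x21 * u1 := by
  linear_combination (norm := (simp only [h.x21_eq]; noncomm_ring))
    h.u1_mul_x1 * x2 + h.u1_mul_x2 * x1 - x1 * h.u1_mul_x2 - x2 * h.u1_mul_x1 - h.g_mul_x1

theorem u21_mul_g (h : SatisfiesRel x1 x2 x21 u1 u2 u21 g gi z) :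
    u21 * g = g * u21 := by
  linear_combination (norm := (simp only [h.u21_eq]; noncomm_ring))
    u1 * h.u2_mul_g + h.u1_mul_g * u2 + u2 * h.u1_mul_g + h.u2_mul_g * u1 - h.u1_mul_g * u1 -
      2 * g * h.u1_mul_u1

theorem gi_mul_u21 (h : SatisfiesRel x1 x2 x21 u1 u2 u21 g gi z) :
    gi * u21 = u21 * gi :=
  h.gi_mul_of_mul_g h.u21_mul_g

theorem u21_mul_z (h : SatisfiesRel x1 x2 x21 u1 u2 u21 g gi z) :
    u21 * z = z * u21 + 2 * u21 := by
  linear_combination (norm := (simp only [h.u21_eq]; noncomm_ring))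
    u1 * h.u2_mul_z + h.u1_mul_z * u2 + u2 * h.u1_mul_z + h.u2_mul_z * u1

theorem u21_mul_x1 (h : SatisfiesRel x1 x2 x21 u1 u2 u21 g gi z) :
    u21 * x1 = x1 * u21 := by
  linear_combination (norm := (simp only [h.u21_eq]; noncomm_ring))
    u1 * h.u2_mul_x1 - h.u1_mul_x1 * u2 - h.u1_mul_g + h.u1_mul_x1 * u1 + u2 * h.u1_mul_x1 -
      h.u2_mul_x1 * u1 - 2 * x1 * h.u1_mul_u1

theorem u21_mul_x2 (h : SatisfiesRel x1 x2 x21 u1 u2 u21 g gi z) :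
    u21 * x2 = x2 * u21 + (1 + g) * u1 := by
  linear_combination (norm := (simp only [h.u21_eq]; noncomm_ring))
    u1 * h.u2_mul_x2 - h.u1_mul_x2 * u2 + h.u1_mul_g * z + g * h.u1_mul_z + h.u1_mul_x2 * u1 +
      u2 * h.u1_mul_x2 - h.u2_mul_x2 * u1 - h.u2_mul_g - 2 * x2 * h.u1_mul_u1

theorem u21_mul_x21 (h : SatisfiesRel x1 x2 x21 u1 u2 u21 g gi z) :
    u21 * x21 = x21 * u21 := by
  linear_combination (norm := (simp only [h.x21_eq]; noncomm_ring))
    h.u21_mul_x1 * x2 + x1 * h.u21_mul_x2 + h.u21_mul_x2 * x1 + x2 * h.u21_mul_x1 + (1 +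
      g) * h.u1_mul_x1 - h.g_mul_x1 * u1

theorem u21_mul_u1 (h : SatisfiesRel x1 x2 x21 u1 u2 u21 g gi z) :
    u21 * u1 = u1 * u21 := by
  linear_combination (norm := (simp only [h.u21_eq]; noncomm_ring))
    u2 * h.u1_mul_u1 - h.u1_mul_u1 * u2

theorem gi_mul_u2 (h : SatisfiesRel x1 x2 x21 u1 u2 u21 g gi z) :
    gi * u2 = u2 * gi - u1 * gi := by
  rw [h.gi_mul_of_mul_g (h.u2_mul_g.trans (mul_sub _ _ _).symm), sub_mul]

theorem u2_mul_x21 (h : SatisfiesRel x1 x2 x21 u1 u2 u21 g gi z) :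
    u2 * x21 = x21 * u2 + (x1 + x1 * g - 2 * x21 * u1) := by
  linear_combination (norm := (simp only [h.x21_eq]; noncomm_ring))
    h.u2_mul_x1 * x2 + h.u2_mul_x2 * x1 - x1 * h.u2_mul_x2 - x2 * h.u2_mul_x1 +
      x1 * h.u1_mul_x2 + x2 * h.u1_mul_x1 + g * h.z_mul_x1 + h.g_mul_x1 * z + h.g_mul_x1 -
      h.g_mul_x2

theorem isNoetherianAdjoin_torus (K : Type*) [Field K] [Algebra K A]
    (h : SatisfiesRel x1 x2 x21 u1 u2 u21 g gi z) : IsNoetherianAdjoin K {z, gi, g} := by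
  have h₁ : IsNoetherianAdjoin K {g} := by
    simpa using (isNoetherianAdjoin_empty (K := K)).adjoin_insert (a := g) (by simp)
  have h₂ : IsNoetherianAdjoin K {gi, g} := by
    refine h₁.adjoin_insert ?_
    simp only [Set.mem_singleton_iff, forall_eq]
    exact .of_commute (by aesop) (h.gi_mul_g.trans h.g_mul_gi.symm)
  refine h₂.adjoin_insert ?_
  simp only [Set.forall_mem_insert, Set.mem_singleton_iff, forall_eq]
  exact ⟨.of_commute (by aesop) h.gi_mul_z.symm, .of_commute (by aesop) h.z_mul_g⟩

theorem isNoetherianAdjoin_borel (K : Type*) [Field K] [Algebra K A]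
    (h : SatisfiesRel x1 x2 x21 u1 u2 u21 g gi z) :
    IsNoetherianAdjoin K {x2, x21, x1, z, gi, g} := by
  have h₁ : IsNoetherianAdjoin K {x1, z, gi, g} := by
    refine (h.isNoetherianAdjoin_torus K).adjoin_insert ?_
    simp only [Set.forall_mem_insert, Set.mem_singleton_iff, forall_eq]
    exact ⟨.of_weight (by aesop) (-1) (by rw [h.z_mul_x1]; abel),
      .of_commute (by aesop) h.gi_mul_x1.symm, .of_commute (by aesop) h.g_mul_x1.symm⟩
  have h₂ : IsNoetherianAdjoin K {x21, x1, z, gi, g} := by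
    refine h₁.adjoin_insert ?_
    simp only [Set.forall_mem_insert, Set.mem_singleton_iff, forall_eq]
    exact ⟨.of_commute (by aesop) h.x21_mul_x1,
      .of_weight (by aesop) (-2) (by rw [h.z_mul_x21]; noncomm_ring),
      .of_commute (by aesop) h.gi_mul_x21.symm, .of_commute (by aesop) h.x21_mul_g⟩
  refine h₂.adjoin_insert ?_
  simp only [Set.forall_mem_insert, Set.mem_singleton_iff, forall_eq]
  exact ⟨.of_commute_add (by aesop) (by aesop) h.x2_mul_x21,
    .of_anticommute_add (q := x21) (by aesop) (by aesop) (by rw [h.x21_eq]; abel),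
    .of_weight (by aesop) (-1) (by rw [h.z_mul_x2]; abel),
    .of_commute_add (q := -(x1 * gi)) (by aesop) (by aesop) (by rw [h.gi_mul_x2]; abel),
    .of_commute_add (by aesop) (by aesop) h.x2_mul_g⟩

theorem isNoetherianAdjoin (K : Type*) [Field K] [Algebra K A]
    (h : SatisfiesRel x1 x2 x21 u1 u2 u21 g gi z) :
    IsNoetherianAdjoin K {u2, u21, u1, x2, x21, x1, z, gi, g} := by
  have h₁ : IsNoetherianAdjoin K {u1, x2, x21, x1, z, gi, g} := by
    refine (h.isNoetherianAdjoin_borel K).adjoin_insert ?_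
    simp only [Set.forall_mem_insert, Set.mem_singleton_iff, forall_eq]
    exact ⟨.of_anticommute_add (q := 1 - g) (by aesop) (sub_mem (one_mem _) (by aesop))
        (by rw [h.u1_mul_x2]; abel),
      .of_commute (by aesop) h.u1_mul_x21,
      .of_anticommute_add (by aesop) (zero_mem _) (by rw [h.u1_mul_x1, add_zero]),
      .of_weight (by aesop) 1 (by rw [h.u1_mul_z, one_zsmul]),
      .of_commute (by aesop) h.gi_mul_u1.symm, .of_commute (by aesop) h.u1_mul_g⟩
  have h₂ : IsNoetherianAdjoin K {u21, u1, x2, x21, x1, z, gi, g} := by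
    refine h₁.adjoin_insert ?_
    simp only [Set.forall_mem_insert, Set.mem_singleton_iff, forall_eq]
    exact ⟨.of_commute (by aesop) h.u21_mul_u1,
      .of_commute_add (by aesop) (mul_mem (add_mem (one_mem _) (by aesop)) (by aesop))
        h.u21_mul_x2,
      .of_commute (by aesop) h.u21_mul_x21, .of_commute (by aesop) h.u21_mul_x1,
      .of_weight (by aesop) 2 (by rw [h.u21_mul_z]; noncomm_ring),
      .of_commute (by aesop) h.gi_mul_u21.symm, .of_commute (by aesop) h.u21_mul_g⟩
  refine h₂.adjoin_insert ?_
  simp only [Set.forall_mem_insert, Set.mem_singleton_iff, forall_eq]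
  exact ⟨.of_commute_add (by aesop) (by aesop) h.u2_mul_u21,
    .of_anticommute_add (q := u21) (by aesop) (by aesop) (by rw [h.u21_eq]; abel),
    .of_anticommute_add (q := g * z + x2 * u1) (by aesop)
      (add_mem (by aesop) (by aesop)) (by rw [h.u2_mul_x2]; abel),
    .of_commute_add (by aesop) (sub_mem (add_mem (by aesop) (by aesop))
      (mul_mem (mul_mem (ofNat_mem _ 2) (by aesop)) (by aesop))) h.u2_mul_x21,
    .of_anticommute_add (q := 1 - g + x1 * u1) (by aesop)
      (add_mem (sub_mem (one_mem _) (by aesop)) (by aesop)) (by rw [h.u2_mul_x1]; abel),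
    .of_weight (by aesop) 1 (by rw [h.u2_mul_z, one_zsmul]),
    .of_commute_add (q := u1 * gi) (by aesop) (by aesop) (by rw [h.gi_mul_u2]; abel),
    .of_commute_add (q := -(g * u1)) (by aesop) (by aesop) (by rw [h.u2_mul_g]; abel)⟩

end SatisfiesRel

theorem satisfiesRel (k : Type) [Field k] :
    SatisfiesRel (x1 k) (x2 k) (x21 k) (u1 k) (u2 k) (u21 k) (g k) (gi k) (z k) := by
  constructor
  · rfl
  · rfl
  all_goals
    simp only [x1, x2, x21, u1, u2, u21, g, gi, z, ← map_mul, ← map_add, ← map_sub, ← map_neg,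
      ← map_one (RingQuot.mkAlgHom k (Rel k)), ← map_zero (RingQuot.mkAlgHom k (Rel k))]
    exact RingQuot.mkAlgHom_rel k (by constructor)

theorem adjoin_generators_eq_top (k : Type) [Field k] :
    Algebra.adjoin k {u2 k, u21 k, u1 k, x2 k, x21 k, x1 k, z k, gi k, g k} = ⊤ := by
  rw [eq_top_iff, ← (AlgHom.range_eq_top _).mpr (RingQuot.mkAlgHom_surjective k (Rel k)),
    ← Algebra.map_top, ← FreeAlgebra.adjoin_range_ι, AlgHom.map_adjoin]
  refine Algebra.adjoin_mono ?_
  rintro _ ⟨_, ⟨i, rfl⟩, rfl⟩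
  fin_cases i <;> simp [x1, x2, u1, u2, g, gi, z, fx1, fx2, fu1, fu2, fg, fgi, fz]

end Relations

end SuperJordanDouble

open SuperJordanDouble

/-- `D~` is a noetherian ring (left and right noetherian;
right noetherianity is stated as left noetherianity of the opposite ring). -/
theorem superJordanDouble_noetherian (k : Type) [Field k] (hchar : (2 : k) ≠ 0) :
    IsNoetherianRing (tD k) ∧ IsNoetherianRing (tD k)ᵐᵒᵖ := by
  exact ((satisfiesRel k).isNoetherianAdjoin k).of_eq_top (adjoin_generators_eq_top k)
end

section
/- The algebra DH admits a Hopf k-algebra structure (with bijective antipode) whose comultiplication Δ, counit and antipode are determined on generators by: Δ(γ) = γ⊗γ, Δ(ε) = ε⊗ε, Δ(ζ) = ζ⊗1 + 1⊗ζ, Δ(x1) = x1⊗1 + γ⊗x1, Δ(x2) = x2⊗1 + γ⊗x2, Δ(u1) = u1⊗1 + ε⊗u1, Δ(u2) = u2⊗1 + ε⊗u2 - ε*ζ⊗u1, with counit sending γ, ε to 1 and ζ, x1, x2, u1, u2 to 0. -/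
/-!
The Drinfeld double `D(H)` of the bosonization of the restricted super Jordan
plane, presented by generators x1, x2, ζ, ε, γ, u1, u2 and the relations of the
paper, realized as `RingQuot` of a relation on the free algebra on 7 generators.
-/

namespace RestrictedDoubleDH

variable (k : Type) [Field k] (p : ℕ)

noncomputable def fx1 : FreeAlgebra k (Fin 7) := FreeAlgebra.ι k 0
noncomputable def fx2 : FreeAlgebra k (Fin 7) := FreeAlgebra.ι k 1
noncomputable def fz  : FreeAlgebra k (Fin 7) := FreeAlgebra.ι k 2
noncomputable def fe  : FreeAlgebra k (Fin 7) := FreeAlgebra.ι k 3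
noncomputable def fga : FreeAlgebra k (Fin 7) := FreeAlgebra.ι k 4
noncomputable def fu1 : FreeAlgebra k (Fin 7) := FreeAlgebra.ι k 5
noncomputable def fu2 : FreeAlgebra k (Fin 7) := FreeAlgebra.ι k 6
noncomputable def fx21 : FreeAlgebra k (Fin 7) := fx1 k * fx2 k + fx2 k * fx1 k
noncomputable def fu21 : FreeAlgebra k (Fin 7) := fu1 k * fu2 k + fu2 k * fu1 k

/-- The defining relations of `D(H)`. -/
inductive Rel : FreeAlgebra k (Fin 7) → FreeAlgebra k (Fin 7) → Prop
  | x1sq   : Rel (fx1 k * fx1 k) 0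
  | x2x21  : Rel (fx2 k * fx21 k) (fx21 k * fx2 k + fx1 k * fx21 k)
  | x21pow : Rel (fx21 k ^ p) 0
  | x2pow  : Rel (fx2 k ^ (2 * p)) 0
  | u1sq   : Rel (fu1 k * fu1 k) 0
  | u2u21  : Rel (fu2 k * fu21 k) (fu21 k * fu2 k + fu1 k * fu21 k)
  | u21pow : Rel (fu21 k ^ p) 0
  | u2pow  : Rel (fu2 k ^ (2 * p)) 0
  | esq    : Rel (fe k * fe k) 1
  | zpow   : Rel (fz k ^ p) (fz k)
  | ez     : Rel (fe k * fz k) (fz k * fe k)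
  | gapow  : Rel (fga k ^ (2 * p)) 1
  | ega    : Rel (fe k * fga k) (fga k * fe k)
  | zga    : Rel (fz k * fga k) (fga k * fz k)
  | gax1   : Rel (fga k * fx1 k) (-(fx1 k * fga k))
  | gax2   : Rel (fga k * fx2 k) (-(fx2 k * fga k) + fx1 k * fga k)
  | u1z    : Rel (fu1 k * fz k) (fz k * fu1 k + fu1 k)
  | u2z    : Rel (fu2 k * fz k) (fz k * fu2 k + fu2 k)
  | ex1    : Rel (fe k * fx1 k) (-(fx1 k * fe k))
  | ex2    : Rel (fe k * fx2 k) (-(fx2 k * fe k))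
  | eu1    : Rel (fe k * fu1 k) (-(fu1 k * fe k))
  | eu2    : Rel (fe k * fu2 k) (-(fu2 k * fe k))
  | zx1    : Rel (fz k * fx1 k) (fx1 k * fz k + fx1 k)
  | zx2    : Rel (fz k * fx2 k) (fx2 k * fz k + fx2 k)
  | u1x1   : Rel (fu1 k * fx1 k) (-(fx1 k * fu1 k))
  | u1x2   : Rel (fu1 k * fx2 k) (-(fx2 k * fu1 k) + 1 - fga k * fe k)
  | u2x1   : Rel (fu2 k * fx1 k) (-(fx1 k * fu2 k) + 1 - fga k * fe k + fx1 k * fu1 k)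
  | u2x2   : Rel (fu2 k * fx2 k) (-(fx2 k * fu2 k) + fga k * fz k * fe k + fx2 k * fu1 k)
  | u1ga   : Rel (fu1 k * fga k) (-(fga k * fu1 k))
  | u2ga   : Rel (fu2 k * fga k) (-(fga k * fu2 k) + fga k * fu1 k)

/-- The algebra `D(H)`. -/
abbrev DH := RingQuot (Rel k p)

noncomputable def x1 : DH k p := RingQuot.mkAlgHom k (Rel k p) (fx1 k)
noncomputable def x2 : DH k p := RingQuot.mkAlgHom k (Rel k p) (fx2 k)
noncomputable def z  : DH k p := RingQuot.mkAlgHom k (Rel k p) (fz k)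
noncomputable def e  : DH k p := RingQuot.mkAlgHom k (Rel k p) (fe k)
noncomputable def ga : DH k p := RingQuot.mkAlgHom k (Rel k p) (fga k)
noncomputable def u1 : DH k p := RingQuot.mkAlgHom k (Rel k p) (fu1 k)
noncomputable def u2 : DH k p := RingQuot.mkAlgHom k (Rel k p) (fu2 k)
noncomputable def x21 : DH k p := x1 k p * x2 k p + x2 k p * x1 k p
noncomputable def u21 : DH k p := u1 k p * u2 k p + u2 k p * u1 k p

end RestrictedDoubleDH

open RestrictedDoubleDH
open scoped TensorProduct
open TensorProduct (assoc lid rid)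

namespace RestrictedDoubleDH
set_option linter.unusedSimpArgs false

/-- The Lah numbers, the coefficients of rising factorials in terms of falling factorials. -/
def lah : ℕ → ℕ → ℕ
  | 0, 0 => 1
  | 0, _ + 1 => 0
  | _ + 1, 0 => 0
  | n + 1, j + 1 => (n + (j + 1)) * lah n (j + 1) + lah n j

theorem lah_eq_zero_of_lt : ∀ {n j : ℕ}, n < j → lah n j = 0
  | 0, _ + 1, _ => rfl
  | n + 1, j + 1, h => by
    rw [lah, lah_eq_zero_of_lt (show n < j + 1 by omega), lah_eq_zero_of_lt (show n < j by omega),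
      mul_zero]

theorem lah_self : ∀ n : ℕ, lah n n = 1
  | 0 => rfl
  | n + 1 => by rw [lah, lah_eq_zero_of_lt (Nat.lt_succ_self n), lah_self n, mul_zero]

theorem mul_lah_zero (n : ℕ) : n * lah n 0 = 0 := by
  cases n <;> simp [lah]

theorem factorial_mul_lah (n j : ℕ) :
    (j + 1).factorial * lah (n + 1) (j + 1) = n.choose j * (n + 1).factorial := by
  induction n generalizing j with
  | zero => cases j <;> simp [lah]
  | succ n ih =>
    rw [lah, mul_add, mul_left_comm, ih]
    cases j with
    | zero => simp [lah, Nat.factorial_succ (n + 1)]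
    | succ j =>
      have hc : n.choose (j + 1) * (j + 1) + n.choose j * j = n.choose j * n := by
        rcases le_or_gt j n with h | h
        · rw [Nat.choose_succ_right_eq, ← mul_add, Nat.sub_add_cancel h]
        · simp [Nat.choose_eq_zero_of_lt h, Nat.choose_eq_zero_of_lt (h.trans (Nat.lt_succ_self j))]
      rw [Nat.factorial_succ (j + 1), mul_assoc, ih, Nat.choose_succ_succ,
        Nat.factorial_succ (n + 1)]
      linear_combination (n + 1).factorial * hc

theorem prime_dvd_lah {p j : ℕ} (hp : p.Prime) (h0 : j ≠ 0) (hj : j < p) : p ∣ lah p j := by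
  obtain ⟨n, rfl⟩ := Nat.exists_eq_succ_of_ne_zero hp.ne_zero
  obtain ⟨i, rfl⟩ := Nat.exists_eq_succ_of_ne_zero h0
  have h : n + 1 ∣ (i + 1).factorial * lah (n + 1) (i + 1) := by
    rw [factorial_mul_lah]
    exact (Nat.dvd_factorial hp.pos le_rfl).mul_left _
  exact (hp.dvd_mul.1 h).resolve_left fun h' => absurd ((hp.dvd_factorial).1 h') (by omega)

section PrimePowers

variable {R : Type*} [Ring R] {p : ℕ}

theorem add_pow_prime_of_commute (hp : p.Prime) (hR : (p : R) = 0) {x y : R} (h : Commute x y) :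
    (x + y) ^ p = x ^ p + y ^ p := by
  rw [h.add_pow_prime_eq hp, hR]
  simp

theorem sub_pow_prime_of_commute (hp : p.Prime) (hR : (p : R) = 0) {x y : R} (h : Commute x y) :
    (x - y) ^ p = x ^ p - y ^ p := by
  rw [eq_sub_iff_add_eq, ← add_pow_prime_of_commute hp hR (h.sub_left (Commute.refl y)),
    sub_add_cancel]

theorem natCast_end_eq_zero (hR : (p : R) = 0) : (p : Module.End ℤ R) = 0 := by
  ext t
  rw [← nsmul_one]
  simp [hR]

/-- In characteristic `p`, the difference `(D + C) ^ p - D ^ p` is obtained from `1` by applying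
`p` times the map `t ↦ (D + C) * t - t * D`. -/
theorem add_pow_prime_eq_of_rec (hp : p.Prime) (hR : (p : R) = 0) {C D : R} (f : ℕ → R)
    (f_zero : f 0 = 1) (f_succ : ∀ n, f (n + 1) = (D + C) * f n - f n * D) :
    (D + C) ^ p = D ^ p + f p := by
  have hcomm := LinearMap.commute_mulLeft_right (R := ℤ) (D + C) D
  have hf (n : ℕ) : ((LinearMap.mulLeft ℤ (D + C) - LinearMap.mulRight ℤ D) ^ n) 1 = f n := by
    induction n with
    | zero => simp [f_zero]
    | succ n ih => simp [pow_succ', Module.End.mul_apply, ih, f_succ]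
  rw [← hf, sub_pow_prime_of_commute hp (natCast_end_eq_zero hR) hcomm]
  simp [LinearMap.pow_mulLeft, LinearMap.pow_mulRight]

theorem mul_pow_of_mul_eq_add_sq {D P : R} (h : D * P = P * D + P * P) (i : ℕ) :
    D * P ^ i = P ^ i * D + i • P ^ (i + 1) := by
  induction i with
  | zero => simp
  | succ i ih =>
    rw [pow_succ, ← mul_assoc, ih, add_mul, mul_assoc, h, mul_add, ← mul_assoc, ← mul_assoc,
      smul_mul_assoc, ← pow_succ, ← pow_succ, succ_nsmul]
    abel

theorem mul_pow_of_mul_eq_add_two_mul {C D P : R} (hC : D * C = C * D + 2 * (P * C))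
    (hPC : Commute P C) (j : ℕ) :
    D * C ^ j = C ^ j * D + (2 * j) • (P * C ^ j) := by
  induction j with
  | zero => simp
  | succ j ih =>
    rw [pow_succ, ← mul_assoc, ih, add_mul, mul_assoc, hC, mul_add, two_mul, mul_add,
      ← mul_assoc (C ^ j) P, ← (hPC.pow_right j).eq, smul_mul_assoc, mul_add 2 j 1, add_smul]
    simp only [mul_assoc, two_smul, mul_one]
    abel

theorem add_pow_prime_of_mul_eq_add_two_mul (hp : p.Prime) (hR : (p : R) = 0) {C D P : R}
    (hC : D * C = C * D + 2 * (P * C)) (hP : D * P = P * D + P * P) (hPC : Commute P C) :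
    (D + C) ^ p = D ^ p + C ^ p := by
  rw [add_pow_prime_eq_of_rec hp hR
    (fun n => ∑ q ∈ Finset.HasAntidiagonal.antidiagonal n, lah n q.2 • (P ^ q.1 * C ^ q.2))
      (by simp [lah])]
  · congr 1
    rw [Finset.sum_eq_single (0, p)]
    · simp [lah_self]
    · rintro ⟨i, j⟩ hij hne
      rw [Finset.HasAntidiagonal.mem_antidiagonal] at hij
      dsimp only at hij ⊢
      rcases eq_or_ne j 0 with rfl | hj
      · have := mul_lah_zero p
        simp [hp.ne_zero] at this
        simp [this]
      · have hi : i ≠ 0 := by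
          rintro rfl
          exact hne (by simp_all)
        obtain ⟨c, hc⟩ := prime_dvd_lah hp hj (by omega)
        rw [hc, nsmul_eq_mul, Nat.cast_mul, hR]
        simp
    · simp
  · intro n
    set g : ℕ × ℕ → R := fun q => ((n + q.2) * lah n q.2) • (P ^ q.1 * C ^ q.2) with hg
    have hshift : ∑ q ∈ Finset.HasAntidiagonal.antidiagonal n, g (q.1 + 1, q.2) =
        ∑ q ∈ Finset.HasAntidiagonal.antidiagonal n, g (q.1, q.2 + 1) := by
      have h := (Finset.Nat.sum_antidiagonal_succ (n := n) (f := g)).symm.trans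
        Finset.Nat.sum_antidiagonal_succ'
      have h1 : g (0, n + 1) = 0 := by simp [hg, lah_eq_zero_of_lt]
      have h2 : g (n + 1, 0) = 0 := by
        simp only [hg, add_zero, mul_lah_zero, zero_smul]
      rwa [h1, h2, zero_add, zero_add] at h
    have hterm (i j : ℕ) : (D + C) * (P ^ i * C ^ j) - P ^ i * C ^ j * D =
        (i + 2 * j) • (P ^ (i + 1) * C ^ j) + P ^ i * C ^ (j + 1) := by
      rw [add_mul, ← mul_assoc D, mul_pow_of_mul_eq_add_sq hP, add_mul, mul_assoc (P ^ i) D,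
        mul_pow_of_mul_eq_add_two_mul hC hPC, mul_add, ← mul_assoc C, ← (hPC.pow_left i).eq,
        mul_assoc (P ^ i) C, ← pow_succ', mul_smul_comm, ← mul_assoc (P ^ i) P, ← pow_succ,
        smul_mul_assoc, add_smul, mul_assoc (P ^ i) (C ^ j)]
      abel
    rw [Finset.Nat.sum_antidiagonal_succ', Finset.mul_sum, Finset.sum_mul,
      ← Finset.sum_sub_distrib]
    simp only [lah, zero_smul, zero_add, add_smul]
    rw [Finset.sum_add_distrib, ← hshift, ← Finset.sum_add_distrib]
    refine Finset.sum_congr rfl fun q hq => ?_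
    rw [Finset.HasAntidiagonal.mem_antidiagonal] at hq
    rw [mul_smul_comm, smul_mul_assoc, ← smul_sub, hterm, smul_add, smul_smul, mul_comm (lah n _),
      show q.1 + 2 * q.2 = n + q.2 by omega]

theorem sub_mul_pow_prime (hp : p.Prime) (hR : (p : R) = 0) {D Q Z : R}
    (hD : D * Q = Q * D + Q * Q) (hZD : Commute Z D) (hZQ : Commute Z Q) (hQ : Q ^ p = 0) :
    (D - Z * Q) ^ p = D ^ p := by
  have hc (n : ℕ) : ∃ c : R, Commute c D ∧ Commute c Q ∧
      ((LinearMap.mulLeft ℤ (D + -(Z * Q)) - LinearMap.mulRight ℤ D) ^ n) 1 = c * Q ^ n := by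
    induction n with
    | zero => exact ⟨1, by simp, by simp, by simp⟩
    | succ n ih =>
      obtain ⟨c, hcD, hcQ, h⟩ := ih
      refine ⟨(n • 1 - Z) * c, ?_, ?_, ?_⟩
      · exact (((Commute.one_left D).smul_left n).sub_left hZD).mul_left hcD
      · exact (((Commute.one_left Q).smul_left n).sub_left hZQ).mul_left hcQ
      · rw [pow_succ', Module.End.mul_apply, h]
        simp only [LinearMap.sub_apply, LinearMap.mulLeft_apply, LinearMap.mulRight_apply]
        rw [add_mul, ← mul_assoc, ← hcD.eq, mul_assoc, mul_pow_of_mul_eq_add_sq hD, mul_assoc c _ D,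
          neg_mul, mul_assoc Z, ← mul_assoc Q, ← hcQ.eq, mul_assoc c, ← pow_succ', sub_mul, sub_mul,
          mul_add, mul_smul_comm, smul_mul_assoc, smul_mul_assoc, one_mul, mul_assoc]
        abel
  have hsucc := add_pow_prime_eq_of_rec hp hR (C := -(Z * Q)) (D := D)
    (fun n => ((LinearMap.mulLeft ℤ (D + -(Z * Q)) - LinearMap.mulRight ℤ D) ^ n) 1) (by simp)
    (fun n => by simp [pow_succ', Module.End.mul_apply])
  obtain ⟨c, -, -, h⟩ := hc p
  rw [sub_eq_add_neg, hsucc]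
  rw [h, hQ, mul_zero, add_zero]

theorem mul_mul_eq_of_mul_eq {x y w : R} (h : x * y = w) (t : R) : x * (y * t) = w * t := by
  rw [← mul_assoc, h]

/-- If `a, A` satisfy the quadratic and cubic relations of the super Jordan plane and `B` braids
with them as the second tensor leg of a coproduct, then `A` and `B` satisfy the binomial formula
in degree `2 * p`. -/
theorem add_pow_two_mul_prime (hp : p.Prime) (hR : (p : R) = 0) {a A B : R} (ha : a * a = 0)
    (hA : A * (a * A + A * a) = (a * A + A * a) * A + a * (a * A + A * a))
    (hBa : B * a = -(a * B)) (hBA : B * A = -(A * B) + a * B) :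
    (A + B) ^ (2 * p) = A ^ (2 * p) + B ^ (2 * p) := by
  have hAAa : A * (A * a) = a * (A * A) + a * (A * a) := by
    simp only [mul_add, add_mul, mul_assoc, mul_mul_eq_of_mul_eq ha, zero_mul] at hA
    rw [← sub_eq_zero] at hA ⊢
    rw [← hA]
    abel
  have rules := And.intro (mul_mul_eq_of_mul_eq hBa) (mul_mul_eq_of_mul_eq hBA)
  have hAAat (t : R) : A * (A * (a * t)) = (a * (A * A) + a * (A * a)) * t := by
    rw [← hAAa]
    simp only [mul_assoc]
  have hsq : (A + B) ^ 2 = A ^ 2 + (a * B + B ^ 2) := by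
    simp only [sq, mul_add, add_mul, hBA]
    abel
  have hBB : (a * B + B ^ 2) ^ p = (B ^ 2) ^ p := by
    have hcomm : Commute (a * B) (B ^ 2) := by
      simp only [commute_iff_eq, sq, mul_assoc, mul_neg, hBa, rules.1, neg_mul, neg_neg]
    have hnil : (a * B) ^ 2 = 0 := by
      simp only [sq, mul_assoc, mul_neg, rules.1, neg_mul, mul_mul_eq_of_mul_eq ha, zero_mul,
        neg_zero]
    rw [add_pow_prime_of_commute hp hR hcomm, pow_eq_zero_of_le hp.two_le hnil, zero_add]
  rw [pow_mul, hsq, add_pow_prime_of_mul_eq_add_two_mul hp hR (P := a * A + A * a), hBB,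
    ← pow_mul, ← pow_mul]
  · simp only [two_mul, sq, mul_assoc, mul_add, add_mul, mul_neg, neg_mul, neg_neg, hBa, hBA,
      rules.1, rules.2, hAAa, hAAat, mul_mul_eq_of_mul_eq ha, zero_mul,
      mul_zero, ha]
    abel
  · simp only [sq, mul_assoc, mul_add, add_mul, hAAa, hAAat, mul_mul_eq_of_mul_eq ha, zero_mul,
      mul_zero, ha]
    abel
  · simp only [commute_iff_eq, sq, mul_assoc, mul_add, add_mul, mul_neg, neg_mul, neg_neg, hBa, hBA,
      rules.1, rules.2, hAAa, hAAat, mul_mul_eq_of_mul_eq ha, zero_mul, ha, mul_zero]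
    abel

/-- The `2 * p`-th power of the twisted coproduct of `u2`. -/
theorem twisted_add_pow_two_mul_prime (hp : p.Prime) (hR : (p : R) = 0) {A E Z v₁ v₂ : R}
    (hEE : E * E = 1) (hEZ : E * Z = Z * E) (hEA : E * A = -(A * E)) (hAZ : A * Z = Z * A + A)
    (hE₁ : v₁ * E = E * v₁) (hE₂ : v₂ * E = E * v₂) (hZ₁ : v₁ * Z = Z * v₁)
    (hZ₂ : v₂ * Z = Z * v₂) (hA₁ : v₁ * A = A * v₁) (hA₂ : v₂ * A = A * v₂) (h₁ : v₁ * v₁ = 0)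
    (h₂ : v₂ * (v₁ * v₂ + v₂ * v₁) = (v₁ * v₂ + v₂ * v₁) * v₂ + v₁ * (v₁ * v₂ + v₂ * v₁))
    (hpow : (v₁ * v₂ + v₂ * v₁) ^ p = 0) :
    (A + E * v₂ - E * Z * v₁) ^ (2 * p) = A ^ (2 * p) + v₂ ^ (2 * p) := by
  have hZA : Z * A = A * Z - A := by rw [hAZ]; abel
  have hEEt := mul_mul_eq_of_mul_eq hEE
  have hEZt := mul_mul_eq_of_mul_eq hEZ
  have hEAt := mul_mul_eq_of_mul_eq hEA
  have hZAt := mul_mul_eq_of_mul_eq hZA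
  have hE₁t := mul_mul_eq_of_mul_eq hE₁
  have hE₂t := mul_mul_eq_of_mul_eq hE₂
  have hZ₁t := mul_mul_eq_of_mul_eq hZ₁
  have hZ₂t := mul_mul_eq_of_mul_eq hZ₂
  have hA₁t := mul_mul_eq_of_mul_eq hA₁
  have hA₂t := mul_mul_eq_of_mul_eq hA₂
  have h₁t := mul_mul_eq_of_mul_eq h₁
  have h₂' : v₂ * (v₂ * v₁) = v₁ * (v₂ * v₂) + v₁ * (v₂ * v₁) := by
    simp only [mul_add, add_mul, mul_assoc, h₁t, zero_mul] at h₂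
    rw [← sub_eq_zero] at h₂ ⊢
    rw [← h₂]
    abel
  have h₂t (t : R) : v₂ * (v₂ * (v₁ * t)) = (v₁ * (v₂ * v₂) + v₁ * (v₂ * v₁)) * t := by
    rw [← h₂']
    simp only [mul_assoc]
  have hB : (E * v₂ - E * Z * v₁) ^ (2 * p) = v₂ ^ (2 * p) := by
    have hsq : (E * v₂ - E * Z * v₁) ^ 2 = v₂ ^ 2 - Z * (v₁ * v₂ + v₂ * v₁) := by
      simp only [sq, mul_add, mul_sub, sub_mul, mul_assoc, hEE, hEZ, hE₁, hE₂, hZ₁, hZ₂, h₁, hEEt,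
        hEZt, hE₁t, hE₂t, hZ₁t, hZ₂t, h₁t, mul_zero, one_mul]
      abel
    rw [pow_mul, hsq, sub_mul_pow_prime hp hR _ _ _ hpow, ← pow_mul]
    · simp only [sq, mul_add, add_mul, mul_assoc, h₂', h₂t, h₁, h₁t, mul_zero, zero_mul]
      abel
    · simp only [commute_iff_eq, sq, mul_assoc, hZ₂, hZ₂t]
    · simp only [commute_iff_eq, mul_add, add_mul, mul_assoc, hZ₁, hZ₂, hZ₁t, hZ₂t]
  rw [show A + E * v₂ - E * Z * v₁ = (E * v₂ - E * Z * v₁) + A by abel,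
    add_pow_two_mul_prime hp hR (a := E * v₁), hB, add_comm]
  · simp only [mul_assoc, hE₁t, h₁, mul_zero]
  · simp only [sq, mul_add, mul_sub, add_mul, sub_mul, mul_assoc, hEE, hEZ, hE₁, hE₂, hZ₁, hZ₂, h₁,
      hEEt, hEZt, hE₁t, hE₂t, hZ₁t, hZ₂t, h₁t, h₂', h₂t, mul_zero, zero_mul, one_mul]
    abel
  · simp only [mul_assoc, hEAt, hA₁, hA₁t, neg_mul, hE₁, hE₁t, hEA, mul_neg, neg_neg]
  · simp only [mul_add, mul_sub, add_mul, sub_mul, mul_assoc, hEAt, hA₁, hA₁t, hA₂, hA₂t, neg_mul,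
      hE₁, hE₂, hE₁t, hE₂t, hEA, hZA, hZAt, hEZ, hEZt, mul_neg, neg_neg]
    abel

end PrimePowers

/-- Elements of a ring satisfying the defining relations of `D(H)`. -/
structure Realization (p : ℕ) {R : Type*} [Ring R] (X₁ X₂ Z E G U₁ U₂ : R) : Prop where
  x1sq : X₁ * X₁ = 0
  x2x21 : X₂ * (X₁ * X₂ + X₂ * X₁) =
    (X₁ * X₂ + X₂ * X₁) * X₂ + X₁ * (X₁ * X₂ + X₂ * X₁)
  x21pow : (X₁ * X₂ + X₂ * X₁) ^ p = 0
  x2pow : X₂ ^ (2 * p) = 0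
  u1sq : U₁ * U₁ = 0
  u2u21 : U₂ * (U₁ * U₂ + U₂ * U₁) =
    (U₁ * U₂ + U₂ * U₁) * U₂ + U₁ * (U₁ * U₂ + U₂ * U₁)
  u21pow : (U₁ * U₂ + U₂ * U₁) ^ p = 0
  u2pow : U₂ ^ (2 * p) = 0
  esq : E * E = 1
  zpow : Z ^ p = Z
  ez : E * Z = Z * E
  gapow : G ^ (2 * p) = 1
  ega : E * G = G * E
  zga : Z * G = G * Z
  gax1 : G * X₁ = -(X₁ * G)
  gax2 : G * X₂ = -(X₂ * G) + X₁ * G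
  u1z : U₁ * Z = Z * U₁ + U₁
  u2z : U₂ * Z = Z * U₂ + U₂
  ex1 : E * X₁ = -(X₁ * E)
  ex2 : E * X₂ = -(X₂ * E)
  eu1 : E * U₁ = -(U₁ * E)
  eu2 : E * U₂ = -(U₂ * E)
  zx1 : Z * X₁ = X₁ * Z + X₁
  zx2 : Z * X₂ = X₂ * Z + X₂
  u1x1 : U₁ * X₁ = -(X₁ * U₁)
  u1x2 : U₁ * X₂ = -(X₂ * U₁) + 1 - G * E
  u2x1 : U₂ * X₁ = -(X₁ * U₂) + 1 - G * E + X₁ * U₁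
  u2x2 : U₂ * X₂ = -(X₂ * U₂) + G * Z * E + X₂ * U₁
  u1ga : U₁ * G = -(G * U₁)
  u2ga : U₂ * G = -(G * U₂) + G * U₁

namespace Realization

section Ring

variable {p : ℕ} {R : Type*} [Ring R] {X₁ X₂ Z E G U₁ U₂ : R}
  (h : Realization p X₁ X₂ Z E G U₁ U₂)

include h

theorem x2x2x1 : X₂ * (X₂ * X₁) = X₁ * (X₂ * X₂) + X₁ * (X₂ * X₁) := by
  have := h.x2x21
  simp only [mul_add, add_mul, mul_assoc, mul_mul_eq_of_mul_eq h.x1sq, zero_mul, zero_add] at this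
  rw [← sub_eq_zero] at this ⊢
  rw [← this]
  abel

theorem u2u2u1 : U₂ * (U₂ * U₁) = U₁ * (U₂ * U₂) + U₁ * (U₂ * U₁) := by
  have := h.u2u21
  simp only [mul_add, add_mul, mul_assoc, mul_mul_eq_of_mul_eq h.u1sq, zero_mul, zero_add] at this
  rw [← sub_eq_zero] at this ⊢
  rw [← this]
  abel

theorem u1e : U₁ * E = -(E * U₁) := by rw [h.eu1, neg_neg]

theorem u2e : U₂ * E = -(E * U₂) := by rw [h.eu2, neg_neg]

/-- Rewriting rules to the normal form in which the `X`s precede `G`, `Z`, `E`, and these precede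
the `U`s. -/
theorem normalize :
    (X₁ * X₁ = 0 ∧ (∀ t, X₁ * (X₁ * t) = 0) ∧
      X₂ * (X₂ * X₁) = X₁ * (X₂ * X₂) + X₁ * (X₂ * X₁) ∧
      ∀ t, X₂ * (X₂ * (X₁ * t)) = (X₁ * (X₂ * X₂) + X₁ * (X₂ * X₁)) * t) ∧
    (U₁ * U₁ = 0 ∧ (∀ t, U₁ * (U₁ * t) = 0) ∧
      U₂ * (U₂ * U₁) = U₁ * (U₂ * U₂) + U₁ * (U₂ * U₁) ∧
      ∀ t, U₂ * (U₂ * (U₁ * t)) = (U₁ * (U₂ * U₂) + U₁ * (U₂ * U₁)) * t) ∧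
    (E * E = 1 ∧ E * Z = Z * E ∧ E * G = G * E ∧ Z * G = G * Z ∧
      (∀ t, E * (E * t) = t) ∧ (∀ t, E * (Z * t) = Z * E * t) ∧
      (∀ t, E * (G * t) = G * E * t) ∧ ∀ t, Z * (G * t) = G * Z * t) ∧
    (G * X₁ = -(X₁ * G) ∧ G * X₂ = -(X₂ * G) + X₁ * G ∧ E * X₁ = -(X₁ * E) ∧
      E * X₂ = -(X₂ * E) ∧ Z * X₁ = X₁ * Z + X₁ ∧ Z * X₂ = X₂ * Z + X₂ ∧
      (∀ t, G * (X₁ * t) = -(X₁ * G) * t) ∧ (∀ t, G * (X₂ * t) = (-(X₂ * G) + X₁ * G) * t) ∧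
      (∀ t, E * (X₁ * t) = -(X₁ * E) * t) ∧ (∀ t, E * (X₂ * t) = -(X₂ * E) * t) ∧
      (∀ t, Z * (X₁ * t) = (X₁ * Z + X₁) * t) ∧ ∀ t, Z * (X₂ * t) = (X₂ * Z + X₂) * t) ∧
    (U₁ * G = -(G * U₁) ∧ U₂ * G = -(G * U₂) + G * U₁ ∧ U₁ * E = -(E * U₁) ∧
      U₂ * E = -(E * U₂) ∧ U₁ * Z = Z * U₁ + U₁ ∧ U₂ * Z = Z * U₂ + U₂ ∧
      (∀ t, U₁ * (G * t) = -(G * U₁) * t) ∧ (∀ t, U₂ * (G * t) = (-(G * U₂) + G * U₁) * t) ∧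
      (∀ t, U₁ * (E * t) = -(E * U₁) * t) ∧ (∀ t, U₂ * (E * t) = -(E * U₂) * t) ∧
      (∀ t, U₁ * (Z * t) = (Z * U₁ + U₁) * t) ∧ ∀ t, U₂ * (Z * t) = (Z * U₂ + U₂) * t) ∧
    (U₁ * X₁ = -(X₁ * U₁) ∧ U₁ * X₂ = -(X₂ * U₁) + 1 - G * E ∧
      U₂ * X₁ = -(X₁ * U₂) + 1 - G * E + X₁ * U₁ ∧
      U₂ * X₂ = -(X₂ * U₂) + G * Z * E + X₂ * U₁ ∧
      (∀ t, U₁ * (X₁ * t) = -(X₁ * U₁) * t) ∧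
      (∀ t, U₁ * (X₂ * t) = (-(X₂ * U₁) + 1 - G * E) * t) ∧
      (∀ t, U₂ * (X₁ * t) = (-(X₁ * U₂) + 1 - G * E + X₁ * U₁) * t) ∧
      ∀ t, U₂ * (X₂ * t) = (-(X₂ * U₂) + G * Z * E + X₂ * U₁) * t) := by
  refine ⟨⟨h.x1sq, fun t => by rw [mul_mul_eq_of_mul_eq h.x1sq, zero_mul], h.x2x2x1,
    fun t => by rw [← h.x2x2x1]; simp only [mul_assoc]⟩,
    ⟨h.u1sq, fun t => by rw [mul_mul_eq_of_mul_eq h.u1sq, zero_mul], h.u2u2u1,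
    fun t => by rw [← h.u2u2u1]; simp only [mul_assoc]⟩,
    ⟨h.esq, h.ez, h.ega, h.zga, fun t => by rw [mul_mul_eq_of_mul_eq h.esq, one_mul], ?_, ?_, ?_⟩,
    ⟨h.gax1, h.gax2, h.ex1, h.ex2, h.zx1, h.zx2, ?_, ?_, ?_, ?_, ?_, ?_⟩,
    ⟨h.u1ga, h.u2ga, h.u1e, h.u2e, h.u1z, h.u2z, ?_, ?_, ?_, ?_, ?_, ?_⟩,
    ⟨h.u1x1, h.u1x2, h.u2x1, h.u2x2, ?_, ?_, ?_, ?_⟩⟩ <;>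
  apply mul_mul_eq_of_mul_eq
  exacts [h.ez, h.ega, h.zga, h.gax1, h.gax2, h.ex1, h.ex2, h.zx1, h.zx2, h.u1ga, h.u2ga, h.u1e,
    h.u2e, h.u1z, h.u2z, h.u1x1, h.u1x2, h.u2x1, h.u2x2]

theorem pow_pred_mul (hp : p.Prime) : G ^ (2 * p - 1) * G = 1 := by
  rw [← pow_succ, Nat.sub_add_cancel (by have := hp.pos; omega), h.gapow]

theorem mul_pow_pred (hp : p.Prime) : G * G ^ (2 * p - 1) = 1 := by
  rw [← pow_succ', Nat.sub_add_cancel (by have := hp.pos; omega), h.gapow]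

end Ring

section TensorProduct

variable {p : ℕ} (k : Type*) [Field k] [CharP k p]

include k in
theorem natCast_prime_eq_zero (R : Type*) [Ring R] [Algebra k R] : (p : R) = 0 := by
  rw [← map_natCast (algebraMap k R), CharP.cast_eq_zero, map_zero]

variable {R : Type*} [Ring R] [Algebra k R] {X₁ X₂ Z E G U₁ U₂ : R}
  (h : Realization p X₁ X₂ Z E G U₁ U₂)

include h

theorem tensorProduct (hp : p.Prime) :
    Realization p (R := R ⊗[k] R) (X₁ ⊗ₜ 1 + G ⊗ₜ X₁) (X₂ ⊗ₜ 1 + G ⊗ₜ X₂) (Z ⊗ₜ 1 + 1 ⊗ₜ Z)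
      (E ⊗ₜ E) (G ⊗ₜ G) (U₁ ⊗ₜ 1 + E ⊗ₜ U₁) (U₂ ⊗ₜ 1 + E ⊗ₜ U₂ - (E * Z) ⊗ₜ U₁) := by
  have hn := h.normalize
  have hR : (p : R ⊗[k] R) = 0 := natCast_prime_eq_zero k _
  constructor
  case x21pow =>
    have hsum : (X₁ ⊗ₜ[k] (1 : R) + G ⊗ₜ X₁) * (X₂ ⊗ₜ 1 + G ⊗ₜ X₂) +
        (X₂ ⊗ₜ 1 + G ⊗ₜ X₂) * (X₁ ⊗ₜ 1 + G ⊗ₜ X₁) =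
        (X₁ * X₂ + X₂ * X₁) ⊗ₜ 1 + ((X₁ * G) ⊗ₜ X₁ + (G * G) ⊗ₜ (X₁ * X₂ + X₂ * X₁)) := by
      simp only [mul_add, add_mul, Algebra.TensorProduct.tmul_mul_tmul, TensorProduct.add_tmul,
        TensorProduct.tmul_add, TensorProduct.neg_tmul, mul_one, one_mul, hn]
      abel
    have hc : Commute (X₁ * X₂ + X₂ * X₁) (X₁ * G) := by
      simp only [commute_iff_eq, mul_add, add_mul, mul_assoc, hn, mul_neg, neg_mul, neg_neg,
        mul_zero, zero_mul]
      try abel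
    have hc' : Commute (X₁ * X₂ + X₂ * X₁) (G * G) := by
      simp only [commute_iff_eq, mul_add, add_mul, mul_assoc, hn, mul_neg, neg_mul, neg_neg,
        mul_zero, zero_mul]
      try abel
    have hc₁ : Commute ((X₁ * X₂ + X₂ * X₁) ⊗ₜ[k] (1 : R)) ((X₁ * G) ⊗ₜ X₁) := by
      rw [commute_iff_eq, Algebra.TensorProduct.tmul_mul_tmul, Algebra.TensorProduct.tmul_mul_tmul,
        hc.eq, one_mul, mul_one]
    have hc₂ : Commute ((X₁ * X₂ + X₂ * X₁) ⊗ₜ[k] (1 : R))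
        ((G * G) ⊗ₜ (X₁ * X₂ + X₂ * X₁)) := by
      rw [commute_iff_eq, Algebra.TensorProduct.tmul_mul_tmul, Algebra.TensorProduct.tmul_mul_tmul,
        hc'.eq, one_mul, mul_one]
    have hc₃ : Commute ((X₁ * G) ⊗ₜ[k] X₁) ((G * G) ⊗ₜ (X₁ * X₂ + X₂ * X₁)) := by
      simp only [commute_iff_eq, mul_add, add_mul, Algebra.TensorProduct.tmul_mul_tmul, mul_assoc,
        hn, mul_neg, neg_mul, neg_neg, mul_zero, zero_mul, add_zero, zero_add]
    have hnil : ((X₁ * G) ⊗ₜ[k] X₁) ^ p = 0 :=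
      pow_eq_zero_of_le hp.two_le (by
        rw [sq, Algebra.TensorProduct.tmul_mul_tmul, h.x1sq, TensorProduct.tmul_zero])
    rw [hsum, add_pow_prime_of_commute hp hR (hc₁.add_right hc₂),
      add_pow_prime_of_commute hp hR hc₃, hnil, Algebra.TensorProduct.tmul_pow,
      Algebra.TensorProduct.tmul_pow, h.x21pow, TensorProduct.zero_tmul, TensorProduct.tmul_zero,
      add_zero, add_zero]
  case u21pow =>
    have hsum : (U₁ ⊗ₜ[k] (1 : R) + E ⊗ₜ U₁) * (U₂ ⊗ₜ 1 + E ⊗ₜ U₂ - (E * Z) ⊗ₜ U₁) +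
        (U₂ ⊗ₜ 1 + E ⊗ₜ U₂ - (E * Z) ⊗ₜ U₁) * (U₁ ⊗ₜ 1 + E ⊗ₜ U₁) =
        (U₁ * U₂ + U₂ * U₁) ⊗ₜ 1 + ((E * U₁) ⊗ₜ U₁ + 1 ⊗ₜ (U₁ * U₂ + U₂ * U₁)) := by
      simp only [mul_add, add_mul, mul_sub, sub_mul, Algebra.TensorProduct.tmul_mul_tmul,
        TensorProduct.add_tmul, TensorProduct.tmul_add, TensorProduct.neg_tmul, mul_one, one_mul,
        mul_assoc, mul_neg, neg_mul, hn, TensorProduct.tmul_zero]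
      abel
    have hc : Commute (U₁ * U₂ + U₂ * U₁) (E * U₁) := by
      simp only [commute_iff_eq, mul_add, add_mul, mul_assoc, hn, mul_neg, neg_mul, neg_neg,
        mul_zero, zero_mul]
      try abel
    have hc₁ : Commute ((U₁ * U₂ + U₂ * U₁) ⊗ₜ[k] (1 : R)) ((E * U₁) ⊗ₜ U₁) := by
      rw [commute_iff_eq, Algebra.TensorProduct.tmul_mul_tmul, Algebra.TensorProduct.tmul_mul_tmul,
        hc.eq, one_mul, mul_one]
    have hc₂ : Commute ((U₁ * U₂ + U₂ * U₁) ⊗ₜ[k] (1 : R)) (1 ⊗ₜ (U₁ * U₂ + U₂ * U₁)) := by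
      rw [commute_iff_eq, Algebra.TensorProduct.tmul_mul_tmul, Algebra.TensorProduct.tmul_mul_tmul,
        one_mul, mul_one]
    have hc₃ : Commute ((E * U₁) ⊗ₜ[k] U₁) ((1 : R) ⊗ₜ (U₁ * U₂ + U₂ * U₁)) := by
      simp only [commute_iff_eq, mul_add, add_mul, Algebra.TensorProduct.tmul_mul_tmul, mul_assoc,
        hn, mul_one, one_mul, mul_zero, add_zero, zero_add]
    have hnil : ((E * U₁) ⊗ₜ[k] U₁) ^ p = 0 :=
      pow_eq_zero_of_le hp.two_le (by
        rw [sq, Algebra.TensorProduct.tmul_mul_tmul, h.u1sq, TensorProduct.tmul_zero])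
    rw [hsum, add_pow_prime_of_commute hp hR (hc₁.add_right hc₂),
      add_pow_prime_of_commute hp hR hc₃, hnil, Algebra.TensorProduct.tmul_pow,
      Algebra.TensorProduct.tmul_pow, h.u21pow, TensorProduct.zero_tmul, TensorProduct.tmul_zero,
      add_zero, add_zero]
  case x2pow =>
    rw [add_pow_two_mul_prime hp hR (a := X₁ ⊗ₜ 1), Algebra.TensorProduct.tmul_pow,
      Algebra.TensorProduct.tmul_pow, h.x2pow, TensorProduct.zero_tmul, TensorProduct.tmul_zero,
      add_zero]
    · rw [Algebra.TensorProduct.tmul_mul_tmul, h.x1sq, TensorProduct.zero_tmul]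
    · simp only [Algebra.TensorProduct.tmul_mul_tmul, ← TensorProduct.add_tmul, mul_one, h.x2x21]
    · simp only [Algebra.TensorProduct.tmul_mul_tmul, h.gax1, TensorProduct.neg_tmul, mul_one,
        one_mul]
    · simp only [Algebra.TensorProduct.tmul_mul_tmul, h.gax2, TensorProduct.neg_tmul,
        TensorProduct.add_tmul, mul_one, one_mul]
  case u2pow =>
    have := twisted_add_pow_two_mul_prime hp hR (A := U₂ ⊗ₜ[k] (1 : R)) (E := E ⊗ₜ 1)
      (Z := Z ⊗ₜ 1) (v₁ := 1 ⊗ₜ U₁) (v₂ := 1 ⊗ₜ U₂)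
    simp only [Algebra.TensorProduct.tmul_mul_tmul, one_mul, mul_one, h.esq, h.ez, h.eu2, h.u2z,
      h.u1sq, TensorProduct.neg_tmul, TensorProduct.add_tmul, ← TensorProduct.tmul_add, h.u2u21,
      Algebra.TensorProduct.tmul_pow, h.u21pow, h.u2pow, TensorProduct.tmul_zero,
      TensorProduct.zero_tmul, add_zero, Algebra.TensorProduct.one_def, forall_const] at this
    rw [h.ez]
    exact this
  case zpow =>
    rw [add_pow_prime_of_commute hp hR, Algebra.TensorProduct.tmul_pow,
      Algebra.TensorProduct.tmul_pow, one_pow, h.zpow]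
    simp [commute_iff_eq]
  case gapow =>
    rw [Algebra.TensorProduct.tmul_pow, h.gapow, Algebra.TensorProduct.one_def]
  all_goals
    simp only [mul_add, add_mul, mul_sub, sub_mul, Algebra.TensorProduct.tmul_mul_tmul,
      mul_one, one_mul, mul_assoc, mul_neg, neg_mul, neg_neg, hn, mul_zero, zero_mul,
      TensorProduct.add_tmul, TensorProduct.tmul_add, TensorProduct.sub_tmul,
      TensorProduct.tmul_sub, TensorProduct.neg_tmul, TensorProduct.tmul_neg,
      TensorProduct.tmul_zero, TensorProduct.zero_tmul, Algebra.TensorProduct.one_def]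
    try abel

end TensorProduct

section Opposite

variable {p : ℕ} {R : Type*} [Ring R] {X₁ X₂ Z E G U₁ U₂ : R}
  (h : Realization p X₁ X₂ Z E G U₁ U₂)

theorem mul_eq_mul_of_mul_eq_mul {g g' x y : R} (hl : g' * g = 1) (hr : g * g' = 1)
    (hxy : g * x = y * g) : g' * y = x * g' := by
  rw [← mul_one y, ← hr, ← mul_assoc y, ← hxy, mul_assoc, ← mul_assoc, hl, one_mul]

theorem end_pow_apply_eq_zero {M : Type*} [AddCommGroup M] {T : Module.End ℤ M} {n : ℕ} {x : M}
    (hn : n ≠ 0) (hx : T x = 0) : (T ^ n) x = 0 := by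
  rw [← Nat.succ_pred_eq_of_ne_zero hn, pow_succ, Module.End.mul_apply, hx, map_zero]

include h

/-- Rewriting rules moving the inverse `G'` of `G` to its place in the normal form. -/
theorem normalize_inv {G' : R} (hl : G' * G = 1) (hr : G * G' = 1) :
    (G' * G = 1 ∧ G * G' = 1 ∧ (∀ t, G' * (G * t) = t) ∧ ∀ t, G * (G' * t) = t) ∧
    (G' * X₁ = -(X₁ * G') ∧ G' * X₂ = -(X₂ * G') - X₁ * G' ∧
      (∀ t, G' * (X₁ * t) = -(X₁ * G') * t) ∧
      ∀ t, G' * (X₂ * t) = (-(X₂ * G') - X₁ * G') * t) ∧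
    (E * G' = G' * E ∧ Z * G' = G' * Z ∧ U₁ * G' = -(G' * U₁) ∧
      U₂ * G' = -(G' * U₂) - G' * U₁ ∧
      (∀ t, E * (G' * t) = G' * E * t) ∧ (∀ t, Z * (G' * t) = G' * Z * t) ∧
      (∀ t, U₁ * (G' * t) = -(G' * U₁) * t) ∧
      ∀ t, U₂ * (G' * t) = (-(G' * U₂) - G' * U₁) * t) := by
  have hx₁ : G' * X₁ = -(X₁ * G') := by
    rw [← mul_eq_mul_of_mul_eq_mul hl hr (y := -X₁) (by rw [h.gax1, neg_mul]), mul_neg, neg_neg]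
  have hx₂ : G' * X₂ = -(X₂ * G') - X₁ * G' := by
    rw [← mul_eq_mul_of_mul_eq_mul hl hr (x := X₂) (y := -X₂ + X₁)
      (by rw [h.gax2, add_mul, neg_mul]), mul_add, mul_neg, hx₁]
    abel
  have he : E * G' = G' * E := (mul_eq_mul_of_mul_eq_mul hl hr h.ega.symm).symm
  have hz : Z * G' = G' * Z := (mul_eq_mul_of_mul_eq_mul hl hr h.zga.symm).symm
  have hu₁ : U₁ * G' = -(G' * U₁) := by
    rw [← mul_eq_mul_of_mul_eq_mul hl hr (y := -U₁) (by rw [neg_mul, h.u1ga, neg_neg]), mul_neg]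
  have hu₂ : U₂ * G' = -(G' * U₂) - G' * U₁ := by
    rw [← mul_eq_mul_of_mul_eq_mul hl hr (y := -U₂ - U₁)
      (by rw [sub_mul, neg_mul, h.u2ga, h.u1ga]; abel), mul_sub, mul_neg]
  refine ⟨⟨hl, hr, fun t => by rw [mul_mul_eq_of_mul_eq hl, one_mul],
    fun t => by rw [mul_mul_eq_of_mul_eq hr, one_mul]⟩, ⟨hx₁, hx₂, ?_, ?_⟩,
    ⟨he, hz, hu₁, hu₂, ?_, ?_, ?_, ?_⟩⟩ <;>
  apply mul_mul_eq_of_mul_eq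
  exacts [hx₁, hx₂, he, hz, hu₁, hu₂]

theorem antipode_x2_pow (hp : p.Prime) (hR : (p : R) = 0) {G' : R}
    (hr : G * G' = 1) : (G' * X₂) ^ (2 * p) = 0 := by
  have hEnd : (p : Module.End ℤ R) = 0 := natCast_end_eq_zero hR
  have hgpow : G ^ (2 * p) * (G' * X₂) ^ (2 * p) = 0 := by
    have hc := LinearMap.commute_mulLeft_right (R := ℤ) (A := R)
    have := add_pow_two_mul_prime hp hEnd (a := LinearMap.mulLeft ℤ X₁)
      (A := LinearMap.mulLeft ℤ X₂)
      (B := LinearMap.mulLeft ℤ G * LinearMap.mulRight ℤ (-(G' * X₂)))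
      (by ext t; simp [← mul_assoc, h.x1sq])
      (by
        ext t
        have := congrArg (· * t) h.x2x21
        simpa [mul_add, add_mul, mul_assoc] using this)
      (by ext t; simp [← mul_assoc, h.gax1])
      (by ext t; simp [← mul_assoc, h.gax2, add_mul, add_comm])
    rw [(hc _ _).mul_pow, LinearMap.pow_mulLeft, LinearMap.pow_mulLeft,
      LinearMap.pow_mulRight, h.x2pow] at this
    have hone := LinearMap.congr_fun this 1
    rw [end_pow_apply_eq_zero (mul_ne_zero two_ne_zero hp.ne_zero)
      (by simp [← mul_assoc, hr])] at hone
    simpa [even_two.mul_right p |>.neg_pow] using hone.symm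
  rwa [h.gapow, one_mul] at hgpow

theorem antipode_u21 : (E * U₁) * (E * U₂ + E * Z * U₁) + (E * U₂ + E * Z * U₁) * (E * U₁) =
    -(U₁ * U₂ + U₂ * U₁) := by
  simp only [mul_add, add_mul, mul_assoc, h.normalize, mul_neg, neg_mul, neg_neg, mul_zero]
  abel

theorem antipode_u2u21 :
    (-(U₁ * U₂ + U₂ * U₁)) * (-(E * U₂ + E * Z * U₁)) =
      -(E * U₂ + E * Z * U₁) * -(U₁ * U₂ + U₂ * U₁) + -(U₁ * U₂ + U₂ * U₁) * -(E * U₁) := by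
  simp only [mul_add, add_mul, mul_assoc, h.normalize, mul_neg, neg_mul, neg_neg, mul_zero,
    zero_mul, neg_add]
  abel

theorem antipode_u2_pow (hp : p.Prime) (hR : (p : R) = 0) :
    (E * U₂ + E * Z * U₁) ^ (2 * p) = 0 := by
  have hEnd : (p : Module.End ℤ R) = 0 := natCast_end_eq_zero hR
  have hv : LinearMap.mulRight ℤ (-(E * U₁)) * LinearMap.mulRight ℤ (-(E * U₂ + E * Z * U₁)) +
      LinearMap.mulRight ℤ (-(E * U₂ + E * Z * U₁)) * LinearMap.mulRight ℤ (-(E * U₁)) =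
      LinearMap.mulRight ℤ (-(U₁ * U₂ + U₂ * U₁)) := by
    rw [← h.antipode_u21]
    ext t
    simp only [LinearMap.add_apply, Module.End.mul_apply, LinearMap.mulRight_apply, mul_add,
      mul_neg, neg_mul, neg_neg, mul_assoc, add_mul]
    abel
  have := twisted_add_pow_two_mul_prime hp hEnd (A := LinearMap.mulLeft ℤ U₂)
    (E := LinearMap.mulLeft ℤ E) (Z := LinearMap.mulLeft ℤ Z)
    (v₁ := LinearMap.mulRight ℤ (-(E * U₁)))
    (v₂ := LinearMap.mulRight ℤ (-(E * U₂ + E * Z * U₁)))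
    (by ext t; simp [← mul_assoc, h.esq])
    (by ext t; simp [← mul_assoc, h.ez])
    (by ext t; simp [← mul_assoc, h.eu2])
    (by ext t; simp [← mul_assoc, h.u2z, add_mul])
    (LinearMap.commute_mulLeft_right _ _).symm (LinearMap.commute_mulLeft_right _ _).symm
    (LinearMap.commute_mulLeft_right _ _).symm (LinearMap.commute_mulLeft_right _ _).symm
    (LinearMap.commute_mulLeft_right _ _).symm (LinearMap.commute_mulLeft_right _ _).symm
    (by
      ext t
      simp only [Module.End.mul_apply, LinearMap.mulRight_apply, LinearMap.zero_apply, mul_assoc,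
        mul_neg, neg_mul, h.normalize, mul_zero, neg_zero])
    (by
      rw [hv]
      ext t
      have := congrArg (t * ·) h.antipode_u2u21
      simpa only [Module.End.mul_apply, LinearMap.mulRight_apply, LinearMap.add_apply, mul_assoc,
        mul_add t] using this)
    (by
      rw [hv, LinearMap.pow_mulRight, neg_pow, h.u21pow, mul_zero]
      ext t
      simp)
  rw [LinearMap.pow_mulLeft, LinearMap.pow_mulRight, h.u2pow] at this
  have hone := LinearMap.congr_fun this 1
  have hzero : U₂ + -(E * (E * U₂ + E * Z * U₁)) - E * (Z * -(E * U₁)) = 0 := by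
    simp only [mul_add, mul_assoc, mul_neg, h.normalize]
    abel
  rw [end_pow_apply_eq_zero (mul_ne_zero two_ne_zero hp.ne_zero)
    (by simpa only [LinearMap.sub_apply, LinearMap.add_apply, Module.End.mul_apply,
      LinearMap.mulLeft_apply, LinearMap.mulRight_apply, one_mul, mul_one, mul_neg E] using hzero),
    (even_two.mul_right p).neg_pow] at hone
  simpa using hone.symm

open MulOpposite in
theorem opposite (hp : p.Prime) (hp2 : 2 < p) (hR : (p : R) = 0) :
    Realization p (op (-(G ^ (2 * p - 1) * X₁))) (op (-(G ^ (2 * p - 1) * X₂))) (op (-Z)) (op E)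
      (op (G ^ (2 * p - 1))) (op (-(E * U₁))) (op (-(E * U₂ + E * Z * U₁))) := by
  have hl := h.pow_pred_mul hp
  have hr := h.mul_pow_pred hp
  have hpow : (G ^ (2 * p - 1)) ^ (2 * p) = 1 := by
    rw [← pow_mul, mul_comm, pow_mul, h.gapow, one_pow]
  generalize G ^ (2 * p - 1) = G' at *
  have hn := h.normalize
  have hi := h.normalize_inv hl hr
  constructor <;> apply unop_injective <;>
    simp only [unop_mul, unop_add, unop_sub, unop_neg, unop_pow, unop_op, unop_zero, unop_one]
  case x21pow =>
    have hsum : -(G' * X₂) * -(G' * X₁) + -(G' * X₁) * -(G' * X₂) =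
        -(G' * G') * (X₁ * X₂ + X₂ * X₁) := by
      simp only [mul_add, add_mul, mul_sub, sub_mul, mul_assoc, hn, hi, mul_neg, neg_mul,
        neg_neg, mul_zero]
      try abel
    have hc : Commute (-(G' * G')) (X₁ * X₂ + X₂ * X₁) := by
      simp only [commute_iff_eq, mul_add, add_mul, mul_sub, sub_mul, mul_assoc, hn, hi,
        mul_neg, neg_mul, neg_neg, mul_zero, zero_mul]
      try abel
    rw [hsum, hc.mul_pow, h.x21pow, mul_zero]
  case u21pow =>
    have := h.antipode_u21
    rw [neg_mul_neg, neg_mul_neg, add_comm, this, neg_pow, h.u21pow, mul_zero]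
  case x2pow =>
    rw [(even_two.mul_right p).neg_pow, h.antipode_x2_pow hp hR hr]
  case u2pow =>
    rw [(even_two.mul_right p).neg_pow, h.antipode_u2_pow hp hR]
  case zpow =>
    rw [(hp.odd_of_ne_two hp2.ne').neg_pow, h.zpow]
  case gapow => exact hpow
  all_goals
    simp only [mul_add, add_mul, mul_sub, sub_mul, mul_one, one_mul, mul_assoc, mul_neg, neg_mul,
      neg_neg, hn, hi, mul_zero, zero_mul]
    try abel

end Opposite

end Realization

section Generators

variable (k : Type) [Field k] (p : ℕ)

theorem realization_generators :
    Realization p (x1 k p) (x2 k p) (z k p) (e k p) (ga k p) (u1 k p) (u2 k p) := by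
  constructor <;>
  simp only [x1, x2, z, e, ga, u1, u2, ← map_mul, ← map_pow, ← map_add, ← map_sub, ← map_neg,
    ← map_one (RingQuot.mkAlgHom k (Rel k p)), ← map_zero (RingQuot.mkAlgHom k (Rel k p))] <;>
  apply RingQuot.mkAlgHom_rel <;>
  constructor

variable {k p} {B : Type*} [Ring B] [Algebra k B] {X₁ X₂ Z E G U₁ U₂ : B}

/-- The algebra map from `D(H)` sending the generators to a given realization. -/
noncomputable def Realization.lift (h : Realization p X₁ X₂ Z E G U₁ U₂) : DH k p →ₐ[k] B :=
  RingQuot.liftAlgHom k ⟨FreeAlgebra.lift k ![X₁, X₂, Z, E, G, U₁, U₂], fun _ _ hr => by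
    cases hr <;>
      simp only [fx1, fx2, fz, fe, fga, fu1, fu2, fx21, fu21, map_mul, map_pow, map_add, map_sub,
        map_neg, map_one, map_zero, FreeAlgebra.lift_ι_apply, Matrix.cons_val]
    exacts [h.x1sq, h.x2x21, h.x21pow, h.x2pow, h.u1sq, h.u2u21, h.u21pow, h.u2pow, h.esq, h.zpow,
      h.ez, h.gapow, h.ega, h.zga, h.gax1, h.gax2, h.u1z, h.u2z, h.ex1, h.ex2, h.eu1, h.eu2,
      h.zx1, h.zx2, h.u1x1, h.u1x2, h.u2x1, h.u2x2, h.u1ga, h.u2ga]⟩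

theorem Realization.lift_generators (h : Realization p X₁ X₂ Z E G U₁ U₂) :
    h.lift (x1 k p) = X₁ ∧ h.lift (x2 k p) = X₂ ∧ h.lift (z k p) = Z ∧ h.lift (e k p) = E ∧
      h.lift (ga k p) = G ∧ h.lift (u1 k p) = U₁ ∧ h.lift (u2 k p) = U₂ := by
  simp [Realization.lift, x1, x2, z, e, ga, u1, u2, fx1, fx2, fz, fe, fga, fu1, fu2]

variable (k p) in
theorem adjoin_generators :
    Algebra.adjoin k {x1 k p, x2 k p, z k p, e k p, ga k p, u1 k p, u2 k p} = ⊤ := by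
  refine eq_top_iff.2 fun a _ => ?_
  obtain ⟨b, rfl⟩ := RingQuot.mkAlgHom_surjective k (Rel k p) a
  induction b using FreeAlgebra.induction with
  | grade0 r => rw [AlgHom.commutes]; exact Subalgebra.algebraMap_mem _ r
  | grade1 i =>
    apply Algebra.subset_adjoin
    fin_cases i <;> simp [x1, x2, z, e, ga, u1, u2, fx1, fx2, fz, fe, fga, fu1, fu2]
  | mul a b ha hb => rw [map_mul]; exact mul_mem (ha trivial) (hb trivial)
  | add a b ha hb => rw [map_add]; exact add_mem (ha trivial) (hb trivial)

end Generators

section Antipode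

variable {k : Type*} [Field k] {A : Type*} [Ring A] [Algebra k A]

/-- The linear map underlying an algebra map to the opposite algebra. -/
noncomputable def unopLinearMap (S : A →ₐ[k] Aᵐᵒᵖ) : A →ₗ[k] A :=
  (MulOpposite.opLinearEquiv k).symm.toLinearMap ∘ₗ S.toLinearMap

variable (S : A →ₐ[k] Aᵐᵒᵖ)

theorem unopLinearMap_apply (a : A) : unopLinearMap S a = (S a).unop := rfl

theorem unopLinearMap_one : unopLinearMap S 1 = 1 := by simp [unopLinearMap_apply]

theorem unopLinearMap_mul (a b : A) :
    unopLinearMap S (a * b) = unopLinearMap S b * unopLinearMap S a := by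
  simp [unopLinearMap_apply]

theorem unopLinearMap_pow (a : A) (n : ℕ) : unopLinearMap S (a ^ n) = unopLinearMap S a ^ n := by
  simp [unopLinearMap_apply]

/-- The square of an algebra anti-endomorphism, as an algebra endomorphism. -/
noncomputable def unopSq : A →ₐ[k] A :=
  AlgHom.ofLinearMap (unopLinearMap S ∘ₗ unopLinearMap S) (by simp [unopLinearMap_one])
    (by simp [unopLinearMap_mul])

theorem unopSq_apply (a : A) : unopSq S a = unopLinearMap S (unopLinearMap S a) := rfl

theorem unopLinearMap_bijective {n : ℕ} (hn : n ≠ 0) (h : unopSq S ^ n = 1) :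
    Function.Bijective (unopLinearMap S) := by
  obtain ⟨m, rfl⟩ := Nat.exists_eq_succ_of_ne_zero hn
  refine ⟨Function.LeftInverse.injective (g := ⇑(unopSq S ^ m) ∘ unopLinearMap S) fun a => ?_,
    Function.RightInverse.surjective (g := unopLinearMap S ∘ ⇑(unopSq S ^ m)) fun a => ?_⟩
  · rw [pow_succ] at h
    exact AlgHom.congr_fun h a
  · rw [pow_succ'] at h
    exact AlgHom.congr_fun h a

theorem mul'_rTensor_mul_tmul (u : A ⊗[k] A) (a b : A) :
    LinearMap.mul' k A ((unopLinearMap S).rTensor A (u * a ⊗ₜ b)) =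
      unopLinearMap S a * LinearMap.mul' k A ((unopLinearMap S).rTensor A u) * b := by
  induction u with
  | zero => simp
  | add u v hu hv => simp only [add_mul, map_add, hu, hv, mul_add]
  | tmul c d => simp [unopLinearMap_mul, mul_assoc]

theorem mul'_lTensor_tmul_mul (u : A ⊗[k] A) (a b : A) :
    LinearMap.mul' k A ((unopLinearMap S).lTensor A (a ⊗ₜ b * u)) =
      a * LinearMap.mul' k A ((unopLinearMap S).lTensor A u) * unopLinearMap S b := by
  induction u with
  | zero => simp
  | add u v hu hv => simp only [add_mul, map_add, hu, hv, mul_add]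
  | tmul c d => simp [unopLinearMap_mul, mul_assoc]

theorem mul'_rTensor_mul {u : A ⊗[k] A} {c : k}
    (hu : LinearMap.mul' k A ((unopLinearMap S).rTensor A u) = algebraMap k A c) (v : A ⊗[k] A) :
    LinearMap.mul' k A ((unopLinearMap S).rTensor A (u * v)) =
      algebraMap k A c * LinearMap.mul' k A ((unopLinearMap S).rTensor A v) := by
  induction v with
  | zero => simp
  | add v w hv hw => simp only [map_add, hv, hw, mul_add]
  | tmul a b => rw [mul'_rTensor_mul_tmul, hu, ← Algebra.commutes, mul_assoc]; simp

theorem mul'_lTensor_mul {v : A ⊗[k] A} {c : k}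
    (hv : LinearMap.mul' k A ((unopLinearMap S).lTensor A v) = algebraMap k A c) (u : A ⊗[k] A) :
    LinearMap.mul' k A ((unopLinearMap S).lTensor A (u * v)) =
      algebraMap k A c * LinearMap.mul' k A ((unopLinearMap S).lTensor A u) := by
  induction u with
  | zero => simp
  | add v w hv hw => simp only [map_add, hv, hw, mul_add, add_mul]
  | tmul a b => rw [mul'_lTensor_tmul_mul, hv, ← Algebra.commutes, mul_assoc]; simp

theorem algHom_pow_apply_eq_add_nsmul {f : A →ₐ[k] A} {a c : A} (ha : f a = a + c) (hc : f c = c)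
    (n : ℕ) : (f ^ n) a = a + n • c := by
  induction n with
  | zero => simp
  | succ n ih => rw [pow_succ', AlgHom.mul_apply, ih, map_add, map_nsmul, ha, hc, succ_nsmul']; abel

end Antipode

section HopfAlgebra

variable {k : Type*} [Field k] {p : ℕ} {A : Type*} [Ring A] [Algebra k A]
  {X₁ X₂ Z E G U₁ U₂ : A}

/-- The prescribed values of the comultiplication on the generators. -/
structure IsComul (X₁ X₂ Z E G U₁ U₂ : A) (Δ : A →ₐ[k] A ⊗[k] A) : Prop where
  x1 : Δ X₁ = X₁ ⊗ₜ 1 + G ⊗ₜ X₁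
  x2 : Δ X₂ = X₂ ⊗ₜ 1 + G ⊗ₜ X₂
  z : Δ Z = Z ⊗ₜ 1 + 1 ⊗ₜ Z
  e : Δ E = E ⊗ₜ E
  ga : Δ G = G ⊗ₜ G
  u1 : Δ U₁ = U₁ ⊗ₜ 1 + E ⊗ₜ U₁
  u2 : Δ U₂ = U₂ ⊗ₜ 1 + E ⊗ₜ U₂ - (E * Z) ⊗ₜ U₁

/-- The prescribed values of the counit on the generators. -/
structure IsCounit (X₁ X₂ Z E G U₁ U₂ : A) (ct : A →ₐ[k] k) : Prop where
  x1 : ct X₁ = 0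
  x2 : ct X₂ = 0
  z : ct Z = 0
  e : ct E = 1
  ga : ct G = 1
  u1 : ct U₁ = 0
  u2 : ct U₂ = 0

/-- The values of the antipode on the generators. -/
structure IsAntipode (p : ℕ) (X₁ X₂ Z E G U₁ U₂ : A) (S : A →ₗ[k] A) : Prop where
  x1 : S X₁ = -(G ^ (2 * p - 1) * X₁)
  x2 : S X₂ = -(G ^ (2 * p - 1) * X₂)
  z : S Z = -Z
  e : S E = E
  ga : S G = G ^ (2 * p - 1)
  u1 : S U₁ = -(E * U₁)
  u2 : S U₂ = -(E * U₂ + E * Z * U₁)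

theorem realization_counit (hp : p.Prime) : Realization p (0 : k) 0 0 1 1 0 0 := by
  constructor <;> simp [hp.ne_zero]

theorem algHom_ext_of_adjoin (hgen : Algebra.adjoin k {X₁, X₂, Z, E, G, U₁, U₂} = ⊤)
    {B : Type*} [Semiring B] [Algebra k B] {f g : A →ₐ[k] B} (hx₁ : f X₁ = g X₁)
    (hx₂ : f X₂ = g X₂) (hz : f Z = g Z) (he : f E = g E) (hga : f G = g G) (hu₁ : f U₁ = g U₁)
    (hu₂ : f U₂ = g U₂) : f = g :=
  AlgHom.ext_of_adjoin_eq_top hgen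
    (by rintro _ (rfl | rfl | rfl | rfl | rfl | rfl | rfl) <;> assumption)

@[elab_as_elim]
theorem induction_of_adjoin (hgen : Algebra.adjoin k {X₁, X₂, Z, E, G, U₁, U₂} = ⊤)
    {C : A → Prop} (halg : ∀ r, C (algebraMap k A r)) (hadd : ∀ a b, C a → C b → C (a + b))
    (hmul : ∀ a b, C a → C b → C (a * b)) (hx₁ : C X₁) (hx₂ : C X₂) (hz : C Z)
    (he : C E) (hga : C G) (hu₁ : C U₁) (hu₂ : C U₂) (a : A) : C a := by
  have ha : a ∈ Algebra.adjoin k {X₁, X₂, Z, E, G, U₁, U₂} := hgen ▸ Algebra.mem_top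
  induction ha using Algebra.adjoin_induction with
  | mem x hx => rcases hx with rfl | rfl | rfl | rfl | rfl | rfl | rfl <;> assumption
  | algebraMap r => exact halg r
  | add x y _ _ hx hy => exact hadd x y hx hy
  | mul x y _ _ hx hy => exact hmul x y hx hy

variable {Δ : A →ₐ[k] A ⊗[k] A} {ct : A →ₐ[k] k} {S : A →ₐ[k] Aᵐᵒᵖ}

theorem IsComul.coassoc (hΔ : IsComul X₁ X₂ Z E G U₁ U₂ Δ)
    (hgen : Algebra.adjoin k {X₁, X₂, Z, E, G, U₁, U₂} = ⊤) :
    (assoc k A A A).toLinearMap ∘ₗ Δ.toLinearMap.rTensor A ∘ₗ Δ.toLinearMap =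
      Δ.toLinearMap.lTensor A ∘ₗ Δ.toLinearMap := by
  have : ((Algebra.TensorProduct.assoc k k k A A A).toAlgHom.comp
      (Algebra.TensorProduct.map Δ (AlgHom.id k A))).comp Δ =
      (Algebra.TensorProduct.map (AlgHom.id k A) Δ).comp Δ := by
    have hu₂ : Δ U₂ = U₂ ⊗ₜ 1 + E ⊗ₜ U₂ + (-1 : k) • (E * Z) ⊗ₜ U₁ := by
      simp [hΔ.u2, sub_eq_add_neg]
    apply algHom_ext_of_adjoin hgen <;>
    simp only [AlgHom.comp_apply, hΔ.x1, hΔ.x2, hΔ.z, hΔ.e, hΔ.ga, hΔ.u1, hu₂, map_add, map_smul,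
      map_mul, map_one, Algebra.TensorProduct.map_tmul, AlgHom.id_apply,
      Algebra.TensorProduct.tmul_mul_tmul, mul_add, mul_one, TensorProduct.add_tmul,
      TensorProduct.tmul_add, ← TensorProduct.smul_tmul', TensorProduct.tmul_smul, smul_add,
      Algebra.TensorProduct.one_def, AlgEquiv.toAlgHom_apply, Algebra.TensorProduct.assoc_tmul] <;>
    abel
  exact LinearMap.ext fun a => AlgHom.congr_fun this a

theorem IsComul.rTensor_counit (hΔ : IsComul X₁ X₂ Z E G U₁ U₂ Δ)
    (hgen : Algebra.adjoin k {X₁, X₂, Z, E, G, U₁, U₂} = ⊤)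
    (hct : IsCounit X₁ X₂ Z E G U₁ U₂ ct) :
    (lid k A).toLinearMap ∘ₗ ct.toLinearMap.rTensor A ∘ₗ Δ.toLinearMap = LinearMap.id := by
  have : ((Algebra.TensorProduct.lid k A).toAlgHom.comp
      (Algebra.TensorProduct.map ct (AlgHom.id k A))).comp Δ = AlgHom.id k A := by
    apply algHom_ext_of_adjoin hgen <;>
    simp [hΔ.x1, hΔ.x2, hΔ.z, hΔ.e, hΔ.ga, hΔ.u1, hΔ.u2, hct.x1, hct.x2, hct.z, hct.e, hct.ga,
      hct.u1, hct.u2]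
  exact LinearMap.ext fun a => AlgHom.congr_fun this a

theorem IsComul.lTensor_counit (hΔ : IsComul X₁ X₂ Z E G U₁ U₂ Δ)
    (hgen : Algebra.adjoin k {X₁, X₂, Z, E, G, U₁, U₂} = ⊤)
    (hct : IsCounit X₁ X₂ Z E G U₁ U₂ ct) :
    (rid k A).toLinearMap ∘ₗ ct.toLinearMap.lTensor A ∘ₗ Δ.toLinearMap = LinearMap.id := by
  have : ((Algebra.TensorProduct.rid k k A).toAlgHom.comp
      (Algebra.TensorProduct.map (AlgHom.id k A) ct)).comp Δ = AlgHom.id k A := by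
    apply algHom_ext_of_adjoin hgen <;>
    simp [hΔ.x1, hΔ.x2, hΔ.z, hΔ.e, hΔ.ga, hΔ.u1, hΔ.u2, hct.x1, hct.x2, hct.z, hct.e, hct.ga,
      hct.u1, hct.u2]
  exact LinearMap.ext fun a => AlgHom.congr_fun this a

theorem IsComul.mul'_rTensor_antipode (hΔ : IsComul X₁ X₂ Z E G U₁ U₂ Δ)
    (hgen : Algebra.adjoin k {X₁, X₂, Z, E, G, U₁, U₂} = ⊤)
    (hct : IsCounit X₁ X₂ Z E G U₁ U₂ ct)
    (hS : IsAntipode p X₁ X₂ Z E G U₁ U₂ (unopLinearMap S))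
    (h : Realization p X₁ X₂ Z E G U₁ U₂) (hp : p.Prime) :
    LinearMap.mul' k A ∘ₗ (unopLinearMap S).rTensor A ∘ₗ Δ.toLinearMap =
      Algebra.linearMap k A ∘ₗ ct.toLinearMap := by
  have hn := h.normalize
  have hi := h.normalize_inv (h.pow_pred_mul hp) (h.mul_pow_pred hp)
  refine LinearMap.ext fun a => ?_
  simp only [LinearMap.comp_apply, AlgHom.toLinearMap_apply, Algebra.linearMap_apply]
  refine induction_of_adjoin hgen (fun r => ?_) (fun a b ha hb => ?_) (fun a b ha hb => ?_)
    ?_ ?_ ?_ ?_ ?_ ?_ ?_ a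
  · simp [Algebra.algebraMap_eq_smul_one, Algebra.TensorProduct.one_def, unopLinearMap_one]
  · simp only [map_add, ha, hb]
  · rw [map_mul, mul'_rTensor_mul S ha, hb, map_mul, map_mul]
  all_goals
    simp only [hΔ.x1, hΔ.x2, hΔ.z, hΔ.e, hΔ.ga, hΔ.u1, hΔ.u2, hct.x1, hct.x2, hct.z, hct.e,
      hct.ga, hct.u1, hct.u2, hS.x1, hS.x2, hS.z, hS.e, hS.ga, hS.u1, hS.u2, map_add, map_sub,
      LinearMap.rTensor_tmul, LinearMap.mul'_apply, unopLinearMap_mul, unopLinearMap_one,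
      map_zero, map_one, mul_assoc, mul_neg, neg_mul, neg_neg, hn, hi, one_mul,
      mul_one]
    try abel

theorem IsComul.mul'_lTensor_antipode (hΔ : IsComul X₁ X₂ Z E G U₁ U₂ Δ)
    (hgen : Algebra.adjoin k {X₁, X₂, Z, E, G, U₁, U₂} = ⊤)
    (hct : IsCounit X₁ X₂ Z E G U₁ U₂ ct)
    (hS : IsAntipode p X₁ X₂ Z E G U₁ U₂ (unopLinearMap S))
    (h : Realization p X₁ X₂ Z E G U₁ U₂) (hp : p.Prime) :
    LinearMap.mul' k A ∘ₗ (unopLinearMap S).lTensor A ∘ₗ Δ.toLinearMap =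
      Algebra.linearMap k A ∘ₗ ct.toLinearMap := by
  have hn := h.normalize
  have hi := h.normalize_inv (h.pow_pred_mul hp) (h.mul_pow_pred hp)
  refine LinearMap.ext fun a => ?_
  simp only [LinearMap.comp_apply, AlgHom.toLinearMap_apply, Algebra.linearMap_apply]
  refine induction_of_adjoin hgen (fun r => ?_) (fun a b ha hb => ?_) (fun a b ha hb => ?_)
    ?_ ?_ ?_ ?_ ?_ ?_ ?_ a
  · simp [Algebra.algebraMap_eq_smul_one, Algebra.TensorProduct.one_def, unopLinearMap_one]
  · simp only [map_add, ha, hb]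
  · rw [map_mul, mul'_lTensor_mul S hb, ha, ← Algebra.commutes, map_mul, map_mul]
  all_goals
    simp only [hΔ.x1, hΔ.x2, hΔ.z, hΔ.e, hΔ.ga, hΔ.u1, hΔ.u2, hct.x1, hct.x2, hct.z, hct.e,
      hct.ga, hct.u1, hct.u2, hS.x1, hS.x2, hS.z, hS.e, hS.ga, hS.u1, hS.u2, map_add, map_sub,
      LinearMap.lTensor_tmul, LinearMap.mul'_apply, unopLinearMap_one,
      map_zero, map_one, mul_assoc, mul_add, add_mul, mul_neg, neg_mul, neg_neg, hn, hi, one_mul,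
      mul_one, mul_sub]
    try abel

theorem IsAntipode.unopSq_generators (hS : IsAntipode p X₁ X₂ Z E G U₁ U₂ (unopLinearMap S))
    (h : Realization p X₁ X₂ Z E G U₁ U₂) (hp : p.Prime) :
    unopSq S X₁ = -X₁ ∧ unopSq S X₂ = -X₂ - X₁ ∧ unopSq S Z = Z ∧ unopSq S E = E ∧
      unopSq S G = G ∧ unopSq S U₁ = -U₁ ∧ unopSq S U₂ = -U₂ + U₁ := by
  have hn := h.normalize
  have hi := h.normalize_inv (h.pow_pred_mul hp) (h.mul_pow_pred hp)
  have hga : unopLinearMap S (G ^ (2 * p - 1)) = G := by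
    rw [unopLinearMap_pow, hS.ga]
    have hinv : G ^ (2 * p - 1) * (G ^ (2 * p - 1)) ^ (2 * p - 1) = 1 := by
      rw [← pow_succ', Nat.sub_add_cancel (by have := hp.pos; omega), ← pow_mul, mul_comm, pow_mul,
        h.gapow, one_pow]
    exact (left_inv_eq_right_inv (h.mul_pow_pred hp) hinv).symm
  simp only [unopSq_apply, hS.x1, hS.x2, hS.z, hS.e, hS.ga, hS.u1, hS.u2, hga, map_neg, map_add,
    unopLinearMap_mul]
  refine ⟨?_, ?_, ?_, ?_, ?_, ?_, ?_⟩ <;>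
  simp only [mul_assoc, mul_add, add_mul, sub_mul, mul_neg, neg_mul, neg_neg, hn, hi, mul_one]
  abel

theorem IsAntipode.bijective (hS : IsAntipode p X₁ X₂ Z E G U₁ U₂ (unopLinearMap S))
    (hgen : Algebra.adjoin k {X₁, X₂, Z, E, G, U₁, U₂} = ⊤)
    (h : Realization p X₁ X₂ Z E G U₁ U₂) (hp : p.Prime) (hA : (p : A) = 0) :
    Function.Bijective (unopLinearMap S) := by
  obtain ⟨hx₁, hx₂, hz, he, hga, hu₁, hu₂⟩ := hS.unopSq_generators h hp
  refine unopLinearMap_bijective S (n := 2 * p) (mul_ne_zero two_ne_zero hp.ne_zero) ?_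
  have hfix {a c : A} (ha : (unopSq S ^ 2) a = a + c) (hc : (unopSq S ^ 2) c = c) :
      (unopSq S ^ (2 * p)) a = a := by
    rw [pow_mul, algHom_pow_apply_eq_add_nsmul ha hc, nsmul_eq_mul, hA, zero_mul, add_zero]
  have hfix₀ {a : A} (ha : (unopSq S ^ 2) a = a) : (unopSq S ^ (2 * p)) a = a :=
    hfix (c := 0) (by rw [ha, add_zero]) (map_zero _)
  apply algHom_ext_of_adjoin hgen
  · exact hfix₀ (by simp [sq, hx₁])
  · exact hfix (c := X₁ + X₁) (by simp [sq, hx₁, hx₂]; abel) (by simp [sq, hx₁])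
  · exact hfix₀ (by simp [sq, hz])
  · exact hfix₀ (by simp [sq, he])
  · exact hfix₀ (by simp [sq, hga])
  · exact hfix₀ (by simp [sq, hu₁])
  · exact hfix (c := -U₁ - U₁) (by simp [sq, hu₁, hu₂]; abel) (by simp [sq, hu₁]; try abel)

end HopfAlgebra

end RestrictedDoubleDH

/-- `D(H)` admits a Hopf `k`-algebra structure (with bijective
antipode) whose comultiplication `Δ` (an algebra map `D(H) → D(H) ⊗ D(H)`) and
counit (an algebra map `D(H) → k`) take the prescribed values on the generators:
`Δ(γ) = γ⊗γ`, `Δ(ε) = ε⊗ε`, `Δ(ζ) = ζ⊗1 + 1⊗ζ`, `Δ(x1) = x1⊗1 + γ⊗x1`,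
`Δ(x2) = x2⊗1 + γ⊗x2`, `Δ(u1) = u1⊗1 + ε⊗u1`,
`Δ(u2) = u2⊗1 + ε⊗u2 - εζ⊗u1`, the counit sends `γ, ε ↦ 1` and
`ζ, x1, x2, u1, u2 ↦ 0`.  The Hopf axioms (coassociativity, the counit axioms
and the antipode axioms) are stated explicitly. -/
theorem restrictedDoubleDH_hopf (p : ℕ) (hp : p.Prime) (hp2 : 2 < p)
    (k : Type) [Field k] [CharP k p] :
    ∃ (Δ : DH k p →ₐ[k] (DH k p ⊗[k] DH k p)) (ct : DH k p →ₐ[k] k)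
      (S : DH k p →ₗ[k] DH k p),
      -- coassociativity
      (assoc k (DH k p) (DH k p) (DH k p)).toLinearMap ∘ₗ
          Δ.toLinearMap.rTensor (DH k p) ∘ₗ Δ.toLinearMap =
        Δ.toLinearMap.lTensor (DH k p) ∘ₗ Δ.toLinearMap ∧
      -- counit axioms
      (lid k (DH k p)).toLinearMap ∘ₗ ct.toLinearMap.rTensor (DH k p) ∘ₗ Δ.toLinearMap =
        LinearMap.id ∧
      (rid k (DH k p)).toLinearMap ∘ₗ ct.toLinearMap.lTensor (DH k p) ∘ₗ Δ.toLinearMap =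
        LinearMap.id ∧
      -- antipode axioms
      LinearMap.mul' k (DH k p) ∘ₗ S.rTensor (DH k p) ∘ₗ Δ.toLinearMap =
        Algebra.linearMap k (DH k p) ∘ₗ ct.toLinearMap ∧
      LinearMap.mul' k (DH k p) ∘ₗ S.lTensor (DH k p) ∘ₗ Δ.toLinearMap =
        Algebra.linearMap k (DH k p) ∘ₗ ct.toLinearMap ∧
      -- the antipode is bijective
      Function.Bijective S ∧
      -- values of the comultiplication on the generators
      Δ (ga k p) = ga k p ⊗ₜ[k] ga k p ∧
      Δ (e k p) = e k p ⊗ₜ[k] e k p ∧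
      Δ (z k p) = z k p ⊗ₜ[k] 1 + 1 ⊗ₜ[k] z k p ∧
      Δ (x1 k p) = x1 k p ⊗ₜ[k] 1 + ga k p ⊗ₜ[k] x1 k p ∧
      Δ (x2 k p) = x2 k p ⊗ₜ[k] 1 + ga k p ⊗ₜ[k] x2 k p ∧
      Δ (u1 k p) = u1 k p ⊗ₜ[k] 1 + e k p ⊗ₜ[k] u1 k p ∧
      Δ (u2 k p) = u2 k p ⊗ₜ[k] 1 + e k p ⊗ₜ[k] u2 k p -
        (e k p * z k p) ⊗ₜ[k] u1 k p ∧
      -- values of the counit on the generators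
      ct (ga k p) = 1 ∧ ct (e k p) = 1 ∧ ct (z k p) = 0 ∧
      ct (x1 k p) = 0 ∧ ct (x2 k p) = 0 ∧ ct (u1 k p) = 0 ∧ ct (u2 k p) = 0 := by
  have h := realization_generators k p
  have hR : (p : DH k p) = 0 := Realization.natCast_prime_eq_zero k _
  obtain ⟨Δ, hΔ⟩ : ∃ Δ : DH k p →ₐ[k] DH k p ⊗[k] DH k p, IsComul (x1 k p) (x2 k p) (z k p)
      (e k p) (ga k p) (u1 k p) (u2 k p) Δ := by
    obtain ⟨h₁, h₂, h₃, h₄, h₅, h₆, h₇⟩ := (h.tensorProduct k hp).lift_generators (k := k)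
    exact ⟨_, h₁, h₂, h₃, h₄, h₅, h₆, h₇⟩
  obtain ⟨ct, hct⟩ : ∃ ct : DH k p →ₐ[k] k, IsCounit (x1 k p) (x2 k p) (z k p) (e k p) (ga k p)
      (u1 k p) (u2 k p) ct := by
    obtain ⟨h₁, h₂, h₃, h₄, h₅, h₆, h₇⟩ := (realization_counit (k := k) hp).lift_generators (k := k)
    exact ⟨_, h₁, h₂, h₃, h₄, h₅, h₆, h₇⟩
  obtain ⟨S, hS⟩ : ∃ S : DH k p →ₐ[k] (DH k p)ᵐᵒᵖ, IsAntipode p (x1 k p) (x2 k p) (z k p)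
      (e k p) (ga k p) (u1 k p) (u2 k p) (unopLinearMap S) := by
    obtain ⟨h₁, h₂, h₃, h₄, h₅, h₆, h₇⟩ := (h.opposite hp hp2 hR).lift_generators (k := k)
    exact ⟨_, congrArg MulOpposite.unop h₁, congrArg MulOpposite.unop h₂,
      congrArg MulOpposite.unop h₃, congrArg MulOpposite.unop h₄, congrArg MulOpposite.unop h₅,
      congrArg MulOpposite.unop h₆, congrArg MulOpposite.unop h₇⟩
  have hgen := adjoin_generators k p
  exact ⟨Δ, ct, unopLinearMap S, hΔ.coassoc hgen, hΔ.rTensor_counit hgen hct,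
    hΔ.lTensor_counit hgen hct, hΔ.mul'_rTensor_antipode hgen hct hS h hp,
    hΔ.mul'_lTensor_antipode hgen hct hS h hp, hS.bijective hgen h hp hR,
    hΔ.ga, hΔ.e, hΔ.z, hΔ.x1, hΔ.x2, hΔ.u1, hΔ.u2,
    hct.ga, hct.e, hct.z, hct.x1, hct.x2, hct.u1, hct.u2⟩
end
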